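/- For l ≥ 2 and n ≥ 0, the 2-enumeration of (2n+1, l)-alternating sign trapezoids (the sum over all (2n+1,l)-alternating sign trapezoids A of 2^{q(A)}, where q(A) is the number of -1 entries in A) equals 2^{n+1} ( ∏_{1 ≤ i ≤ j ≤ n} (2(i+j) + l - 3)/(2i - 1) )². -/

import Mathlib

/-- An `(n,l)`-alternating sign trapezoid (for `l ≥ 2`): a trapezoidal array of `-1`s, `0`s
and `1`s with `n` rows, the top row having `2n+l-2` entries and each subsequent row two fewer
entries centred below.  Rows are indexed by `0 ≤ i < n` and columns by `0 ≤ j < 2n+l-2`; the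
entry `a i j` sits in row `i`, column `j`, and row `i` occupies columns `i ≤ j ≤ 2n+l-3-i`
(entries outside the trapezoid are `0`).  Conditions: the nonzero entries alternate in sign
along each row and each column, the topmost nonzero entry of each column is `1`, each row sums
to `1`, and each of the `l-2` central columns (columns `n ≤ j ≤ n+l-3`) sums to `0`. -/
structure AST (n l : ℕ) where
  a : ℕ → ℕ → ℤ
  entries : ∀ i j, a i j = -1 ∨ a i j = 0 ∨ a i j = 1
  outside : ∀ i j, (n ≤ i ∨ j < i ∨ 2 * n + l - 3 - i < j) → a i j = 0
  row_sum : ∀ i, i < n → ∑ j ∈ Finset.range (2 * n + l - 2), a i j = 1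
  row_alt : ∀ i j₁ j₂, j₁ < j₂ → a i j₁ ≠ 0 → a i j₂ ≠ 0 →
    (∀ j', j₁ < j' → j' < j₂ → a i j' = 0) → a i j₂ = -a i j₁
  col_alt : ∀ j i₁ i₂, i₁ < i₂ → a i₁ j ≠ 0 → a i₂ j ≠ 0 →
    (∀ i', i₁ < i' → i' < i₂ → a i' j = 0) → a i₂ j = -a i₁ j
  col_top : ∀ i j, a i j ≠ 0 → (∀ i', i' < i → a i' j = 0) → a i j = 1
  central_sum : ∀ j, n ≤ j → j < n + l - 2 → ∑ i ∈ Finset.range n, a i j = 0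

variable {n l : ℕ}

/-- The sum of the entries of column `j`. -/
def colSum (A : AST n l) (j : ℕ) : ℤ := ∑ i ∈ Finset.range n, A.a i j

/-- The row index of the bottom entry of column `j`. -/
def botRow (n l j : ℕ) : ℕ := min j (min (2 * n + l - 3 - j) (n - 1))

/-- Column `j` is a `1`-column: its entries sum to `1`. -/
def IsOneCol (A : AST n l) (j : ℕ) : Prop := colSum A j = 1

/-- Column `j` is a `10`-column: a `1`-column whose bottom entry is `0`. -/
def IsTenCol (A : AST n l) (j : ℕ) : Prop := colSum A j = 1 ∧ A.a (botRow n l j) j = 0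

/-- `q(A)`: the number of `-1`s in `A`. -/
def qStat (A : AST n l) : ℕ :=
  ∑ i ∈ Finset.range n, ∑ j ∈ Finset.range (2 * n + l - 2), if A.a i j = -1 then 1 else 0

/-- `r(A)`: the number of `1`-columns among the `n` leftmost columns. -/
def rStat (A : AST n l) : ℕ :=
  ((Finset.range n).filter fun j => colSum A j = 1).card

/-- `s(A)`: the number of `10`-columns among the `n` leftmost columns. -/
def sStat (A : AST n l) : ℕ :=
  ((Finset.range n).filter fun j => colSum A j = 1 ∧ A.a (botRow n l j) j = 0).card

/-- `t(A)`: the number of `10`-columns among the `n` rightmost columns. -/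
def tStat (A : AST n l) : ℕ :=
  ((Finset.Ico (n + l - 2) (2 * n + l - 2)).filter
    fun j => colSum A j = 1 ∧ A.a (botRow n l j) j = 0).card

open Finset

/-- determinant of the K×K corner of an infinite array -/
def cdet (K : ℕ) (r : ℕ → ℕ → ℚ) : ℚ := (Matrix.of fun i j : Fin K => r i j).det

def skp (i0 i : ℕ) : ℕ := if i < i0 then i else i + 1

lemma cdet_congr {K : ℕ} {r s : ℕ → ℕ → ℚ} (h : ∀ i < K, ∀ j < K, r i j = s i j) :
    cdet K r = cdet K s := by
  unfold cdet
  congr 1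
  ext i j
  exact h i i.2 j j.2

lemma cdet_exp0 (K i0 : ℕ) (hi : i0 ≤ K) (r : ℕ → ℕ → ℚ)
    (h0 : r i0 0 = 1) (h : ∀ j, 0 < j → j ≤ K → r i0 j = 0) :
    cdet (K+1) r = (-1)^i0 * cdet K (fun i j => r (skp i0 i) (j+1)) := by
  unfold cdet
  rw [Matrix.det_succ_row _ (⟨i0, by omega⟩ : Fin (K+1)), Finset.sum_eq_single (0 : Fin (K+1))]
  · simp only [Matrix.of_apply, Fin.val_zero, h0, add_zero, mul_one]
    congr 2
    ext i j
    simp [Fin.succAbove, Fin.lt_def, skp]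
    split_ifs <;> rfl
  · intro j _ hj
    rw [Matrix.of_apply, h j (Nat.pos_of_ne_zero (fun hh => hj (Fin.ext hh))) (by omega)]
    simp
  · simp

lemma cdet_expL (K i0 : ℕ) (hi : i0 ≤ K) (r : ℕ → ℕ → ℚ)
    (h0 : r i0 K = 1) (h : ∀ j, j < K → r i0 j = 0) :
    cdet (K+1) r = (-1)^(i0+K) * cdet K (fun i j => r (skp i0 i) j) := by
  unfold cdet
  rw [Matrix.det_succ_row _ (⟨i0, by omega⟩ : Fin (K+1)), Finset.sum_eq_single (Fin.last K)]
  · simp only [Matrix.of_apply, Fin.val_last, h0, mul_one]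
    congr 2
    ext i j
    simp [Fin.succAbove, Fin.lt_def, skp]
    split_ifs <;> rfl
  · intro j _ hj
    rw [Matrix.of_apply, h j (by
      have := j.2
      have : j.1 ≠ K := fun hh => hj (Fin.ext hh)
      omega)]
    simp
  · simp

/-- Plücker relation -/
lemma plucker (K : ℕ) (M : Matrix (Fin K) (Fin K) ℚ) (a b : Fin K) (hab : a ≠ b)
    (p q : Fin K → ℚ) :
    M.det * ((M.updateRow a p).updateRow b q).det =
      (M.updateRow a p).det * (M.updateRow b q).det
      + (M.updateRow b p).det * ((M.updateRow a (M b)).updateRow b q).det := by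
  classical
  -- linear functional
  let φ : (Fin K → ℚ) → ℚ := fun x => ((M.updateRow b q).updateRow a x).det
  have hadd : ∀ x y, φ (x + y) = φ x + φ y := fun x y => by
    simp only [φ]; rw [Matrix.det_updateRow_add]
  have hsm : ∀ (c : ℚ) x, φ (c • x) = c * φ x := fun c x => by
    simp only [φ]; rw [Matrix.det_updateRow_smul]
  let Φ : (Fin K → ℚ) →ₗ[ℚ] ℚ := ⟨⟨φ, hadd⟩, fun c x => by simp [hsm]⟩
  have key : M.det • p = ∑ i, (M.updateRow i p).det • M i := by
    have := Matrix.mulVec_cramer M.transpose p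
    rw [Matrix.det_transpose] at this
    rw [← this]
    ext j
    simp [Matrix.mulVec, dotProduct, Matrix.cramer_apply, Finset.sum_apply, mul_comm,
      Matrix.updateCol_transpose, Matrix.det_transpose]
  have h2 := congrArg Φ key
  rw [map_smul, map_sum] at h2
  simp only [map_smul] at h2
  have hz : ∀ i, i ≠ a → i ≠ b → Φ (M i) = 0 := by
    intro i hia hib
    change ((M.updateRow b q).updateRow a (M i)).det = 0
    apply Matrix.det_zero_of_row_eq hia.symm
    ext j
    rw [Matrix.updateRow_self, Matrix.updateRow_ne hia, Matrix.updateRow_ne hib]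
  rw [← Finset.sum_subset (Finset.subset_univ {a, b})] at h2
  · rw [Finset.sum_pair hab] at h2
    simp only [smul_eq_mul] at h2
    have e1 : Φ p = ((M.updateRow a p).updateRow b q).det := by
      change ((M.updateRow b q).updateRow a p).det = _
      rw [Matrix.updateRow_comm _ hab]
    have e2 : Φ (M a) = (M.updateRow b q).det := by
      change ((M.updateRow b q).updateRow a (M a)).det = _
      congr 1
      rw [← Matrix.updateRow_comm _ hab, Matrix.updateRow_eq_self]
    have e3 : Φ (M b) = ((M.updateRow a (M b)).updateRow b q).det := by
      change ((M.updateRow b q).updateRow a (M b)).det = _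
      rw [Matrix.updateRow_comm _ hab]
    rw [e1, e2, e3] at h2
    exact h2
  · intro i _ hi
    simp only [Finset.mem_insert, Finset.mem_singleton, not_or] at hi
    rw [hz i hi.1 hi.2]; simp

/-- array with first row p and row K+1 equal to q -/
def ins (K : ℕ) (r : ℕ → ℕ → ℚ) (p q : ℕ → ℚ) : ℕ → ℕ → ℚ :=
  fun i => if i = 0 then p else if i = K + 1 then q else r i

lemma plucker' (K : ℕ) (r : ℕ → ℕ → ℚ) (e f p q : ℕ → ℚ) :
    cdet (K+2) (ins K r e f) * cdet (K+2) (ins K r p q) =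
    cdet (K+2) (ins K r p f) * cdet (K+2) (ins K r e q)
    + cdet (K+2) (ins K r e p) * cdet (K+2) (ins K r f q) := by
  have hne : (0 : Fin (K+2)) ≠ Fin.last (K+1) := by intro h; simp [Fin.ext_iff] at h
  have h := plucker (K+2) (Matrix.of fun i j : Fin (K+2) => ins K r e f i j) 0 (Fin.last (K+1))
    hne (fun j => p j) (fun j => q j)
  have u1 : ∀ (e f p : ℕ → ℚ), (Matrix.of fun i j : Fin (K+2) => ins K r e f i j).updateRow 0
      (fun j => p j) = Matrix.of fun i j : Fin (K+2) => ins K r p f i j := by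
    intro e f p
    ext i j
    by_cases hi : i = 0
    · subst hi; rw [Matrix.updateRow_self]; simp [ins]
    · rw [Matrix.updateRow_ne hi]
      simp [ins, hi]
  have u2 : ∀ (e f p : ℕ → ℚ), (Matrix.of fun i j : Fin (K+2) => ins K r e f i j).updateRow
      (Fin.last (K+1))
      (fun j => p j) = Matrix.of fun i j : Fin (K+2) => ins K r e p i j := by
    intro e f p
    ext i j
    by_cases hi : i = Fin.last (K+1)
    · subst hi; rw [Matrix.updateRow_self]; simp [ins]
    · rw [Matrix.updateRow_ne hi]
      have : (i : ℕ) ≠ K+1 := fun hh => hi (Fin.ext hh)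
      simp [ins, this]
  have u3 : (Matrix.of fun i j : Fin (K+2) => ins K r e f i j) (Fin.last (K+1)) =
      (fun j : Fin (K+2) => f j) := by
    ext j; simp [ins]
  rw [u3, u1, u1, u2, u2, u2, u2] at h
  exact h

lemma ins_swap (K : ℕ) (r : ℕ → ℕ → ℚ) (e p : ℕ → ℚ) :
    cdet (K+2) (ins K r e p) = - cdet (K+2) (ins K r p e) := by
  have hne : (0 : Fin (K+2)) ≠ Fin.last (K+1) := by intro h; simp [Fin.ext_iff] at h
  have h := Matrix.det_permute (Equiv.swap (0 : Fin (K+2)) (Fin.last (K+1)))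
    (Matrix.of fun i j : Fin (K+2) => ins K r p e i j)
  rw [Equiv.Perm.sign_swap hne] at h
  unfold cdet
  have h' : ∀ x : ℚ, -x = ((-1 : ℤˣ) : ℤ) * x := by intro x; simp
  rw [h', ← h]
  congr 1
  ext i j
  simp only [Matrix.submatrix_apply, id, Matrix.of_apply]
  by_cases h0 : i = 0
  · subst h0; simp [ins]
  · by_cases h1 : i = Fin.last (K+1)
    · subst h1; simp [ins]
    · rw [Equiv.swap_apply_of_ne_of_ne h0 h1]
      have a1 : (i : ℕ) ≠ K+1 := fun hh => h1 (Fin.ext hh)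
      simp [ins, h0, a1]

theorem dodgson (K : ℕ) (r : ℕ → ℕ → ℚ) :
    cdet (K+2) r * cdet K (fun i j => r (i+1) (j+1)) =
    cdet (K+1) r * cdet (K+1) (fun i j => r (i+1) (j+1))
    - cdet (K+1) (fun i j => r i (j+1)) * cdet (K+1) (fun i j => r (i+1) j) := by
  let e : ℕ → ℚ := fun j => if j = 0 then 1 else 0
  let f : ℕ → ℚ := fun j => if j = K + 1 then 1 else 0
  have h := plucker' K r e f (r 0) (r (K+1))
  rw [ins_swap K r e (r 0)] at h
  have e0 : cdet (K+2) (ins K r (r 0) (r (K+1))) = cdet (K+2) r := by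
    apply cdet_congr
    intro i _ j _
    unfold ins; split_ifs with h1 h2
    · rw [h1]
    · rw [h2]
    · rfl
  have e1 : cdet (K+2) (ins K r e f) = cdet K (fun i j => r (i+1) (j+1)) := by
    rw [cdet_exp0 (K+1) 0 (by omega) _ (by simp [ins, e])
      (by intro j hj _; simp [ins, e]; omega)]
    rw [cdet_expL K K (by omega) _ (by simp [ins, skp, f])
      (by intro j hj; simp [ins, skp, f]; omega), ← two_mul, pow_mul]
    simp only [even_two, Even.neg_pow, one_pow, one_mul, pow_zero]
    apply cdet_congr
    intro i hi j _
    simp [ins, skp, hi, hi.ne]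
  have e2 : cdet (K+2) (ins K r (r 0) f) = cdet (K+1) r := by
    rw [cdet_expL (K+1) (K+1) (by omega) _ (by simp [ins, f])
      (by intro j hj; simp [ins, f]; omega), ← two_mul, pow_mul]
    simp only [even_two, Even.neg_pow, one_pow, one_mul]
    apply cdet_congr
    intro i hi j _
    simp only [ins, skp, hi, if_true, hi.ne, if_false]
    split_ifs with h1
    · rw [h1]
    · rfl
  have e3 : cdet (K+2) (ins K r e (r (K+1))) = cdet (K+1) (fun i j => r (i+1) (j+1)) := by
    rw [cdet_exp0 (K+1) 0 (by omega) _ (by simp [ins, e])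
      (by intro j hj _; simp [ins, e]; omega), pow_zero, one_mul]
    apply cdet_congr
    intro i hi j _
    simp only [ins, skp, Nat.not_lt_zero, if_false, Nat.succ_ne_zero]
    split_ifs with h1
    · rw [h1]
    · rfl
  have e4 : cdet (K+2) (ins K r (r 0) e) = (-1)^(K+1) * cdet (K+1) (fun i j => r i (j+1)) := by
    rw [cdet_exp0 (K+1) (K+1) (by omega) _ (by simp [ins, e])
      (by intro j hj _; simp [ins, e]; omega)]
    congr 1
    apply cdet_congr
    intro i hi j _
    simp only [ins, skp, hi, if_true, hi.ne, if_false]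
    split_ifs with h1
    · rw [h1]
    · rfl
  have e5 : cdet (K+2) (ins K r f (r (K+1))) = (-1)^(K+1) * cdet (K+1) (fun i j => r (i+1) j) := by
    rw [cdet_expL (K+1) 0 (by omega) _ (by simp [ins, f])
      (by intro j hj; simp [ins, f]; omega), zero_add]
    congr 1
    apply cdet_congr
    intro i hi j _
    simp only [ins, skp, Nat.not_lt_zero, if_false, Nat.succ_ne_zero]
    split_ifs with h1
    · rw [h1]
    · rfl
  rw [e0, e1, e2, e3, e4, e5] at h
  have hs : ((-1 : ℚ)^(K+1)) * (-1)^(K+1) = 1 := by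
    rw [← mul_pow]; norm_num
  linear_combination h - (cdet (K+1) (fun i j => r i (j+1)) *
    cdet (K+1) (fun i j => r (i+1) j)) * hs

open Finset PowerSeries

/-- `((1+t)/(1-t))^y` -/
noncomputable def US (y : ℚ) : PowerSeries ℚ :=
  PowerSeries.binomialSeries ℚ y * rescale (-1 : ℚ) (PowerSeries.binomialSeries ℚ (-y))

lemma US_add (y z : ℚ) : US (y + z) = US y * US z := by
  unfold US
  rw [neg_add, binomialSeries_add, binomialSeries_add, map_mul]
  ring

lemma US_zero : US 0 = 1 := by
  unfold US
  simp

lemma US_neg_mul (y : ℚ) : US (-y) * US y = 1 := by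
  rw [← US_add]; simp [US_zero]

lemma rescale_rescale_neg (F : PowerSeries ℚ) : rescale (-1 : ℚ) (rescale (-1 : ℚ) F) = F := by
  rw [rescale_rescale]; simp

lemma US_rescale (y : ℚ) : rescale (-1 : ℚ) (US y) = US (-y) := by
  unfold US
  rw [map_mul, rescale_rescale_neg, neg_neg, mul_comm]

lemma US_one : US 1 * (1 - X) = 1 + X := by
  have h1 : PowerSeries.binomialSeries ℚ (1 : ℚ) = 1 + X := by
    have := binomialSeries_nat (R := ℚ) (A := ℚ) 1
    simpa using this
  have h2 : rescale (-1 : ℚ) (PowerSeries.binomialSeries ℚ (-1 : ℚ)) * (1 - X) = 1 := by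
    have h3 : (1 - X : PowerSeries ℚ) = rescale (-1 : ℚ) (PowerSeries.binomialSeries ℚ (1 : ℚ)) := by
      rw [h1, map_add, rescale_neg_one_X]; simp [sub_eq_add_neg]
    rw [h3, ← map_mul, ← binomialSeries_add]
    simp
  unfold US
  rw [mul_assoc, h2, h1, mul_one]

lemma US_const (y : ℚ) : constantCoeff (US y) = 1 := by
  unfold US
  rw [map_mul, binomialSeries_constantCoeff, ← coeff_zero_eq_constantCoeff_apply, coeff_rescale]
  simp

lemma US_coeff_zero (y : ℚ) : coeff 0 (US y) = 1 := by
  rw [coeff_zero_eq_constantCoeff_apply, US_const]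

lemma US_poly (d : ℕ) : ∃ p : Polynomial ℚ, ∀ y, p.eval y = coeff d (US y) := by
  have hc : ∀ k : ℕ, ∃ p : Polynomial ℚ, ∀ y, p.eval y = Ring.choose y k := by
    intro k
    refine ⟨Polynomial.C ((k.factorial : ℚ)⁻¹) * descPochhammer ℚ k, fun y => ?_⟩
    rw [Ring.choose_eq_smul, Polynomial.eval_mul, Polynomial.eval_C, smul_eq_mul]
    congr 1
    rw [← descPochhammer_map (algebraMap ℤ ℚ) k, Polynomial.eval_map, ← Polynomial.aeval_def,
      Polynomial.aeval_eq_smeval]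
  choose p hp using hc
  refine ⟨∑ x ∈ antidiagonal d, p x.1 * (Polynomial.C ((-1)^x.2) * (p x.2).comp (-Polynomial.X)),
    fun y => ?_⟩
  rw [Polynomial.eval_finsetSum]
  unfold US
  rw [coeff_mul]
  apply Finset.sum_congr rfl
  intro x _
  simp [hp, coeff_rescale]

/-- f-row entries -/
noncomputable def ff (P : ℚ) (i k : ℕ) : ℚ := coeff (2*i+1) (X^k * US (P + k))

lemma ff_zero_one (P : ℚ) : ff P 0 1 = 1 := by
  unfold ff
  rw [show (2*0+1) = 0 + 1 from rfl, coeff_X_pow_mul, US_coeff_zero]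

lemma ff_lt (P : ℚ) (i k : ℕ) (h : 2*i+1 < k) : ff P i k = 0 := by
  unfold ff
  rw [coeff_X_pow_mul', if_neg (by omega)]

lemma ff_succ (P : ℚ) (i k : ℕ) : ff P (i+1) (k+2) = ff (P+2) i k := by
  unfold ff
  rw [show P + ((k+2 : ℕ) : ℚ) = P + 2 + k by push_cast; ring]
  rw [show 2*(i+1)+1 = 2*i+1+2 by ring, show k+2 = 2 + k by ring, pow_add, mul_assoc, coeff_X_pow_mul]

lemma ff_zero (i : ℕ) : ff 0 i 0 = 0 := by
  unfold ff
  simp [US_zero, coeff_one]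

lemma ff_zero_zero (P : ℚ) : ff P 0 0 = 2 * P := by
  unfold ff US
  simp only [mul_zero, zero_add, pow_zero, one_mul, Nat.cast_zero, add_zero]
  rw [coeff_mul]
  rw [Finset.Nat.sum_antidiagonal_eq_sum_range_succ_mk]
  simp [Finset.sum_range_succ, coeff_rescale]
  ring


lemma sum_even_terms (g : ℕ → ℚ) (hg : ∀ j, g (2*j+1) = 0) (n : ℕ) :
    ∑ k ∈ range (2*n), g k = ∑ j ∈ range n, g (2*j) := by
  induction n with
  | zero => simp
  | succ n ih =>
    rw [show 2*(n+1) = 2*n+1+1 by ring, sum_range_succ, sum_range_succ, ih, hg, sum_range_succ,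
      add_zero]

lemma coeff_odd_even (E : PowerSeries ℚ) (hE : rescale (-1 : ℚ) E = E) (j : ℕ) :
    coeff (2*j+1) E = 0 := by
  have h := congrArg (coeff (2*j+1)) hE
  rw [coeff_rescale, pow_succ, pow_mul] at h
  simp at h
  linarith

lemma even_expand (E : PowerSeries ℚ) (hE : rescale (-1 : ℚ) E = E) (F : PowerSeries ℚ) (i : ℕ) :
    coeff (2*i+1) (E * F) = ∑ j ∈ range (i+1), coeff (2*(i-j)) E * coeff (2*j+1) F := by
  rw [coeff_mul, Finset.Nat.sum_antidiagonal_eq_sum_range_succ_mk]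
  rw [show (2*i+1).succ = 2*(i+1) by omega, sum_even_terms _ (fun j => by
    simp [coeff_odd_even E hE j])]
  rw [← Finset.sum_range_reflect]
  apply Finset.sum_congr rfl
  intro j hj
  rw [mem_range] at hj
  dsimp only
  rw [show 2*(i+1-1-j) = 2*(i-j) by omega, show 2*i+1-2*(i-j) = 2*j+1 by omega]

/-- multiplying by an even series with constant term one does not change odd-row determinants -/
lemma cdet_even (a : ℕ) (E : PowerSeries ℚ) (hE : rescale (-1 : ℚ) E = E)
    (h0 : constantCoeff E = 1) (F : ℕ → PowerSeries ℚ) :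
    cdet a (fun i k => coeff (2*i+1) (E * F k)) = cdet a (fun i k => coeff (2*i+1) (F k)) := by
  let C : Matrix (Fin a) (Fin a) ℚ :=
    Matrix.of fun i j => if (j : ℕ) ≤ i then coeff (2*((i:ℕ)-j)) E else 0
  have hC : C.det = 1 := by
    rw [Matrix.det_of_isLowerTriangular]
    · apply Finset.prod_eq_one
      intro i _
      simp [C, h0]
    · intro i j hij
      have : ¬ ((j : ℕ) ≤ i) := by
        have : i < j := hij
        have := Fin.lt_def.mp this
        omega
      simp only [C, Matrix.of_apply, if_neg this]
  unfold cdet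
  rw [← one_mul (Matrix.det (Matrix.of fun i j : Fin a => coeff (2*(i:ℕ)+1) (F j))), ← hC,
    ← Matrix.det_mul]
  congr 1
  ext i k
  rw [Matrix.mul_apply, Matrix.of_apply]
  dsimp only
  rw [even_expand E hE]
  simp only [C, Matrix.of_apply, ite_mul, zero_mul]
  rw [Fin.sum_univ_eq_sum_range (fun j => if j ≤ (i:ℕ) then coeff (2*((i:ℕ)-j)) E * coeff (2*j+1) (F k) else 0) a]
  rw [← Finset.sum_filter]
  apply Finset.sum_congr _ (fun _ _ => rfl)
  ext j
  have := i.2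
  simp only [mem_range, mem_filter]
  omega

/-- `w = t (1+t)/(1-t)` -/
noncomputable def wS : PowerSeries ℚ := X * US 1

lemma wS_pow (k : ℕ) (P : ℚ) : US P * wS ^ k = X^k * US (P + k) := by
  induction k with
  | zero => simp
  | succ k ih =>
    rw [pow_succ, ← mul_assoc, ih, wS, pow_succ]
    push_cast
    rw [← add_assoc, US_add (P + k) 1]
    ring

lemma US_two (y z : ℚ) (h : y = z) : US y = US z := by rw [h]

/-- the even part of `1+w` -/
noncomputable def evW : PowerSeries ℚ := (1 + wS) * US (-(1/2))

lemma evW_eq : (1 + wS) = evW * US (1/2) := by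
  unfold evW
  rw [mul_assoc, US_neg_mul, mul_one]

lemma evW_const : constantCoeff evW = 1 := by
  simp [evW, wS, US_const]

lemma evW_even : rescale (-1 : ℚ) evW = evW := by
  unfold evW wS
  simp only [map_mul, map_add, map_one, rescale_neg_one_X, US_rescale, neg_neg]
  have h1 : US (-1 : ℚ) * US (1/2) = US (-(1/2)) := by rw [← US_add]; norm_num
  have h2 : US (1 : ℚ) * US (-(1/2)) = US (1/2) := by rw [← US_add]; norm_num
  have h3 := US_one
  linear_combination -X * h1 - X * h2 + US (-(1/2)) * h3 - (1 - X) * h2 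

open Finset PowerSeries

/-- adding adjacent columns -/
lemma cdet_cols (K : ℕ) (r : ℕ → ℕ → ℚ) (h : ∀ k, r 0 (k+1) = - r 0 k) (h0 : r 0 0 = 1) :
    cdet (K+1) r = cdet K (fun i k => r (i+1) k + r (i+1) (k+1)) := by
  have h1 : cdet (K+1) r = cdet (K+1) (fun i k => if k = 0 then r i 0 else r i (k-1) + r i k) := by
    unfold cdet
    apply Matrix.det_eq_of_forall_col_eq_smul_add_pred (fun _ => -1)
    · intro i; simp
    · intro i j; simp
  rw [h1, cdet_exp0 K 0 (by omega) _ (by simp [h0]) (by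
    intro j hj _
    obtain ⟨k, rfl⟩ : ∃ k, j = k + 1 := ⟨j - 1, by omega⟩
    simp [h]), pow_zero, one_mul]
  apply cdet_congr
  intro i _ k _
  simp [skp]

noncomputable def Gd (a : ℕ) (P : ℚ) : ℚ := cdet a (fun i k => ff P i k)

lemma ff_eq (P : ℚ) (i k : ℕ) : ff P i k = coeff (2*i+1) (US P * wS^k) := by
  rw [wS_pow]; rfl

/-- sum of adjacent columns, then strip the even factor -/
lemma Gd_half (K : ℕ) (P : ℚ) :
    cdet K (fun i k => ff P i k + ff P i (k+1)) = Gd K (P + 1/2) := by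
  unfold Gd
  have h : ∀ i k, ff P i k + ff P i (k+1) = coeff (2*i+1) (evW * (US (P+1/2) * wS^k)) := by
    intro i k
    rw [ff_eq, ff_eq, ← map_add, US_add P (1/2)]
    congr 1
    have := evW_eq
    linear_combination US P * wS^k * this
  simp only [h]
  rw [cdet_even K evW evW_even evW_const (fun k => US (P+1/2) * wS^k)]
  simp only [← ff_eq]

/-- the array with rows `η, f_0, f_1, …` -/
noncomputable def etaArr (P : ℚ) (i k : ℕ) : ℚ := if i = 0 then (-1)^k else ff P (i-1) k

lemma eta_full (K : ℕ) (P : ℚ) : cdet (K+1) (etaArr P) = Gd K (P + 1/2) := by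
  rw [cdet_cols _ _ (by intro k; simp [etaArr, pow_succ]) (by simp [etaArr])]
  rw [← Gd_half]
  rfl

lemma Gd_drop (K : ℕ) (P : ℚ) : cdet (K+1) (fun i k => ff P i (k+1)) = Gd K (P + 2) := by
  rw [cdet_exp0 K 0 (by omega) _ (by simp [ff_zero_one]) (by
    intro j hj _; exact ff_lt _ _ _ (by omega)), pow_zero, one_mul]
  unfold Gd
  apply cdet_congr
  intro i _ j _
  simp [skp, ff_succ]

lemma eta_drop (K : ℕ) (P : ℚ) :
    cdet (K+2) (fun i k => etaArr P i (k+1)) = - Gd K (P + 5/2) := by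
  rw [cdet_exp0 (K+1) 1 (by omega) _ (by simp [etaArr, ff_zero_one]) (by
    intro j hj _; simp only [etaArr, one_ne_zero, if_false]; exact ff_lt _ _ _ (by omega))]
  rw [pow_one, neg_one_mul]
  congr 1
  rw [show P + 5/2 = P + 2 + 1/2 by ring, ← eta_full]
  apply cdet_congr
  intro i _ j _
  unfold etaArr skp
  rcases i with _ | i
  · simp [pow_succ]
  · simp [ff_succ]

lemma Gd_rec (a : ℕ) (P : ℚ) :
    Gd (a+2) (P+1/2) * Gd a (P+2) =
      Gd (a+1) (P+1/2) * Gd (a+1) (P+2) + Gd a (P+5/2) * Gd (a+2) P := by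
  have h := dodgson (a+1) (etaArr P)
  rw [show a+1+2 = a+2+1 by ring, show a+1+1 = a+2 by ring] at h
  rw [eta_full, eta_drop, show a + 2 = a+1+1 by ring, eta_full] at h
  have e : ∀ i k, etaArr P (i+1) k = ff P i k := by intro i k; simp [etaArr]
  simp only [e] at h
  rw [Gd_drop, Gd_drop] at h
  change _ = _ - _ * Gd (a+1+1) P at h
  rw [h]
  ring

lemma Gd_zero (P : ℚ) : Gd 0 P = 1 := by simp [Gd, cdet]
lemma Gd_one (P : ℚ) : Gd 1 P = 2 * P := by simp [Gd, cdet, ff_zero_zero]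
lemma Gd_at_zero (a : ℕ) : Gd (a+1) 0 = 0 := by
  unfold Gd cdet
  apply Matrix.det_eq_zero_of_column_eq_zero 0
  intro i
  simp [ff_zero]

/-- rising factorial -/
def asc (x : ℚ) (n : ℕ) : ℚ := ∏ i ∈ range n, (x + i)
lemma asc_zero (x : ℚ) : asc x 0 = 1 := by simp [asc]
lemma asc_succ (x : ℚ) (n : ℕ) : asc x (n+1) = asc x n * (x + n) := by
  simp [asc, prod_range_succ]
lemma asc_succ' (x : ℚ) (n : ℕ) : asc x (n+1) = x * asc (x+1) n := by
  simp only [asc, prod_range_succ']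
  rw [mul_comm]
  simp only [Nat.cast_zero, add_zero]
  congr 1
  apply prod_congr rfl
  intros; push_cast; ring
lemma asc_pos (x : ℚ) (hx : 0 < x) (n : ℕ) : 0 < asc x n := by
  apply prod_pos; intros; positivity

/-- constant `1/((2a-1)!!(2a-3)!!)` for `a+1` -/
def Cc : ℕ → ℚ
  | 0 => 1
  | (a+1) => Cc a / ((2*a+3) * (2*a+1))

lemma Cc_pos (a : ℕ) : 0 < Cc a := by
  induction a with
  | zero => simp [Cc]
  | succ a ih => rw [Cc]; positivity

/-- `h (a+1)` -/
def hh (a : ℕ) (x : ℚ) : ℚ := Cc a * asc x (a+1) * asc (x + 3*a + 2) a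

def Gc : ℕ → ℚ → ℚ
  | 0, _ => 1
  | 1, x => x
  | (a+2), x => hh (a+1) x * Gc a (x+4)

lemma hh_pos (a : ℕ) (x : ℚ) (hx : 0 < x) : 0 < hh a x := by
  unfold hh
  have := Cc_pos a
  have := asc_pos x hx (a+1)
  have := asc_pos (x+3*a+2) (by positivity) a
  positivity

lemma Gc_pos : ∀ (a : ℕ) (x : ℚ) (_ : 0 < x), 0 < Gc a x
  | 0, _, _ => by simp [Gc]
  | 1, x, hx => by simpa [Gc]
  | (a+2), x, hx => by
    rw [Gc]
    exact mul_pos (hh_pos _ _ hx) (Gc_pos a (x+4) (by linarith))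

lemma hh_diff (a : ℕ) (x : ℚ) : hh (a+1) (x+1) - hh (a+1) x =
    (2*a+3) * Cc (a+1) * asc (x+1) (a+1) * (x+2*a+4) * asc (x+3*a+6) a := by
  unfold hh
  push_cast
  rw [show x + 1 + 3 * ((a:ℚ) + 1) + 2 = x + 3*a+6 by ring,
    show x + 3 * ((a:ℚ) + 1) + 2 = x + 3*a+5 by ring]
  rw [asc_succ (x+1) (a+1), asc_succ' x (a+1), asc_succ (x+3*a+6) a, asc_succ' (x+3*a+5) a]
  rw [show x + 3 * (a:ℚ) + 5 + 1 = x + 3*a+6 by ring]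
  push_cast
  ring

lemma Gc_star : ∀ (a : ℕ) (x : ℚ),
    Gc (a+1) (x+1) * Gc (a+1) (x+4) =
    (hh (a+1) (x+1) - hh (a+1) x) * Gc a (x+5) * Gc a (x+4)
  | 0, x => by
    rw [hh_diff]; simp [Gc, Cc, asc_zero, asc_succ]
  | 1, x => by
    rw [hh_diff]; simp [Gc, Cc, hh, asc_zero, asc_succ]; ring
  | (a+2), x => by
    have ih := Gc_star a (x+4)
    rw [show a + 2 + 1 = (a+1)+2 by ring, Gc, Gc, Gc, Gc]
    rw [show x+4+1 = x + 1 + 4 by ring, show x+4+5 = x+5+4 by ring] at ih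
    have key : hh (a+1+1) (x+1) * hh (a+1+1) (x+4) * (hh (a+1) (x+1+4) - hh (a+1) (x+4)) =
       (hh (a+1+2) (x+1) - hh (a+1+2) x) * hh (a+1) (x+5) * hh (a+1) (x+4) := by
      rw [show x+1+4 = x+4+1 by ring, show a+1+2 = a+2+1 by ring, hh_diff, hh_diff]
      unfold hh
      push_cast
      rw [show x + 1 + 3 * ((a:ℚ) + 1 + 1) + 2 = x + 3*a+9 by ring,
        show x + 4 + 3 * ((a:ℚ) + 1 + 1) + 2 = x + 3*a+12 by ring,
        show x + 4 + 3 * (a:ℚ) + 6 = x + 3*a+10 by ring,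
        show x + 3 * ((a:ℚ)+2) + 6 = x + 3*a+12 by ring,
        show x + 5 + 3 * ((a:ℚ)+1) + 2 = x + 3*a+10 by ring,
        show x + 4 + 3 * ((a:ℚ)+1) + 2 = x + 3*a+9 by ring,
        show x + 4 + 1 = x + 5 by ring]
      rw [asc_succ (x+3*a+9) (a+1), asc_succ (x+3*a+10) a, asc_succ (x+4) (a+1+1),
        asc_succ (x+5) (a+1)]
      have c1 : Cc (a+1+1) = Cc (a+1) / ((2*a+5) * (2*a+3)) := by
        rw [Cc]; push_cast; ring
      have c2 : Cc (a+2+1) = Cc (a+1) / ((2*a+5) * (2*a+3)) / ((2*a+7) * (2*a+5)) := by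
        rw [← c1]; rw [Cc]; push_cast; ring
      rw [c1, c2]
      push_cast
      field_simp
      ring
    linear_combination hh (a+1+1) (x+1) * hh (a+1+1) (x+4) * ih + Gc a (x+5+4) * Gc a (x+4+4) * key

lemma Gc_rec (a : ℕ) (x : ℚ) :
    Gc (a+2) (x+1) * Gc a (x+4) =
      Gc (a+1) (x+1) * Gc (a+1) (x+4) + Gc a (x+5) * Gc (a+2) x := by
  rw [Gc_star, Gc, Gc, show x+1+4 = x+5 by ring]
  ring

lemma Gc_at_zero : ∀ a : ℕ, Gc (a+1) 0 = 0
  | 0 => by simp [Gc]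
  | (a+1) => by
    rw [show a+1+1 = a+2 by ring, Gc, hh, asc_succ' 0]; simp

lemma Gd_nat : ∀ (a x : ℕ), Gd a ((x:ℚ)/2) = Gc a x
  | 0, x => by rw [Gd_zero, Gc]
  | 1, x => by rw [Gd_one, Gc]; ring
  | (a+2), x => by
    induction x with
    | zero =>
      rw [show a+2 = a+1+1 by ring, Nat.cast_zero, zero_div, Gd_at_zero, Gc_at_zero]
    | succ x ih =>
      have h := Gd_rec a ((x:ℚ)/2)
      have h' := Gc_rec a (x:ℚ)
      have e1 := Gd_nat (a+1) (x+1)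
      have e2 := Gd_nat (a+1) (x+4)
      have e3 := Gd_nat a (x+5)
      have e4 := Gd_nat a (x+4)
      push_cast at e1 e2 e3 e4 ⊢
      rw [show (x:ℚ)/2+1/2 = ((x:ℚ)+1)/2 by ring, show (x:ℚ)/2+2 = ((x:ℚ)+4)/2 by ring,
        show (x:ℚ)/2+5/2 = ((x:ℚ)+5)/2 by ring, e1, e2, e3, e4, ih, ← h'] at h
      exact mul_right_cancel₀ (Gc_pos a (x+4) (by positivity)).ne' h

lemma asc_poly (c : ℚ) (n : ℕ) : ∃ p : Polynomial ℚ, ∀ x, p.eval x = asc (x + c) n := by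
  induction n with
  | zero => exact ⟨1, fun x => by simp [asc_zero]⟩
  | succ n ih =>
    obtain ⟨p, hp⟩ := ih
    refine ⟨p * (Polynomial.X + Polynomial.C (c + n)), fun x => ?_⟩
    rw [asc_succ, Polynomial.eval_mul, hp]
    simp [add_assoc]

lemma Gc_poly : ∀ (a : ℕ), ∃ p : Polynomial ℚ, ∀ x, p.eval x = Gc a x
  | 0 => ⟨1, fun x => by simp [Gc]⟩
  | 1 => ⟨Polynomial.X, fun x => by simp [Gc]⟩
  | (a+2) => by
    obtain ⟨p, hp⟩ := Gc_poly a
    obtain ⟨q, hq⟩ := asc_poly 0 (a+1+1)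
    obtain ⟨s, hs⟩ := asc_poly (3*(a+1:ℕ)+2) (a+1)
    refine ⟨Polynomial.C (Cc (a+1)) * q * s * p.comp (Polynomial.X + 4), fun x => ?_⟩
    rw [Gc, hh]
    simp only [Polynomial.eval_mul, hq, hs, Polynomial.eval_comp, hp, Polynomial.eval_C,
      Polynomial.eval_add, Polynomial.eval_X, add_zero, ← add_assoc]
    norm_num

lemma Gd_poly (a : ℕ) : ∃ p : Polynomial ℚ, ∀ x, p.eval x = Gd a x := by
  have hf : ∀ i k : ℕ, ∃ p : Polynomial ℚ, ∀ x, p.eval x = ff x i k := by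
    intro i k
    by_cases h : k ≤ 2*i+1
    · obtain ⟨p, hp⟩ := US_poly (2*i+1-k)
      refine ⟨p.comp (Polynomial.X + Polynomial.C (k:ℚ)), fun x => ?_⟩
      unfold ff
      rw [coeff_X_pow_mul', if_pos h]
      simp [hp]
    · refine ⟨0, fun x => ?_⟩
      rw [ff_lt _ _ _ (by omega)]; simp
  choose p hp using hf
  refine ⟨(Matrix.of fun i j : Fin a => p i j).det, fun x => ?_⟩
  rw [← Polynomial.coe_evalRingHom, RingHom.map_det]
  unfold Gd cdet
  congr 1
  ext i j
  simp [hp]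

theorem Gd_eq (a : ℕ) (P : ℚ) : Gd a P = Gc a (2*P) := by
  obtain ⟨p, hp⟩ := Gd_poly a
  obtain ⟨q, hq⟩ := Gc_poly a
  have : p = q.comp (2 * Polynomial.X) := by
    apply Polynomial.eq_of_infinite_eval_eq
    apply Set.Infinite.mono (s := Set.range (fun x : ℕ => (x:ℚ)/2))
    · rintro _ ⟨x, rfl⟩
      simp only [Set.mem_setOf_eq, hp, Polynomial.eval_comp, hq, Gd_nat]
      simp [mul_div_cancel₀]
    · apply Set.infinite_range_of_injective
      intro x y h
      simpa using h
  rw [← hp, this, Polynomial.eval_comp, hq]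
  simp

open Finset PowerSeries

lemma drop_f (a b : ℕ) (P : ℚ) (G : ℕ → ℕ → ℚ) :
    cdet (a+1+b) (fun i k => if i < a+1 then ff P (a-i) (k+1) else G (i-(a+1)) (k+1)) =
    (-1)^a * cdet (a+b) (fun i k => if i < a then ff (P+2) (a-1-i) k else G (i-a) (k+2)) := by
  rw [show a+1+b = a+b+1 by ring]
  rw [cdet_exp0 (a+b) a (by omega) _ (by simp [ff_zero_one]) (by
    intro j hj _; simp only [lt_add_iff_pos_right, zero_lt_one, if_true]
    exact ff_lt _ _ _ (by omega))]
  congr 1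
  apply cdet_congr
  intro i _ j _
  unfold skp
  by_cases h : i < a
  · rw [if_pos h, if_pos (by omega), if_pos h, show a - i = a-1-i+1 by omega, ff_succ]
  · rw [if_neg h, if_neg (by omega), if_neg h, show i + 1 - (a+1) = i - a by omega]

lemma drop_g (a b : ℕ) (Q : ℚ) (F : ℕ → ℕ → ℚ) :
    cdet (a+b+1) (fun i k => if i < a then F i k else ff Q (i-a) (a+b+1-k)) =
    (-1)^b * cdet (a+b) (fun i k => if i < a then F i k else ff (Q+2) (i-a) (a+b-1-k)) := by
  rw [cdet_expL (a+b) a (by omega) _ (by simp [ff_zero_one]) (by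
    intro j hj; simp only [lt_irrefl, if_false]
    exact ff_lt _ _ _ (by omega))]
  rw [show a + (a+b) = 2*a+b by ring, pow_add, pow_mul]
  norm_num
  apply cdet_congr
  intro i _ j _
  unfold skp
  by_cases h : i < a
  · rw [if_pos h, if_pos (by omega)]; simp [h]
  · rw [if_neg h, if_neg (by omega), if_neg h, show i + 1 - a = i - a + 1 by omega,
      show a + b + 1 - j = a + b - 1 - j + 2 by omega, ff_succ]

noncomputable def marr (a b : ℕ) (P Q : ℚ) (i k : ℕ) : ℚ :=
  if i < a then ff P (a-1-i) k else ff Q (i-a) (a+b-1-k)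

noncomputable def Mm (a b : ℕ) (P Q : ℚ) : ℚ := cdet (a+b) (marr a b P Q)

/-- delete first row, first column -/
lemma minor_ff (a b : ℕ) (P Q : ℚ) :
    cdet (a+b+1) (fun i j => marr (a+1) (b+1) P Q (i+1) (j+1)) =
      if a = 0 then Mm 0 (b+1) (P+1) Q else (-1)^(a-1) * Mm (a-1) (b+1) (P+2) Q := by
  rcases a with _ | a
  · rw [if_pos rfl]
    unfold Mm
    apply cdet_congr
    intro i hi j hj
    unfold marr
    rw [if_neg (by omega), if_neg (by omega)]
    congr 1; omega
  · rw [if_neg (by omega)]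
    have := drop_f a (b+1) P (fun i k => ff Q i (a+b+2-k))
    rw [show a+1+(b+1) = a+1+b+1 by ring] at this
    rw [Nat.add_sub_cancel, ← (show cdet (a+(b+1)) _ = Mm a (b+1) (P+2) Q from ?_), ← this]
    · apply cdet_congr
      intro i hi j hj
      unfold marr
      by_cases h : i < a+1
      · rw [if_pos (by omega), if_pos h]; congr 1; omega
      · rw [if_neg (by omega), if_neg h]; congr 1 <;> omega
    · apply cdet_congr
      intro i hi j hj
      unfold marr
      by_cases h : i < a
      · rw [if_pos h, if_pos h]
      · rw [if_neg h, if_neg h]; congr 1; omega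

/-- delete last row, last column -/
lemma minor_ll (a b : ℕ) (P Q : ℚ) :
    cdet (a+b+1) (fun i j => marr (a+1) (b+1) P Q i j) =
      if b = 0 then Mm (a+1) 0 P (Q+1) else (-1)^(b-1) * Mm (a+1) (b-1) P (Q+2) := by
  rcases b with _ | b
  · rw [if_pos rfl]
    unfold Mm
    apply cdet_congr
    intro i hi j hj
    unfold marr
    rw [if_pos (by omega), if_pos (by omega)]
  · rw [if_neg (by omega)]
    have := drop_g (a+1) b Q (fun i k => ff P (a-i) k)
    rw [Nat.add_sub_cancel, ← (show cdet (a+1+b) _ = Mm (a+1) b P (Q+2) from ?_), ← this]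
    · rw [show a + (b+1) + 1 = a+1+b+1 by ring]
      apply cdet_congr
      intro i hi j hj
      unfold marr
      by_cases h : i < a+1
      · rw [if_pos (by omega), if_pos h]; congr 1
      · rw [if_neg (by omega), if_neg h]; congr 1
    · apply cdet_congr
      intro i hi j hj
      unfold marr
      by_cases h : i < a+1
      · rw [if_pos h, if_pos h]; congr 1
      · rw [if_neg h, if_neg h]

/-- delete last row, first column -/
lemma minor_lf (a b : ℕ) (P Q : ℚ) :
    cdet (a+b+1) (fun i j => marr (a+1) (b+1) P Q i (j+1)) = (-1)^a * Mm a b (P+2) Q := by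
  have := drop_f a b P (fun i k => ff Q i (a+b+1-k))
  rw [← (show cdet (a+b) _ = Mm a b (P+2) Q from ?_), ← this]
  · rw [show a + b + 1 = a+1+b by ring]
    apply cdet_congr
    intro i hi j hj
    unfold marr
    by_cases h : i < a+1
    · rw [if_pos (by omega), if_pos h]; congr 1
    · rw [if_neg (by omega), if_neg h]; congr 1
  · apply cdet_congr
    intro i hi j hj
    unfold marr
    by_cases h : i < a
    · rw [if_pos h, if_pos h]
    · rw [if_neg h, if_neg h]; congr 1; omega

/-- delete first row, last column -/
lemma minor_fl (a b : ℕ) (P Q : ℚ) :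
    cdet (a+b+1) (fun i j => marr (a+1) (b+1) P Q (i+1) j) = (-1)^b * Mm a b P (Q+2) := by
  have := drop_g a b Q (fun i k => ff P (a-1-i) k)
  rw [← (show cdet (a+b) _ = Mm a b P (Q+2) from ?_), ← this]
  · apply cdet_congr
    intro i hi j hj
    unfold marr
    by_cases h : i < a
    · rw [if_pos (by omega), if_pos h]; congr 1; omega
    · rw [if_neg (by omega), if_neg h]; congr 1 <;> omega
  · rfl

/-- centre -/
lemma minor_c (a b : ℕ) (P Q : ℚ) :
    cdet (a+b) (fun i j => marr (a+1) (b+1) P Q (i+1) (j+1)) =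
      if a = 0 then (if b = 0 then 1 else (-1)^(b-1) * Mm 0 (b-1) (P+1) (Q+2))
      else (if b = 0 then (-1)^(a-1) * Mm (a-1) 0 (P+2) (Q+1)
        else (-1)^(a-1+(b-1)) * Mm (a-1) (b-1) (P+2) (Q+2)) := by
  rcases a with _ | a
  · rw [if_pos rfl]
    rcases b with _ | b
    · simp [cdet]
    · rw [if_neg (by omega)]
      have := drop_g 0 b Q (fun i k => 0)
      rw [Nat.add_sub_cancel, ← (show cdet (0+b) _ = Mm 0 b (P+1) (Q+2) from ?_), ← this]
      · apply cdet_congr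
        intro i hi j hj
        unfold marr
        rw [if_neg (by omega), if_neg (by omega)]
        congr 1; omega
      · apply cdet_congr
        intro i hi j hj
        unfold marr
        rw [if_neg (by omega), if_neg (by omega)]
  · rw [if_neg (by omega), Nat.add_sub_cancel]
    have h1 := drop_f a b P (fun i k => ff Q i (a+b+2-k))
    have h2 : cdet (a+1+b) (fun i j => marr (a+1+1) (b+1) P Q (i+1) (j+1)) =
      cdet (a+1+b) (fun i k => if i < a+1 then ff P (a-i) (k+1) else ff Q (i-(a+1)) (a+b+2-(k+1))) := by
      apply cdet_congr
      intro i hi j hj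
      unfold marr
      by_cases h : i < a+1
      · rw [if_pos (by omega), if_pos h]; congr 1; omega
      · rw [if_neg (by omega), if_neg h]; congr 1 <;> omega
    rw [h2, h1]
    rcases b with _ | b
    · rw [if_pos rfl]
      congr 1
      apply cdet_congr
      intro i hi j hj
      unfold marr
      rw [if_pos (by omega), if_pos (by omega)]
    · rw [if_neg (by omega), Nat.add_sub_cancel, pow_add, mul_assoc]
      congr 1
      have := drop_g a b Q (fun i k => ff (P+2) (a-1-i) k)
      rw [← (show cdet (a+b) _ = Mm a b (P+2) (Q+2) from ?_), ← this]
      · apply cdet_congr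
        intro i hi j hj
        by_cases h : i < a
        · rw [if_pos h, if_pos h]
        · rw [if_neg h, if_neg h]; congr 1; omega
      · rfl

noncomputable def st (a b : ℕ) (X : ℚ) : ℚ :=
  (-1)^(a/2+b) * Mm a b ((X-2*a+1)/2) ((-X-2*b+1)/2)

lemma st_zero : ∀ X, st 0 0 X = 1 := by
  intro X; simp [st, Mm, cdet]

lemma Mm_eq {a b : ℕ} {P Q P' Q' : ℚ} (h1 : P = P') (h2 : Q = Q') : Mm a b P Q = Mm a b P' Q' := by
  rw [h1, h2]

theorem st_rec (a b : ℕ) (X : ℚ) :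
    st (a+1) (b+1) X * st (a-1) (b-1) X =
      st (a+1) (b-1) X * st (a-1) (b+1) X + st a b (X+2) * st a b (X-2) := by
  set P := (X - 2*(a+1)+1)/2 with hP
  set Q := (-X - 2*(b+1)+1)/2 with hQ
  have h := dodgson (a+b) (marr (a+1) (b+1) P Q)
  rw [minor_ff, minor_ll, minor_lf, minor_fl, minor_c] at h
  have h0 : cdet (a+b+2) (marr (a+1) (b+1) P Q) = Mm (a+1) (b+1) P Q := by
    unfold Mm; rw [show a+1+(b+1) = a+b+2 by ring]
  rw [h0] at h
  have e1 : st (a+1) (b+1) X = (-1)^((a+1)/2+b+1) * Mm (a+1) (b+1) P Q := by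
    unfold st; rw [← add_assoc]; congr 1; apply Mm_eq <;> push_cast <;> rfl
  have e2 : st a b (X+2) = (-1)^(a/2+b) * Mm a b (P+2) Q := by
    unfold st; congr 1; apply Mm_eq
    · rw [hP]; ring
    · rw [hQ]; ring
  have e3 : st a b (X-2) = (-1)^(a/2+b) * Mm a b P (Q+2) := by
    unfold st; congr 1; apply Mm_eq
    · rw [hP]; ring
    · rw [hQ]; ring
  rw [e1, e2, e3]
  have sq : ∀ k : ℕ, ((-1:ℚ)^k)*(-1)^k = 1 := by
    intro k; rw [← mul_pow]; norm_num
  rcases a with _ | a <;> rcases b with _ | b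
  · have e5 : st 1 0 X = Mm 1 0 P (Q+1) := by
      unfold st; norm_num; apply Mm_eq
      · rw [hP]; push_cast; ring
      · rw [hQ]; push_cast; ring
    have e6 : st 0 1 X = - Mm 0 1 (P+1) Q := by
      unfold st; norm_num; apply Mm_eq
      · rw [hP]; push_cast; ring
      · rw [hQ]; push_cast; ring
    simp only [zero_add, Nat.zero_sub, if_true, st_zero, e5, e6, pow_zero, one_mul] at h ⊢
    norm_num
    linear_combination -h
  · have hv := sq b
    have e4 : st 0 b X = (-1)^b * Mm 0 b (P+1) (Q+2) := by
      unfold st; norm_num; apply Mm_eq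
      · rw [hP]; push_cast; ring
      · rw [hQ]; push_cast; ring
    have e5 : st 1 b X = (-1)^b * Mm 1 b P (Q+2) := by
      unfold st; norm_num; apply Mm_eq
      · rw [hP]; push_cast; ring
      · rw [hQ]; push_cast; ring
    have e6 : st 0 (b+2) X = (-1)^b * Mm 0 (b+2) (P+1) Q := by
      unfold st; norm_num [pow_add]; apply Mm_eq
      · rw [hP]; push_cast; ring
      · rw [hQ]; push_cast; ring
    simp only [zero_add, Nat.zero_sub, if_true, Nat.add_sub_cancel, e4, e5, e6, pow_zero, one_mul,
      Nat.add_eq_zero_iff, one_ne_zero, and_false, if_false, pow_add, pow_one,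
      show b + 1 + 1 = b + 2 from rfl] at h ⊢
    norm_num at h ⊢
    linear_combination (-1)^b * h
  · have hv := sq a
    have hu := sq (a/2)
    have hz := sq ((a+1)/2)
    have e4 : st a 0 X = (-1)^(a/2) * Mm a 0 (P+2) (Q+1) := by
      unfold st; norm_num; apply Mm_eq
      · rw [hP]; push_cast; ring
      · rw [hQ]; push_cast; ring
    have e5 : st (a+2) 0 X = -(-1)^(a/2) * Mm (a+2) 0 P (Q+1) := by
      unfold st; norm_num [pow_add]; apply Mm_eq
      · rw [hP]; push_cast; ring
      · rw [hQ]; push_cast; ring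
    have e6 : st a 1 X = -(-1)^(a/2) * Mm a 1 (P+2) Q := by
      unfold st; norm_num [pow_add]; apply Mm_eq
      · rw [hP]; push_cast; ring
      · rw [hQ]; push_cast; ring
    simp only [zero_add, Nat.zero_sub, if_true, Nat.add_sub_cancel, e4, e5, e6, pow_zero, one_mul,
      Nat.add_eq_zero_iff, one_ne_zero, and_false, if_false, pow_add, pow_one, mul_one, add_zero,
      show a + 1 + 1 = a + 2 from rfl, Nat.add_div_right _ (show 0 < 2 by norm_num)] at h ⊢
    generalize (-1:ℚ)^a = w at *
    generalize (-1:ℚ)^(a/2) = u at *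
    generalize (-1:ℚ)^((a+1)/2) = z at *
    have h' : Mm (a+2) 1 P Q * Mm a 0 (P+2) (Q+1) = Mm (a+2) 0 P (Q+1) * Mm a 1 (P+2) Q
        + Mm (a+1) 0 (P+2) Q * Mm (a+1) 0 P (Q+2) := by
      linear_combination w * h - (Mm (a+2) 1 P Q * Mm a 0 (P+2) (Q+1) - Mm (a+2) 0 P (Q+1) * Mm a 1 (P+2) Q
        - Mm (a+1) 0 (P+2) Q * Mm (a+1) 0 P (Q+2)) * hv
    linear_combination u*u*h' + Mm (a+1) 0 (P+2) Q * Mm (a+1) 0 P (Q+2) * (hu - hz)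
  · have hv := sq b
    have hw := sq a
    have hu := sq (a/2)
    have hz := sq ((a+1)/2)
    have e4 : st a b X = (-1)^(a/2) * (-1)^b * Mm a b (P+2) (Q+2) := by
      unfold st; rw [pow_add]; congr 1; apply Mm_eq
      · rw [hP]; push_cast; ring
      · rw [hQ]; push_cast; ring
    have e5 : st (a+2) b X = -(-1)^(a/2) * (-1)^b * Mm (a+2) b P (Q+2) := by
      unfold st; norm_num [pow_add]; apply Mm_eq
      · rw [hP]; push_cast; ring
      · rw [hQ]; push_cast; ring
    have e6 : st a (b+2) X = (-1)^(a/2) * (-1)^b * Mm a (b+2) (P+2) Q := by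
      unfold st; norm_num [pow_add]; apply Mm_eq
      · rw [hP]; push_cast; ring
      · rw [hQ]; push_cast; ring
    simp only [Nat.add_sub_cancel, e4, e5, e6,
      Nat.add_eq_zero_iff, one_ne_zero, and_false, if_false, pow_add, pow_one, mul_one, add_zero,
      show a + 1 + 1 = a + 2 from rfl, show b + 1 + 1 = b + 2 from rfl,
      Nat.add_div_right _ (show 0 < 2 by norm_num)] at h ⊢
    generalize (-1:ℚ)^a = w at *
    generalize (-1:ℚ)^b = v at *
    generalize (-1:ℚ)^(a/2) = u at *
    generalize (-1:ℚ)^((a+1)/2) = z at *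
    have h' : Mm (a+2) (b+2) P Q * Mm a b (P+2) (Q+2) = Mm (a+2) b P (Q+2) * Mm a (b+2) (P+2) Q
       - Mm (a+1) (b+1) (P+2) Q * Mm (a+1) (b+1) P (Q+2) := by
      linear_combination w * v * h - (Mm (a+2) (b+2) P Q * Mm a b (P+2) (Q+2) - Mm (a+2) b P (Q+2) * Mm a (b+2) (P+2) Q
       + Mm (a+1) (b+1) (P+2) Q * Mm (a+1) (b+1) P (Q+2)) * (v * v * hw + hv)
    linear_combination - u*u*v*v * h' + v*v* Mm (a+1) (b+1) (P+2) Q * Mm (a+1) (b+1) P (Q+2) * (hu - hz)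

open Finset PowerSeries

/-- the factor `k(i,j)` -/
def kk (i j : ℕ) (X : ℚ) : ℚ := (X^2 - ((i:ℚ)-j)^2) / (X^2 - ((i:ℚ)+j-1)^2)

def kap (i : ℕ) : ℕ → ℚ → ℚ
  | 0, _ => 1
  | 1, X => kk i 1 X
  | (b+2), X => kk i (b+2) X * kap i b X

def KK : ℕ → ℕ → ℚ → ℚ
  | 0, _, _ => 1
  | 1, b, X => kap 1 b X
  | (a+2), b, X => kap (a+2) b X * KK a b X

lemma kap_step (i b : ℕ) (X : ℚ) : kap i (b+1) X = kk i (b+1) X * kap i (b-1) X := by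
  rcases b with _ | b
  · simp [kap]
  · rfl

lemma KK_step (a b : ℕ) (X : ℚ) : KK (a+1) b X = kap (a+1) b X * KK (a-1) b X := by
  rcases a with _ | a
  · simp [KK]
  · rfl

lemma KK_zero_right (X : ℚ) : ∀ a, KK a 0 X = 1
  | 0 => rfl
  | 1 => rfl
  | (a+2) => by rw [KK, kap, KK_zero_right X a, mul_one]

lemma kk_symm (i j : ℕ) (X : ℚ) : kk i j X = kk j i X := by
  unfold kk; congr 1 <;> ring

lemma KK_stepc (b : ℕ) (X : ℚ) : ∀ a, KK a (b+1) X = kap (b+1) a X * KK a (b-1) X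
  | 0 => by simp [KK, kap]
  | 1 => by simp [KK, kap]; rw [kap_step, kk_symm]
  | (a+2) => by
    rw [KK, KK_stepc b X a, KK, kap, kap_step, kk_symm]; ring

lemma KK_symm (X : ℚ) (a : ℕ) : ∀ b, KK a b X = KK b a X
  | 0 => by rw [KK_zero_right]; rfl
  | 1 => by rw [KK_stepc]; simp [KK, KK_zero_right]
  | (b+2) => by rw [KK_stepc]; simp only [Nat.add_sub_cancel]; rw [KK_symm X a b]; rfl

lemma KK_R1 (a b : ℕ) (X : ℚ) : KK (a+1) (b+1) X * KK (a-1) (b-1) X =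
    kk (a+1) (b+1) X * KK (a-1) (b+1) X * KK (a+1) (b-1) X := by
  rw [KK_step a (b+1), KK_step a (b-1), kap_step]; ring

lemma kk_pos (i j : ℕ) (X : ℚ) (h0 : 0 < X) (hi : 2*(i:ℚ)-1 < X) (hj : 2*(j:ℚ)-1 < X)
    (h1 : 1 ≤ i) (h2 : 1 ≤ j) : 0 < kk i j X := by
  have h1' : (1:ℚ) ≤ i := by exact_mod_cast h1
  have h2' : (1:ℚ) ≤ j := by exact_mod_cast h2
  unfold kk
  apply div_pos <;> nlinarith

lemma kap_pos (X : ℚ) (i : ℕ) (h0 : 0 < X) (hi : 2*(i:ℚ)-1 < X) (h1 : 1 ≤ i) :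
    ∀ b : ℕ, 2*(b:ℚ)-1 < X → 0 < kap i b X
  | 0, _ => by simp [kap]
  | 1, h => kk_pos _ _ _ h0 hi h h1 le_rfl
  | (b+2), h => mul_pos (kk_pos _ _ _ h0 hi h h1 (by omega))
      (kap_pos X i h0 hi h1 b (by push_cast at h; linarith))

lemma KK_pos (X : ℚ) (b : ℕ) (h0 : 0 < X) (hb : 2*(b:ℚ)-1 < X) :
    ∀ a : ℕ, 2*(a:ℚ)-1 < X → 0 < KK a b X
  | 0, _ => by simp [KK]
  | 1, h => kap_pos _ _ h0 h le_rfl _ hb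
  | (a+2), h => mul_pos (kap_pos _ _ h0 h (by omega) _ hb)
      (KK_pos X b h0 hb a (by push_cast at h; linarith))

/-! the one variable factors; `s = 1` or `s = -1` -/
def hs (s : ℚ) (a : ℕ) (X : ℚ) : ℚ := s * hh a (s * X - 2*a - 1)

def Gs (s : ℚ) (a : ℕ) (X : ℚ) : ℚ := s^((a+1)/2) * Gc a (s * X - 2*a + 1)

lemma Gs_zero (s X : ℚ) : Gs s 0 X = 1 := by simp [Gs, Gc]

lemma Gs_step (s : ℚ) (a : ℕ) (X : ℚ) : Gs s (a+1) X = hs s a X * Gs s (a-1) X := by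
  rcases a with _ | a
  · simp [Gs, hs, Gc, hh, Cc, asc]; left; ring
  · unfold Gs hs
    rw [Gc, show (a+1+1+1)/2 = (a+1)/2+1 by omega, pow_succ, Nat.add_sub_cancel]
    push_cast
    rw [show s * X - 2 * ((a:ℚ) + 1 + 1) + 1 = s * X - 2 * ((a:ℚ) + 1) - 1 by ring,
      show s * X - 2 * ((a:ℚ) + 1) - 1 + 4 = s * X - 2 * a + 1 by ring]
    ring

lemma asc_neg (y : ℚ) (n : ℕ) : asc (-y) n = (-1)^n * asc (y - n + 1) n := by
  induction n generalizing y with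
  | zero => simp [asc]
  | succ n ih =>
    rw [asc_succ, ih, asc_succ' (y - (n+1:ℕ) + 1)]
    push_cast
    rw [show y - ((n:ℚ) + 1) + 1 + 1 = y - n + 1 by ring]
    ring

lemma hs_neg (a : ℕ) (X : ℚ) : hs (-1) a X =
    Cc a * asc (X + a + 1) (a+1) * asc (X - 2*a) a := by
  unfold hs hh
  rw [show -1 * X - 2*(a:ℚ) - 1 = -(X + 2*a+1) by ring, asc_neg,
    show -(X + 2*(a:ℚ)+1) + 3 * a + 2 = -(X - a - 1) by ring, asc_neg]
  push_cast
  rw [show X + 2 * (a:ℚ) + 1 - (a + 1) + 1 = X + a + 1 by ring,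
    show X - (a:ℚ) - 1 - a + 1 = X - 2*a by ring, pow_succ]
  have : ((-1:ℚ)^a)*(-1)^a = 1 := by rw [← mul_pow]; norm_num
  linear_combination (Cc a * asc (X + a + 1) (a+1) * asc (X - 2*a) a) * this

lemma hs_pos' (a : ℕ) (X : ℚ) : hs 1 a X =
    Cc a * asc (X - 2*a - 1) (a+1) * asc (X + a + 1) a := by
  unfold hs hh
  rw [show 1 * X - 2*(a:ℚ) - 1 = X - 2*a-1 by ring, 
    show X - 2*(a:ℚ) - 1 + 3 * a + 2 = X + a + 1 by ring]
  ring

lemma hs_pos (s : ℚ) (hs' : s = 1 ∨ s = -1) (a : ℕ) (X : ℚ) (h : 2*(a:ℚ)+1 < X) : 0 < hs s a X := by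
  have := Cc_pos a
  have h0 : (0:ℚ) ≤ a := by positivity
  have h2 : 0 < asc (X + a + 1) (a+1) := asc_pos _ (by linarith) _
  have h2 : 0 < asc (X + a + 1) a := asc_pos _ (by linarith) _
  have h3 : 0 < asc (X - 2*a) a := asc_pos _ (by linarith) _
  have h4 : 0 < asc (X - 2*a - 1) (a+1) := asc_pos _ (by linarith) _
  rcases hs' with rfl | rfl
  · rw [hs_pos']; positivity
  · rw [hs_neg]; positivity

lemma Gs_pos (s : ℚ) (hs' : s = 1 ∨ s = -1) (X : ℚ) : ∀ a : ℕ, 2*(a:ℚ)-1 < X → 0 < Gs s a X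
  | 0, _ => by simp [Gs, Gc]
  | 1, h => by
    rw [Gs_step]; simp only [Nat.zero_sub, Gs_zero, mul_one]
    exact hs_pos s hs' 0 X (by push_cast at *; linarith)
  | (a+2), h => by
    rw [Gs_step]; 
    exact mul_pos (hs_pos s hs' _ X (by push_cast at *; linarith))
      (Gs_pos s hs' X a (by push_cast at *; linarith))

lemma hs_ratio (s : ℚ) (hs' : s = 1 ∨ s = -1) (a : ℕ) (X : ℚ) :
    hs s (a+1) (X-2) * hs s (a+1) (X+2) * ((2*a+1) * (X^2-(a+3)^2)) =
     (2*a+5)*(X^2-a^2) * (hs s (a+2) X * hs s a X) := by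
  have hC : ∀ a : ℕ, Cc (a+1) * ((2*a+3)*(2*a+1)) = Cc a := by
    intro a; rw [Cc]; field_simp
  have h1 := hC a
  have h2 := hC (a+1)
  push_cast at h2
  rw [show a+1+1 = a+2 from rfl] at h2
  rcases hs' with rfl | rfl
  · simp only [hs_pos']
    push_cast
    rw [show X - 2 - 2 * ((a:ℚ)+1) - 1 = X - 2*a - 5 by ring, show X - 2 + ((a:ℚ)+1) + 1 = X + a by ring,
      show X + 2 - 2 * ((a:ℚ)+1) - 1 = X - 2*a - 1 by ring, show X + 2 + ((a:ℚ)+1) + 1 = X + a + 4 by ring,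
      show X - 2 * ((a:ℚ)+2) - 1 = X - 2*a - 5 by ring, show X + ((a:ℚ)+2) + 1 = X + a + 3 by ring,
      asc_succ (X-2*a-5) (a+2), asc_succ (X-2*a-1) (a+1), asc_succ' (X+a) a, asc_succ' (X+a+3) (a+1),
      show X + (a:ℚ) + 3 + 1 = X + a + 4 by ring, ← h1, ← h2]
    push_cast
    ring
  · simp only [hs_neg]
    push_cast
    rw [show X - 2 - 2 * ((a:ℚ)+1) = X - 2*a - 4 by ring, show X - 2 + ((a:ℚ)+1) + 1 = X + a by ring,
      show X + 2 - 2 * ((a:ℚ)+1) = X - 2*a by ring, show X + 2 + ((a:ℚ)+1) + 1 = X + a + 4 by ring,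
      show X - 2 * ((a:ℚ)+2) = X - 2*a - 4 by ring, show X + ((a:ℚ)+2) + 1 = X + a + 3 by ring,
      asc_succ (X-2*a-4) (a+1), asc_succ (X-2*a) a, asc_succ' (X+a) (a+1), asc_succ' (X+a+3) (a+2),
      show X + (a:ℚ) + 3 + 1 = X + a + 4 by ring, ← h1, ← h2]
    push_cast
    ring

lemma Gs_one (s : ℚ) (hs' : s = 1 ∨ s = -1) (X : ℚ) : Gs s 1 X = X - s := by
  rcases hs' with rfl | rfl <;> simp [Gs, Gc] <;> ring

lemma Gs_two (s : ℚ) (hs' : s = 1 ∨ s = -1) (X : ℚ) : Gs s 2 X = (X^2-4)*(X-3*s)/3 := by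
  rcases hs' with rfl | rfl <;> simp [Gs, Gc, hh, Cc, asc, prod_range_succ] <;> ring

lemma Gs_three (s : ℚ) (hs' : s = 1 ∨ s = -1) (X : ℚ) :
    Gs s 3 X = (X^2-9)*(X^2-16)*(X-5*s)*(X-s)/45 := by
  rcases hs' with rfl | rfl <;> simp [Gs, Gc, hh, Cc, asc, prod_range_succ] <;> ring

/-- R2 for second index 0 -/
lemma RB0 (s : ℚ) (hs' : s = 1 ∨ s = -1) (X : ℚ) : ∀ a : ℕ, 2*(a:ℚ)+1 < X →
    Gs s a (X-2) * Gs s a (X+2) * (X^2 - a^2) =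
      (2*a+1) * (Gs s (a+1) X * Gs s (a-1) X) * Gs (-s) 1 X * KK (a+1) 1 X
  | 0, h => by
    have h2 : -s = 1 ∨ -s = -1 := by rcases hs' with rfl | rfl <;> simp
    norm_num [Gs_zero, Gs_one s hs', Gs_one (-s) h2, KK, kap, kk] at h ⊢
    have : X^2 - 1 ≠ 0 := by nlinarith
    rw [mul_div_assoc', eq_div_iff this]
    rcases hs' with rfl | rfl <;> ring
  | 1, h => by
    have h2 : -s = 1 ∨ -s = -1 := by rcases hs' with rfl | rfl <;> simp
    norm_num [Gs_zero, Gs_one s hs', Gs_one (-s) h2, KK, kap, kk, Gs_two s hs'] at h ⊢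
    have : X^2 - 4 ≠ 0 := by nlinarith
    rw [mul_div_assoc', eq_div_iff this]
    rcases hs' with rfl | rfl <;> ring
  | (a+2), h => by
    have ih := RB0 s hs' X a (by push_cast at h; linarith)
    push_cast at h ⊢
    have hr := hs_ratio s hs' a X
    rw [Gs_step s (a+1), Gs_step s (a+1), Gs_step s (a+2), KK_step, kap]
    simp only [Nat.add_sub_cancel, show a + 2 - 1 = a+1 from rfl, Gs_step s a]
    rw [Gs_step s a] at ih
    have h0 : (0:ℚ) ≤ a := by positivity
    have e1 : X^2 - (a + 3:ℚ)^2 ≠ 0 := by nlinarith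
    have e2 : X^2 - (a:ℚ)^2 ≠ 0 := by nlinarith
    have e3 : (2*a+1:ℚ) ≠ 0 := by positivity
    have ek : kk (a+2+1) 1 X * (X^2 - (a+3:ℚ)^2) = (X^2 - (a+2:ℚ)^2) := by
      unfold kk; push_cast
      rw [show (a:ℚ)+2+1+1-1 = a+3 by ring, show (a:ℚ)+2+1-1 = a+2 by ring, div_mul_cancel₀ _ e1]
    apply mul_left_cancel₀ (mul_ne_zero e1 (mul_ne_zero e2 e3))
    linear_combination (X^2 - (a+2:ℚ)^2) * (hs s (a+1) (X-2) * hs s (a+1) (X+2) * ((2*a+1) * (X^2-(a+3:ℚ)^2)) * ih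
      + (2*a+1) * (hs s a X * Gs s (a-1) X * Gs s (a-1) X) * Gs (-s) 1 X * KK (a+1) 1 X * hr)
      - (2*a+1)*(2*a+5) * (X^2 - (a:ℚ)^2) * hs s (a+2) X * (hs s a X * Gs s (a-1) X)^2 * Gs (-s) 1 X * KK (a+1) 1 X * ek

/-- R2 for second index 1 -/
lemma RB1 (s : ℚ) (hs' : s = 1 ∨ s = -1) (X : ℚ) : ∀ a : ℕ, 2*(a:ℚ)+1 < X → 3 < X →
    Gs s a (X-2) * Gs s a (X+2) * (Gs (-s) 1 (X-2) * Gs (-s) 1 (X+2)) *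
       (KK a 1 (X-2) * KK a 1 (X+2)) * (X^2 - (a-1:ℚ)^2) =
      (2*a+1) * 3 * (Gs s (a+1) X * Gs s (a-1) X) * Gs (-s) 2 X * KK (a+1) 2 X
  | 0, h, h3 => by
    have h2 : -s = 1 ∨ -s = -1 := by rcases hs' with rfl | rfl <;> simp
    norm_num [Gs_zero, Gs_one s hs', Gs_one (-s) h2, Gs_two (-s) h2, KK, kap, kk] at h ⊢
    have : X^2 - 4 ≠ 0 := by nlinarith
    field_simp
    rcases hs' with rfl | rfl <;> ring
  | 1, h, h3 => by
    have h2 : -s = 1 ∨ -s = -1 := by rcases hs' with rfl | rfl <;> simp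
    norm_num [Gs_zero, Gs_one s hs', Gs_one (-s) h2, KK, kap, kk, Gs_two s hs', Gs_two (-s) h2] at h ⊢
    have e1 : X^2 - 9 ≠ 0 := by nlinarith
    have e2 : (X-2)^2 - 1 ≠ 0 := by nlinarith
    have e3 : (X+2)^2 - 1 ≠ 0 := by nlinarith
    field_simp
    rcases hs' with rfl | rfl <;> ring
  | (a+2), h, h3 => by
    have ih := RB1 s hs' X a (by push_cast at h; linarith) h3
    push_cast at h ⊢
    have hr := hs_ratio s hs' a X
    rw [Gs_step s (a+1), Gs_step s (a+1), Gs_step s (a+2), KK_step (a+1), KK_step (a+1), KK_step (a+2),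
      kap, kap, kap, kap]
    simp only [Nat.add_sub_cancel, show a + 2 - 1 = a+1 from rfl, Gs_step s a]
    rw [Gs_step s a] at ih
    have h0 : (0:ℚ) ≤ a := by positivity
    have e1 : X^2 - (a + 3:ℚ)^2 ≠ 0 := by nlinarith
    have e2 : X^2 - (a:ℚ)^2 ≠ 0 := by nlinarith
    have e3 : (2*a+1:ℚ) ≠ 0 := by positivity
    have e4 : X^2 - (a+4:ℚ)^2 ≠ 0 := by nlinarith
    have e5 : X^2 - (a-1:ℚ)^2 ≠ 0 := by nlinarith
    have e6 : (X-2)^2 - (a+2:ℚ)^2 ≠ 0 := by nlinarith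
    have e7 : (X+2)^2 - (a+2:ℚ)^2 ≠ 0 := by nlinarith
    have e8 : X^2 - (a+1:ℚ)^2 ≠ 0 := by nlinarith
    have ek : kk (a+1+1) 1 (X-2) * kk (a+1+1) 1 (X+2) * ((X^2-(a:ℚ)^2) * (X^2-(a+4:ℚ)^2)) =
       (X^2-(a-1:ℚ)^2) * (X^2 - (a+3:ℚ)^2) := by
      unfold kk; push_cast
      rw [show (a:ℚ)+1+1+1-1 = a+2 by ring, show (a:ℚ)+1+1-1 = a+1 by ring]
      field_simp
      ring
    have ek2 : kk (a+2+1) 2 X * (X^2 - (a+4:ℚ)^2) = (X^2 - (a+1:ℚ)^2) := by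
      unfold kk; push_cast
      rw [show (a:ℚ)+2+1+2-1 = a+4 by ring, show (a:ℚ)+2+1-2 = a+1 by ring, div_mul_cancel₀ _ e4]
    apply mul_left_cancel₀ (mul_ne_zero (mul_ne_zero (mul_ne_zero e1 e4) (mul_ne_zero e2 e3)) e5)
    generalize kk (a+1+1) 1 (X-2) = k1 at *
    generalize kk (a+1+1) 1 (X+2) = k2 at *
    generalize kk (a+2+1) 2 X = k3 at *
    generalize hs s (a+1) (X-2) = u at *
    generalize hs s (a+1) (X+2) = v at *
    generalize hs s (a+2) X = h2 at *
    generalize hs s a X = h1 at *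
    generalize Gs s a (X-2) = A at *
    generalize Gs s a (X+2) = B at *
    generalize Gs s (a-1) X = g at *
    generalize Gs (-s) 1 (X-2) = m1 at *
    generalize Gs (-s) 1 (X+2) = m2 at *
    generalize Gs (-s) 2 X = m3 at *
    generalize KK a 1 (X-2) = q1 at *
    generalize KK a 1 (X+2) = q2 at *
    generalize KK (a+1) 2 X = q3 at *
    generalize (a:ℚ) = t at *
    have e : u*v*A*B*(m1*m2)*(q1*q2)*(k1*k2) * (X^2 - t^2) * (X^2-(t+4)^2) * (2*t+1) * (X^2-(t-1)^2) * (X^2-(t+3)^2)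
       = (2*t+1)*3*h1*g*g*m3*q3*(2*t+5)*(X^2-t^2)*h2*h1*((X^2-(t-1)^2)*(X^2-(t+3)^2)) := by
      linear_combination (u*v*A*B*(m1*m2)*(q1*q2)*(2*t+1) * (X^2-(t-1)^2) * (X^2-(t+3)^2)) * ek
        + (X^2-(t-1)^2)*(X^2-(t+3)^2) * (u*v*(2*t+1)*(X^2-(t+3)^2) * ih + (2*t+1)*3*h1*g*g*m3*q3*hr)
    linear_combination (X^2-(t+1)^2) * e - (2*t+1)*3*h1*g*g*m3*q3*(2*t+5)*(X^2-t^2)*h2*h1*((X^2-(t-1)^2)*(X^2-(t+3)^2)) * ek2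


open Finset PowerSeries

def TT (a b : ℕ) (X : ℚ) : ℚ := Gs 1 a X * Gs (-1) b X * KK a b X

lemma TT_pos (a b : ℕ) (X : ℚ) (h0 : 0 < X) (ha : 2*(a:ℚ)-1 < X) (hb : 2*(b:ℚ)-1 < X) : 0 < TT a b X :=
  mul_pos (mul_pos (Gs_pos _ (Or.inl rfl) _ _ ha) (Gs_pos _ (Or.inr rfl) _ _ hb)) (KK_pos _ _ h0 hb _ ha)

lemma TT_R1' (a b : ℕ) (X : ℚ) : TT (a+1) (b+1) X * TT (a-1) (b-1) X =
    kk (a+1) (b+1) X * (TT (a-1) (b+1) X * TT (a+1) (b-1) X) := by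
  unfold TT
  linear_combination (Gs 1 (a+1) X * Gs (-1) (b+1) X * Gs 1 (a-1) X * Gs (-1) (b-1) X) * KK_R1 a b X

lemma TT_R1 (a b : ℕ) (X : ℚ) (h0 : 0 < X) (ha : 2*(a:ℚ)+1 < X) (hb : 2*(b:ℚ)+1 < X) :
    (X^2 - ((a:ℚ)+b+1)^2) * (TT (a+1) (b+1) X * TT (a-1) (b-1) X) =
    (X^2 - ((a:ℚ)-b)^2) * (TT (a-1) (b+1) X * TT (a+1) (b-1) X) := by
  rw [TT_R1']
  unfold kk
  have h1 : (0:ℚ) ≤ a := by positivity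
  have h2 : (0:ℚ) ≤ b := by positivity
  have e : X^2 - ((a:ℚ)+b+1)^2 ≠ 0 := by nlinarith
  push_cast
  rw [show (a:ℚ)+1+(b+1)-1 = a+b+1 by ring, show (a:ℚ)+1-(b+1) = a-b by ring]
  field_simp

def R2 (a b : ℕ) (X : ℚ) : Prop :=
  TT a b (X-2) * TT a b (X+2) * (X^2-((a:ℚ)-b)^2) =
    (2*a+1)*(2*b+1) * (TT (a+1) (b+1) X * TT (a-1) (b-1) X)

lemma R2_alg (t1 t2 t3 t4 t5 t6 t7 t8 t9 t10 t11 t12 t13 t14 t15 d0 d1 d2 e3 e4 e5 e6 k1 k2 s1 s2 u1 u2 : ℚ)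
    (r1 : e5 * (t1*t6) = k1*(t10*t8)) (r2 : e6*(t2*t7) = k2*(t11*t9))
    (r3 : e3*(t3*t4) = d0*(t12*t13)) (r4 : e4*(t4*t5) = d0*(t14*t15))
    (h00 : t6*t7*d0 = s1*s2*(t4*t5)) (h10 : t8*t9*d1 = u1*s2*(t13*t15))
    (h01 : t10*t11*d2 = s1*u2*(t12*t14)) (hk : k1*k2 = d1*d2) (he : e5*e6 = e3*e4)
    (n3 : e3 ≠ 0) (n4 : e4 ≠ 0) (m1 : s1 ≠ 0) (m2 : s2 ≠ 0) (m4 : t4 ≠ 0) (m5 : t5 ≠ 0) :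
    t1*t2*d0 = u1*u2*(t3*t4) := by
  have q1 : t1*t2*(t6*t7)*(e5*e6) = u1*s2*s1*u2*(t12*t13*t14*t15) := by
    calc t1*t2*(t6*t7)*(e5*e6) = (e5*(t1*t6))*(e6*(t2*t7)) := by ring
      _ = (k1*k2)*(t8*t9)*(t10*t11) := by rw [r1, r2]; ring
      _ = (t8*t9*d1)*(t10*t11*d2) := by rw [hk]; ring
      _ = _ := by rw [h10, h01]; ring
  have q2 : t1*t2*(e3*e4)*(s1*s2*(t4*t5))*d0 = u1*s2*s1*u2*((e3*(t3*t4))*(e4*(t4*t5))) := by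
    rw [r3, r4, ← h00, ← he]
    linear_combination d0*d0*q1
  apply mul_left_cancel₀ (mul_ne_zero (mul_ne_zero n3 n4) (mul_ne_zero (mul_ne_zero m1 m2) (mul_ne_zero m4 m5)))
  linear_combination q2

lemma sq_sub_ne {X y : ℚ} (h1 : y < X) (h2 : -X < y) : X^2-y^2 ≠ 0 := by
  have : 0 < (X-y)*(X+y) := mul_pos (by linarith) (by linarith)
  intro h; linarith

lemma R2_step (a b : ℕ) (X : ℚ) (ha : 2*((a:ℚ)+2)+1 < X) (hb : 2*((b:ℚ)+2)+1 < X)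
    (h00 : R2 a b X) (h10 : R2 (a+2) b X) (h01 : R2 a (b+2) X) : R2 (a+2) (b+2) X := by
  unfold R2 at *
  have h1 : (0:ℚ) ≤ a := by positivity
  have h2 : (0:ℚ) ≤ b := by positivity
  have r1 := TT_R1 (a+1) (b+1) (X-2) (by linarith) (by push_cast; linarith) (by push_cast; linarith)
  have r2 := TT_R1 (a+1) (b+1) (X+2) (by linarith) (by push_cast; linarith) (by push_cast; linarith)
  have r3 := TT_R1 (a+2) (b+2) X (by linarith) (by push_cast; linarith) (by push_cast; linarith)
  have r4 := TT_R1 a b X (by linarith) (by linarith) (by linarith)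
  push_cast at *
  simp only [show a+1+1 = a+2 from rfl, show b+1+1 = b+2 from rfl, show a+2+1 = a+3 from rfl,
    show b+2+1 = b+3 from rfl, Nat.add_sub_cancel, show a+2-1 = a+1 from rfl, show b+2-1 = b+1 from rfl] at *
  have p11 := TT_pos (a+1) (b+1) X (by linarith) (by push_cast; linarith) (by push_cast; linarith)
  have pm : 0 < TT (a-1) (b-1) X := by
    apply TT_pos _ _ _ (by linarith)
    · have : ((a-1:ℕ):ℚ) ≤ a := by exact_mod_cast Nat.sub_le a 1
      linarith
    · have : ((b-1:ℕ):ℚ) ≤ b := by exact_mod_cast Nat.sub_le b 1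
      linarith
  have main := R2_alg _ _ _ _ _ _ _ _ _ _ _ _ _ _ _ _ _ _ _ _ _ _ _ _ _ _ _ _
    (r1.trans (by rfl)) (r2.trans (by rfl)) (r3.trans (congrArg (fun z => (X^2-z^2) * _) (show (a:ℚ)+2-(b+2) = a - b by ring))) r4
    h00 h10 h01 (by ring) (by ring)
    (sq_sub_ne (by linarith) (by linarith)) (sq_sub_ne (by linarith) (by linarith))
    (by positivity) (by positivity) p11.ne' pm.ne'
  rw [show (a:ℚ)+2-(b+2) = a - b by ring]
  exact main

lemma R2_all (X : ℚ) : ∀ a b : ℕ, 2*(a:ℚ)+1 < X → 2*(b:ℚ)+1 < X → R2 a b X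
  | a, 0, ha, hb => by
    have := RB0 1 (Or.inl rfl) X a ha
    unfold R2 TT
    simp only [Nat.zero_sub, zero_add, Gs_zero, KK_zero_right]
    push_cast
    linear_combination this
  | 0, b, ha, hb => by
    have := RB0 (-1) (Or.inr rfl) X b hb
    unfold R2 TT
    simp only [Nat.zero_sub, zero_add, Gs_zero, KK_symm _ 1 _, KK_symm _ 0 _, KK_zero_right]
    rw [neg_neg] at this
    push_cast
    linear_combination this
  | a, 1, ha, hb => by
    have := RB1 1 (Or.inl rfl) X a ha (by push_cast at hb; linarith)
    unfold R2 TT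
    simp only [Nat.sub_self, show 1 + 1 = 2 from rfl, Gs_zero, KK_zero_right]
    push_cast
    linear_combination this
  | 1, b, ha, hb => by
    have := RB1 (-1) (Or.inr rfl) X b hb (by push_cast at ha; linarith)
    unfold R2 TT
    simp only [Nat.sub_self, show 1 + 1 = 2 from rfl, Gs_zero, KK_symm _ 1 _, KK_symm _ 0 _, KK_symm _ 2 _, KK_zero_right]
    rw [neg_neg] at this
    push_cast
    linear_combination this
  | (a+2), (b+2), ha, hb => by
    push_cast at ha hb
    exact R2_step a b X ha hb (R2_all X a b (by linarith) (by linarith))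
      (R2_all X (a+2) b (by push_cast; linarith) (by linarith))
      (R2_all X a (b+2) (by linarith) (by push_cast; linarith))

open Finset PowerSeries

lemma neg_one_pow_half (K : ℕ) : (-1:ℚ)^((K+1)/2) = (-1)^K * (-1)^(K/2) := by
  rcases Nat.even_or_odd' K with ⟨c, rfl | rfl⟩
  · rw [show (2*c+1)/2 = c by omega, show 2*c/2 = c by omega, pow_mul]; simp
  · rw [show (2*c+1+1)/2 = c+1 by omega, show (2*c+1)/2 = c by omega, pow_succ, pow_succ, pow_mul]; simp

lemma cdet_J : ∀ a : ℕ, cdet a (fun i k => if i + k + 1 = a then 1 else 0) = (-1)^(a/2)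
  | 0 => by simp [cdet]
  | (K+1) => by
    rw [cdet_expL K 0 (by omega) _ (by simp) (by intro j hj; simp; omega), neg_one_pow_half, ← cdet_J K]
    rw [zero_add]
    congr 1
    apply cdet_congr
    intro i hi j hj
    simp only [skp, Nat.not_lt_zero, if_false]
    congr 1
    simp only [eq_iff_iff]
    omega

lemma cdet_rev_row (a : ℕ) (r : ℕ → ℕ → ℚ) :
    cdet a (fun i k => r (a-1-i) k) = (-1)^(a/2) * cdet a r := by
  rw [← cdet_J]
  unfold cdet
  rw [← Matrix.det_mul]
  congr 1
  ext i k
  rw [Matrix.mul_apply]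
  simp only [Matrix.of_apply, ite_mul, one_mul, zero_mul]
  rw [Finset.sum_eq_single (⟨a-1-i, by omega⟩ : Fin a)]
  · rw [if_pos (by simp; omega)]
  · intro b _ hb
    rw [if_neg]
    intro h
    apply hb
    ext; simp; omega
  · simp

lemma cdet_tr (a : ℕ) (r : ℕ → ℕ → ℚ) : cdet a (fun i k => r k i) = cdet a r := by
  unfold cdet
  rw [← Matrix.det_transpose]; rfl

lemma cdet_rev_col (a : ℕ) (r : ℕ → ℕ → ℚ) :
    cdet a (fun i k => r i (a-1-k)) = (-1)^(a/2) * cdet a r := by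
  rw [← cdet_tr, cdet_rev_row a (fun i k => r k i), cdet_tr]

lemma st_base_a (a : ℕ) (X : ℚ) : st a 0 X = TT a 0 X := by
  unfold st Mm TT
  have : cdet (a+0) (marr a 0 ((X-2*a+1)/2) ((-X-2*(0:ℕ)+1)/2)) = (-1)^(a/2) * Gd a ((X-2*a+1)/2) := by
    rw [add_zero, Gd, ← cdet_rev_row]
    apply cdet_congr
    intro i hi j hj
    rw [marr, if_pos hi]
  rw [this, Gd_eq, KK_zero_right, Gs_zero, Gs, add_zero, ← mul_assoc, ← mul_pow]
  norm_num
  congr 1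
  ring

lemma st_base_b (b : ℕ) (X : ℚ) : st 0 b X = TT 0 b X := by
  unfold st Mm TT
  have : cdet (0+b) (marr 0 b ((X-2*(0:ℕ)+1)/2) ((-X-2*b+1)/2)) = (-1)^(b/2) * Gd b ((-X-2*b+1)/2) := by
    rw [zero_add, Gd, ← cdet_rev_col]
    apply cdet_congr
    intro i hi j hj
    rw [marr, if_neg (by omega)]
    simp
  rw [this, Gd_eq, KK, Gs_zero, Gs, neg_one_pow_half]
  norm_num
  rw [← mul_assoc]
  congr 2
  ring

theorem st_eq : ∀ (s a b : ℕ) (X : ℚ), a + b = s → 0 < X → 2*(a:ℚ)-1 < X → 2*(b:ℚ)-1 < X →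
    st a b X = TT a b X := by
  intro s
  induction s using Nat.strong_induction_on with
  | _ s ih =>
    intro a b X hs h0 ha hb
    rcases a with _ | a
    · exact st_base_b b X
    rcases b with _ | b
    · exact st_base_a _ X
    push_cast at ha hb
    have h1 : (0:ℚ) ≤ a := by positivity
    have h2 : (0:ℚ) ≤ b := by positivity
    have ca : ((a-1:ℕ):ℚ) ≤ a := by exact_mod_cast Nat.sub_le a 1
    have cb : ((b-1:ℕ):ℚ) ≤ b := by exact_mod_cast Nat.sub_le b 1
    have r := st_rec a b X
    have e0 : st a b (X-2) = TT a b (X-2) := by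
      rcases Nat.eq_zero_or_pos a with rfl | hpa
      · exact st_base_b _ _
      have h3 : (1:ℚ) ≤ a := by exact_mod_cast hpa
      exact ih (a+b) (by omega) _ _ (X-2) rfl (by linarith) (by linarith) (by linarith)
    rw [ih (a-1+(b-1)) (by omega) _ _ _ rfl h0 (by linarith) (by linarith),
      ih (a+1+(b-1)) (by omega) _ _ _ rfl h0 (by push_cast; linarith) (by linarith),
      ih (a-1+(b+1)) (by omega) _ _ _ rfl h0 (by linarith) (by push_cast; linarith),
      ih (a+b) (by omega) _ _ (X+2) rfl (by linarith) (by linarith) (by linarith), e0] at r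
    have p := TT_pos (a-1) (b-1) X h0 (by linarith) (by linarith)
    apply mul_right_cancel₀ p.ne'
    rw [r]
    have e1 := TT_R1 a b X h0 (by linarith) (by linarith)
    have e2 := R2_all X a b (by linarith) (by linarith)
    unfold R2 at e2
    apply mul_left_cancel₀ (sq_sub_ne (X := X) (y := (a:ℚ)-b) (by linarith) (by linarith))
    linear_combination -e1 + e2

def tau (n : ℕ) (l : ℚ) : ℚ := ∏ j ∈ Finset.range n, ∏ i ∈ Finset.range (j + 1),
          (2 * (((i : ℚ) + 1) + ((j : ℚ) + 1)) + l - 3) / (2 * ((i : ℚ) + 1) - 1)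

def rowp (j : ℕ) (l : ℚ) : ℚ := ∏ i ∈ Finset.range (j + 1),
          (2 * (((i : ℚ) + 1) + ((j : ℚ) + 1)) + l - 3) / (2 * ((i : ℚ) + 1) - 1)

lemma tau_succ (n : ℕ) (l : ℚ) : tau (n+1) l = tau n l * rowp n l := by
  rw [tau, prod_range_succ]; rfl

lemma rowp_pos (n : ℕ) (l : ℚ) (hl : 0 < l) : 0 < rowp n l := by
  apply prod_pos
  intro i _
  have h1 : (0:ℚ) ≤ i := by positivity
  have h2 : (0:ℚ) ≤ n := by positivity
  apply div_pos <;> linarith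

lemma tau_pos (n : ℕ) (l : ℚ) (hl : 0 < l) : 0 < tau n l := by
  induction n with
  | zero => simp [tau]
  | succ n ih => rw [tau_succ]; exact mul_pos ih (rowp_pos _ _ hl)

lemma rowp_step (m : ℕ) (l : ℚ) : rowp m (l+4) * (l+2*m+3) = (2*m+3) * rowp (m+1) l := by
  unfold rowp
  rw [prod_div_distrib, prod_div_distrib, prod_range_succ' _ (m+1),
    prod_range_succ (fun i : ℕ => 2 * ((i:ℚ)+1) - 1) (m+1)]
  have hd : ∏ i ∈ range (m+1), (2 * ((i:ℚ)+1) - 1) ≠ 0 := by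
    apply prod_ne_zero_iff.mpr
    intro i _
    have h1 : (0:ℚ) ≤ i := by positivity
    have : 0 < (2 * ((i:ℚ)+1) - 1) := by linarith
    exact this.ne'
  have hn : ∏ k ∈ range (m + 1), (2 * (((k+1:ℕ):ℚ) + 1 + (((m+1:ℕ):ℚ) + 1)) + l - 3) =
    ∏ k ∈ range (m + 1), (2 * ((k:ℚ) + 1 + ((m:ℚ) + 1)) + (l+4) - 3) := by
    apply prod_congr rfl; intros; push_cast; ring
  rw [hn]
  have h2 : 2 * (((m+1:ℕ):ℚ) + 1) - 1 ≠ 0 := by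
    push_cast
    have : (0:ℚ) ≤ m := by positivity
    intro h
    linarith
  push_cast at h2 ⊢
  field_simp
  ring

lemma tau_step (n : ℕ) (l : ℚ) :
    tau n l * tau n (l+4) * (l+2*n+1) = (2*n+1) * (tau (n+1) l * tau (n-1) (l+4)) := by
  rcases n with _ | m
  · simp [tau]; ring
  · rw [tau_succ m (l+4), tau_succ (m+1), Nat.add_sub_cancel]
    push_cast
    linear_combination tau (m+1) l * tau m (l+4) * rowp_step m l

lemma TT_diag : ∀ (n : ℕ) (l : ℚ), 0 < l → TT n n (l+2*n-1) = (tau n l)^2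
  | 0, l, hl => by simp [TT, tau, Gs_zero, KK]
  | 1, l, hl => by
    rw [TT, Gs_one _ (Or.inl rfl), Gs_one _ (Or.inr rfl)]
    simp only [KK, kap, kk, tau]
    norm_num
    have : l + 2 - 1 ≠ 0 := by linarith
    have : l ≠ 0 := by linarith
    field_simp
    have h3 : (l + 2 - 1)^2 - 1 ≠ 0 := by nlinarith
    rw [div_eq_iff h3]; ring
  | (n+2), l, hl => by
    have h0 : (0:ℚ) ≤ n := by positivity
    have e := R2_all (l + 2*(n+2)-1) (n+1) (n+1) (by push_cast; linarith) (by push_cast; linarith)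
    unfold R2 at e
    have i1 := TT_diag (n+1) l hl
    have i2 := TT_diag (n+1) (l+4) (by linarith)
    have i3 := TT_diag n (l+4) (by linarith)
    have t := tau_step (n+1) l
    push_cast at *
    simp only [Nat.add_sub_cancel, show n+1+1 = n+2 from rfl] at e t ⊢
    rw [show l + 2*((n:ℚ)+2) - 1 - 2 = l + 2 * (n+1) - 1 by ring, show l + 2*((n:ℚ)+2) - 1 + 2 = l + 4 + 2 * (n+1) - 1 by ring,
      i1, i2, show l + 2*((n:ℚ)+2) - 1 = l + 4 + 2 * n - 1 by ring, i3, show l + 4 + 2 * (n:ℚ) - 1 = l + 2*((n:ℚ)+2) - 1 by ring] at e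
    have p := tau_pos n (l+4) (by linarith)
    have q : (2*((n:ℚ)+1)+1) ≠ 0 := by positivity
    apply mul_left_cancel₀ (mul_ne_zero (pow_ne_zero 2 q) (pow_ne_zero 2 p.ne'))
    have t2 := congrArg (fun z => z^2) t
    linear_combination t2 - e

theorem Mm_diag (n : ℕ) (l : ℚ) (hl : 0 < l) : |Mm n n (l/2) (1-2*n-l/2)| = (tau n l)^2 := by
  rcases Nat.eq_zero_or_pos n with rfl | hn
  · simp [Mm, cdet, tau]
  have h1 : (1:ℚ) ≤ n := by exact_mod_cast hn
  rw [← TT_diag n l hl, ← st_eq _ n n _ rfl (by linarith) (by linarith) (by linarith)]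
  have hp : 0 < st n n (l+2*n-1) := by
    rw [st_eq _ n n _ rfl (by linarith) (by linarith) (by linarith)]
    exact TT_pos _ _ _ (by linarith) (by linarith) (by linarith)
  rw [← abs_of_pos hp, st, abs_mul, abs_pow]
  norm_num
  congr 1
  apply Mm_eq <;> ring

open Finset PowerSeries

lemma even_mat (a : ℕ) (E : PowerSeries ℚ) (hE : rescale (-1 : ℚ) E = E)
    (h0 : constantCoeff E = 1) : ∃ C : Matrix (Fin a) (Fin a) ℚ, C.det = 1 ∧
      ∀ (F : PowerSeries ℚ) (i : Fin a), coeff (2*(i:ℕ)+1) (E * F) = ∑ j, C i j * coeff (2*(j:ℕ)+1) F := by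
  refine ⟨Matrix.of fun i j => if (j : ℕ) ≤ i then coeff (2*((i:ℕ)-j)) E else 0, ?_, ?_⟩
  · rw [Matrix.det_of_isLowerTriangular]
    · apply Finset.prod_eq_one
      intro i _
      simp [h0]
    · intro i j hij
      simp only [Matrix.of_apply]
      rw [if_neg]
      have : (i : Fin a) < j := hij
      rw [Fin.lt_def] at this
      omega
  · intro F i
    rw [even_expand E hE]
    simp only [Matrix.of_apply, ite_mul, zero_mul]
    rw [Fin.sum_univ_eq_sum_range (fun j => if j ≤ (i:ℕ) then coeff (2*((i:ℕ)-j)) E * coeff (2*j+1) F else 0) a]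
    rw [← Finset.sum_filter]
    apply Finset.sum_congr _ (fun _ _ => rfl)
    ext j
    simp only [Finset.mem_range, Finset.mem_filter]
    have := i.2
    omega

noncomputable def qI : PowerSeries ℚ := (1 - X^2)⁻¹

lemma qI_mul : qI * (1 - X^2) = 1 := by
  unfold qI
  apply PowerSeries.inv_mul_cancel
  simp

noncomputable def rI : PowerSeries ℚ := (1 + 2*X - X^2) * qI

lemma rI_mul : rI * (1 - X^2) = 1 + 2*X - X^2 := by
  rw [rI, mul_assoc, qI_mul, mul_one]

lemma US_nat (d : ℕ) : US (-(d:ℚ)) = US (-1) ^ d := by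
  induction d with
  | zero => simp [US_zero]
  | succ d ih => rw [pow_succ, ← ih, ← US_add]; congr 1; push_cast; ring

lemma one_sub_sq_ne : (1 - X^2 : PowerSeries ℚ) ≠ 0 := by
  intro h
  have := qI_mul
  rw [h] at this
  simp at this

lemma rho_coeff (d : ℕ) : coeff d (US (-(d:ℚ)) * rI) = if d = 0 then 1 else 0 := by
  rcases d with _ | d
  · simp [US_zero, rI, qI]
  rw [if_neg (by omega)]
  set V := US (-1) with hV
  have v1 : V * (1 + X) = 1 - X := by
    rw [hV, ← US_one, ← mul_assoc, US_neg_mul, one_mul]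
  have v2 : (PowerSeries.derivative ℚ V) * (1 - X^2) = -2 * V := by
    have := congrArg (PowerSeries.derivative ℚ) v1
    simp only [Derivation.leibniz, map_add, map_sub, smul_eq_mul, Derivation.map_one_eq_zero, PowerSeries.derivative_X] at this
    linear_combination (1 - X) * this + v1
  set W := V^(d+1) with hW
  have w1 : (PowerSeries.derivative ℚ W) * (1 - X^2) = -2 * ((d:PowerSeries ℚ)+1) * W := by
    rw [hW, Derivation.leibniz_pow]
    simp only [smul_eq_mul, nsmul_eq_mul, Nat.add_sub_cancel]
    push_cast
    linear_combination ((d:PowerSeries ℚ)+1) * V^d * v2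
  have w2 : ((d:PowerSeries ℚ)+1) * (W * rI) = ((d:PowerSeries ℚ)+1) * W - X * PowerSeries.derivative ℚ W := by
    apply mul_right_cancel₀ one_sub_sq_ne
    linear_combination ((d:PowerSeries ℚ)+1) * W * rI_mul + X * w1
  have w3 := congrArg (coeff (d+1)) w2
  rw [show ((d:PowerSeries ℚ)+1) = C ((d:ℚ)+1) by simp, coeff_C_mul, map_sub, coeff_C_mul, mul_comm X,
    coeff_succ_mul_X, PowerSeries.coeff_derivative] at w3
  rw [US_nat]
  have h : ((d:ℚ)+1) * coeff (d+1) (W * rI) = 0 := by rw [w3]; ring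
  rcases mul_eq_zero.mp h with h | h
  · have : (0:ℚ) ≤ d := by positivity
    linarith
  · exact h

/-- the array `X_{a,k}` -/
noncomputable def Rr (p : ℚ) (k a : ℕ) : ℚ := coeff a (US p * wS^k)

noncomputable def Yy (p : ℚ) (k a : ℕ) : ℚ := if a ≤ k then coeff (k-a) (US (-p-k) * rI) else 0

lemma Rr_diag (p : ℚ) (k : ℕ) : Rr p k k = 1 := by
  unfold Rr
  rw [wS_pow]
  have := coeff_X_pow_mul (US (p+k)) k 0
  rw [zero_add] at this
  rw [this, US_coeff_zero]

lemma Rr_lt (p : ℚ) (k a : ℕ) (h : a < k) : Rr p k a = 0 := by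
  unfold Rr
  rw [wS_pow, coeff_X_pow_mul', if_neg (by omega)]

lemma YX (p : ℚ) (m k k' : ℕ) (hk : k < m) : ∑ a ∈ range m, Yy p k a * Rr p k' a = if k = k' then 1 else 0 := by
  have h1 : ∑ a ∈ range m, Yy p k a * Rr p k' a = coeff k ((US p * wS^k') * (US (-p-k) * rI)) := by
    rw [coeff_mul, Finset.Nat.sum_antidiagonal_eq_sum_range_succ_mk]
    symm
    apply Finset.sum_subset_zero_on_sdiff
    · intro a; simp only [mem_range]; omega
    · intro a ha
      simp only [mem_sdiff, mem_range] at ha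
      rw [Yy, if_neg (by omega), zero_mul]
    · intro a ha
      simp only [mem_range] at ha
      rw [Yy, if_pos (by omega), mul_comm]
      rfl
  rw [h1, wS_pow, mul_assoc]
  rw [coeff_X_pow_mul']
  split_ifs with h2 h3 h3
  · subst h3
    rw [← mul_assoc, ← US_add, show p + (k:ℚ) + (-p-k) = -((0:ℕ):ℚ) by push_cast; ring]
    rw [show k - k = 0 by omega, rho_coeff]; simp
  · rw [← mul_assoc, ← US_add, show p + (k':ℚ) + (-p-k) = -((k-k':ℕ):ℚ) by push_cast [h2]; ring, rho_coeff,
      if_neg (by omega)]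
  · omega
  · rfl

lemma XY (p : ℚ) (m : ℕ) (a a' : Fin m) : ∑ k ∈ range m, Rr p k a' * Yy p k a = if a = a' then 1 else 0 := by
  let Xm : Matrix (Fin m) (Fin m) ℚ := Matrix.of fun a k => Rr p k a
  let Ym : Matrix (Fin m) (Fin m) ℚ := Matrix.of fun k a => Yy p k a
  have h : Ym * Xm = 1 := by
    ext k k'
    rw [Matrix.mul_apply, Matrix.one_apply]
    simp only [Xm, Ym, Matrix.of_apply]
    rw [Fin.sum_univ_eq_sum_range (fun a => Yy p k a * Rr p k' a), YX p m k k' k.2]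
    simp [Fin.ext_iff]
  have h2 : Xm * Ym = 1 := mul_eq_one_comm.mp h
  have h3 := congrFun (congrFun h2 a') a
  rw [Matrix.mul_apply, Matrix.one_apply] at h3
  simp only [Xm, Ym, Matrix.of_apply] at h3
  rw [Fin.sum_univ_eq_sum_range (fun k => Rr p k a' * Yy p k a)] at h3
  rw [h3]
  simp [eq_comm]

open Finset PowerSeries

/-- `Ō_b(k)` -/
noncomputable def Ob (p : ℚ) (m b k : ℕ) : ℚ := Rr p k b + 2 * ∑ k' ∈ Ioo k m, Rr p k' b

lemma Ob_diff (p : ℚ) (m b k : ℕ) (hk : k + 1 < m) : Ob p m b k - Ob p m b (k+1) = Rr p k b + Rr p (k+1) b := by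
  unfold Ob
  have : Ioo k m = insert (k+1) (Ioo (k+1) m) := by
    ext x; simp only [mem_Ioo, mem_insert]; omega
  rw [this, sum_insert (by simp)]
  ring

/-- generic rows of the matrix B -/
noncomputable def Sr (p : ℚ) (m i k : ℕ) : ℚ := if i = 0 then 1 else Ob p m (2*(i-1)+1) k

noncomputable def Bm (n : ℕ) (p : ℚ) : Matrix (Fin (n+1)) (Fin (n+1)) ℚ :=
  Matrix.of fun i j => ∑ k ∈ range (2*n+1), Sr p (2*n+1) i k * Rr p k (2*j)

def evenOdd (n : ℕ) : Fin (n+1) ⊕ Fin n ≃ Fin (2*n+1) where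
  toFun := Sum.elim (fun i => ⟨2*i, by omega⟩) (fun i => ⟨2*i+1, by omega⟩)
  invFun a := if h : (a:ℕ) % 2 = 0 then Sum.inl ⟨a/2, by omega⟩ else Sum.inr ⟨a/2, by omega⟩
  left_inv := by
    rintro (i | i)
    · simp
    · have : ¬ ((2*(i:ℕ)+1) % 2 = 0) := by omega
      dsimp only [Sum.elim_inr]
      rw [dif_neg this]
      congr 1
      apply Fin.ext; simp; omega
  right_inv := by
    intro a
    by_cases h : (a:ℕ) % 2 = 0
    · simp only [h, dite_true, Sum.elim_inl]; ext; simp; omega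
    · simp only [h, dite_false, Sum.elim_inr]; ext; simp; omega

noncomputable def Sfull (n : ℕ) (p : ℚ) : Matrix (Fin (n+1) ⊕ Fin n) (Fin (2*n+1)) ℚ :=
  Matrix.of fun i k => Sum.elim (fun i : Fin (n+1) => Sr p (2*n+1) i k) (fun i : Fin n => Yy p k (2*i+1)) i

lemma det_Bm (n : ℕ) (p : ℚ) : (Bm n p).det = ((Sfull n p).submatrix id (evenOdd n)).det := by
  let Xm : Matrix (Fin (2*n+1)) (Fin (2*n+1)) ℚ := Matrix.of fun k a => Rr p k a
  have hX : Xm.det = 1 := by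
    rw [Matrix.det_of_isUpperTriangular]
    · apply Finset.prod_eq_one
      intro i _; exact Rr_diag p i
    · intro i j hij
      exact Rr_lt p i j hij
  have h1 : (Sfull n p).submatrix id (evenOdd n) * Xm.submatrix (evenOdd n) (evenOdd n) =
      Matrix.fromBlocks (Bm n p) (Matrix.of fun (i : Fin (n+1)) (j : Fin n) => ∑ k ∈ range (2*n+1), Sr p (2*n+1) i k * Rr p k (2*j+1)) 0 1 := by
    rw [Matrix.submatrix_mul_equiv]
    ext i j
    rw [Matrix.submatrix_apply, Matrix.mul_apply]
    rcases i with i | i <;> rcases j with j | j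
    · simp only [Sfull, Xm, Matrix.of_apply, evenOdd, id, Sum.elim_inl, Equiv.coe_fn_mk, Matrix.fromBlocks_apply₁₁, Bm]
      rw [Fin.sum_univ_eq_sum_range (fun k => Sr p (2*n+1) i k * Rr p k (2*j))]
    · simp only [Sfull, Xm, Matrix.of_apply, evenOdd, id, Sum.elim_inl, Sum.elim_inr, Equiv.coe_fn_mk, Matrix.fromBlocks_apply₁₂]
      rw [Fin.sum_univ_eq_sum_range (fun k => Sr p (2*n+1) i k * Rr p k (2*j+1))]
    · simp only [Sfull, Xm, Matrix.of_apply, evenOdd, id, Sum.elim_inl, Sum.elim_inr, Equiv.coe_fn_mk, Matrix.fromBlocks_apply₂₁]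
      rw [Fin.sum_univ_eq_sum_range (fun k => Yy p k (2*i+1) * Rr p k (2*j))]
      have := XY p (2*n+1) ⟨2*i+1, by omega⟩ ⟨2*j, by omega⟩
      rw [if_neg (by simp; omega)] at this
      simp only [mul_comm (Yy _ _ _)]
      exact this
    · simp only [Sfull, Xm, Matrix.of_apply, evenOdd, id, Sum.elim_inl, Sum.elim_inr, Equiv.coe_fn_mk, Matrix.fromBlocks_apply₂₂]
      rw [Fin.sum_univ_eq_sum_range (fun k => Yy p k (2*i+1) * Rr p k (2*j+1))]
      have := XY p (2*n+1) ⟨2*i+1, by omega⟩ ⟨2*j+1, by omega⟩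
      simp only [mul_comm (Yy _ _ _)]
      rw [this, Matrix.one_apply]
      congr 1
      simp [Fin.ext_iff]
  have h2 := congrArg Matrix.det h1
  rw [Matrix.det_mul, Matrix.det_submatrix_equiv_self, hX, mul_one, Matrix.det_fromBlocks_zero₂₁, Matrix.det_one, mul_one] at h2
  exact h2.symm

/-- the array of S in natural order -/
noncomputable def sarr (n : ℕ) (p : ℚ) (i k : ℕ) : ℚ :=
  if i < n+1 then Sr p (2*n+1) i k else Yy p k (2*(i-(n+1))+1)

lemma abs_Bm (n : ℕ) (p : ℚ) : |(Bm n p).det| = |cdet (2*n+1) (sarr n p)| := by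
  let f : Fin (n+1) ⊕ Fin n ≃ Fin (2*n+1) := finSumFinEquiv.trans (finCongr (by ring))
  unfold cdet
  rw [det_Bm, ← Matrix.abs_det_submatrix_equiv_equiv f (evenOdd n) (Matrix.of fun i k : Fin (2*n+1) => sarr n p i k)]
  congr 2
  ext i k
  rcases i with i | i
  · simp [f, Sfull, sarr]
    intro h
    have := i.2; omega
  · simp [f, Sfull, sarr]
    intro h
    omega

lemma abs_cdet_scale (K : ℕ) (r : ℕ → ℕ → ℚ) (c : ℕ → ℚ) (hc : ∀ k, |c k| = 1) :
    |cdet K (fun i k => c k * r i k)| = |cdet K r| := by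
  unfold cdet
  have := Matrix.det_mul_row (fun k : Fin K => c k) (Matrix.of fun i k : Fin K => r i k)
  have h2 : (Matrix.of fun i j : Fin K => c j * r i j) = Matrix.of fun i j : Fin K => c j * (Matrix.of fun i k : Fin K => r i k) i j := rfl
  rw [h2, this, abs_mul, Finset.abs_prod]
  simp [hc]

lemma abs_neg_one_pow' (k : ℕ) : |(-1:ℚ)^k| = 1 := by simp

lemma abs_cols (K : ℕ) (r : ℕ → ℕ → ℚ) (h0 : ∀ k, r 0 k = 1) :
    |cdet (K+1) r| = |cdet K (fun i k => r (i+1) k - r (i+1) (k+1))| := by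
  rw [← abs_cdet_scale (K+1) r (fun k => (-1)^k) abs_neg_one_pow',
    ← abs_cdet_scale K _ (fun k => (-1)^k) abs_neg_one_pow',
    cdet_cols K _ (by intro k; simp [h0, pow_succ]) (by simp [h0])]
  congr 2
  funext i k
  rw [pow_succ]; ring

/-- common even factor of the second block -/
noncomputable def c0 : PowerSeries ℚ := ((1 - 2*X - X^2) * (1 + 2*X - X^2)) * qI^2 * ((1 + X) * US (-(1/2)))

lemma qI_even : rescale (-1 : ℚ) qI = qI := by
  have h := congrArg (rescale (-1:ℚ)) qI_mul
  simp only [map_mul, map_sub, map_one, map_pow, rescale_neg_one_X, neg_sq] at h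
  apply mul_right_cancel₀ one_sub_sq_ne
  rw [h, qI_mul]

lemma US_half_even : (1 - X) * US (1/2) = (1 + X) * US (-(1/2)) := by
  have h2 : US (1 : ℚ) * US (-(1/2)) = US (1/2) := by rw [← US_add]; norm_num
  linear_combination (-(1-X)) * h2 + US (-(1/2)) * US_one

lemma c0_even : rescale (-1 : ℚ) c0 = c0 := by
  unfold c0
  simp only [map_mul, map_sub, map_add, map_one, map_pow, rescale_neg_one_X, neg_sq, US_rescale, neg_neg, qI_even, map_ofNat]
  have := US_half_even
  linear_combination ((1 - 2*X - X^2) * (1 + 2*X - X^2)) * qI^2 * this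

lemma c0_const : constantCoeff c0 = 1 := by
  simp [c0, qI, US_const]

lemma Yy_diff (p : ℚ) (k a : ℕ) (ha : 1 ≤ a) :
    Yy p k a - Yy p (k+1) a = - (if a ≤ k+1 then coeff (k+1-a) (c0 * US (1/2-p-k-1)) else 0) := by
  have key : US (-p-k) * rI * X - US (-p-(k+1:ℕ)) * rI = - (c0 * US (1/2-p-k-1)) := by
    have h1 : US (-p-k) = US (-p-(k+1:ℕ)) * US 1 := by rw [← US_add]; congr 1; push_cast; ring
    have h2 : US (1/2-p-k-1) = US (1/2) * US (-p-(k+1:ℕ)) := by rw [← US_add]; congr 1; push_cast; ring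
    have h3 := US_neg_mul (1/2)
    rw [h1, h2, c0, rI]
    generalize US (-p-(k+1:ℕ)) = u
    have h4 := US_one
    have h5 := qI_mul
    have hx : (1 - X : PowerSeries ℚ) ≠ 0 := by
      intro h
      have := congrArg constantCoeff h
      simp at this
    apply mul_right_cancel₀ hx
    linear_combination u * (1+2*X-X^2) * qI * X * h4 + u * (1+2*X-X^2) * (1-2*X-X^2) * qI * h5
      + u * (1+2*X-X^2) * (1-2*X-X^2) * qI^2 * (1+X) * (1-X) * h3
  have key2 := congrArg (fun F => coeff (k+1-a) F) key
  simp only [map_sub, map_neg] at key2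
  split_ifs with h
  · rw [← key2, Yy, Yy, if_pos h]
    congr 1
    split_ifs with h2
    · rw [show k+1-a = k-a+1 by omega, coeff_succ_mul_X]
    · rw [show k+1-a = 0 by omega]; simp
  · rw [Yy, Yy, if_neg h, if_neg (by omega)]; simp

/-- block form -/
lemma abs_blocks (n : ℕ) (E1 E2 : PowerSeries ℚ) (hE1 : rescale (-1 : ℚ) E1 = E1) (h1 : constantCoeff E1 = 1)
    (hE2 : rescale (-1 : ℚ) E2 = E2) (h2 : constantCoeff E2 = 1) (F G : ℕ → PowerSeries ℚ)
    (r : ℕ → ℕ → ℚ) (hF : ∀ i k, i < n → k < n + n → r i k = coeff (2*i+1) (E1 * F k))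
    (hG : ∀ i k, i < n → k < n + n → r (n + i) k = - coeff (2*(n-1-i)+1) (E2 * G k)) :
    |cdet (n+n) r| = |cdet (n+n) (fun i k => if i < n then coeff (2*(n-1-i)+1) (F k) else coeff (2*(i-n)+1) (G k))| := by
  obtain ⟨C1, hC1, hC1'⟩ := even_mat n E1 hE1 h1
  obtain ⟨C2, hC2, hC2'⟩ := even_mat n E2 hE2 h2
  let M : Matrix (Fin n ⊕ Fin n) (Fin (n+n)) ℚ := Matrix.of fun i k =>
    Sum.elim (fun i : Fin n => coeff (2*(i:ℕ)+1) (F k)) (fun i : Fin n => coeff (2*(i:ℕ)+1) (G k)) i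
  have e1 : |cdet (n+n) r| = |(M.submatrix id (finSumFinEquiv (m := n) (n := n))).det| := by
    have : (M.submatrix id (finSumFinEquiv (m := n) (n := n))).det =
        ((Matrix.fromBlocks C1 0 0 (-C2)) * (M.submatrix id (finSumFinEquiv (m := n) (n := n)))).det * (-1)^n := by
      rw [Matrix.det_mul, Matrix.det_fromBlocks_zero₁₂, Matrix.det_neg, hC1, hC2, Fintype.card_fin]
      have : ((-1:ℚ)^n)*(-1)^n = 1 := by rw [← mul_pow]; norm_num
      linear_combination -(M.submatrix id (finSumFinEquiv (m := n) (n := n))).det * this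
    rw [this, abs_mul, abs_neg_one_pow', mul_one]
    unfold cdet
    rw [← Matrix.abs_det_submatrix_equiv_equiv ((Equiv.sumCongr (Equiv.refl (Fin n)) Fin.revPerm).trans finSumFinEquiv)
      (finSumFinEquiv (m := n) (n := n)) (Matrix.of fun i k : Fin (n+n) => r i k)]
    congr 2
    ext i k
    have hk := (finSumFinEquiv k).2
    rw [Matrix.mul_apply, Fintype.sum_sum_type]
    rcases i with i | i
    · simp only [Matrix.submatrix_apply, Matrix.of_apply, M, Sum.elim_inl, Sum.elim_inr, id, Matrix.fromBlocks_apply₁₁, Matrix.fromBlocks_apply₁₂,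
        Matrix.zero_apply, zero_mul, sum_const_zero, add_zero, Equiv.trans_apply, Equiv.sumCongr_apply, Sum.map_inl, finSumFinEquiv_apply_left]
      rw [← hC1', ← hF _ _ i.2 hk]
      simp
    · simp only [Matrix.submatrix_apply, Matrix.of_apply, M, Sum.elim_inl, Sum.elim_inr, id, Matrix.fromBlocks_apply₂₁, Matrix.fromBlocks_apply₂₂,
        Matrix.zero_apply, zero_mul, sum_const_zero, zero_add, Equiv.trans_apply, Equiv.sumCongr_apply, Sum.map_inr, finSumFinEquiv_apply_right,
        Matrix.neg_apply, neg_mul, sum_neg_distrib]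
      rw [← hC2']
      have := hG (n-1-i) _ (by omega) hk
      rw [show n - 1 - (n-1-(i:ℕ)) = i by omega] at this
      rw [← this]
      congr 1
      simp [Fin.rev]
      omega
  rw [e1]
  unfold cdet
  rw [← Matrix.abs_det_submatrix_equiv_equiv ((Equiv.sumCongr (Fin.revPerm) (Equiv.refl (Fin n))).trans finSumFinEquiv)
      (finSumFinEquiv (m := n) (n := n)) (Matrix.of fun i k : Fin (n+n) => if (i:ℕ) < n then coeff (2*(n-1-i)+1) (F k) else coeff (2*(i-n)+1) (G k))]
  congr 2
  ext i k
  rcases i with i | i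
  · simp [M, Fin.rev]
    have hi := i.2
    split_ifs with hh
    · congr 2
      omega
    · omega
  · simp [M]

theorem abs_Bm_final (n : ℕ) (p : ℚ) : |(Bm n p).det| = |Mm n n (p+1/2) (1/2-p-2*n)| := by
  rw [abs_Bm, abs_cols _ _ (by intro k; simp [sarr, Sr]), Mm, two_mul]
  rw [abs_blocks n evW c0 evW_even evW_const c0_even c0_const (fun k => US (p+1/2) * wS^k)
    (fun k => X^(n+n-1-k) * US (1/2-p-2*n + (n+n-1-k:ℕ)))]
  · congr 1
    apply cdet_congr
    intro i hi j hj
    unfold marr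
    split_ifs with h
    · rw [ff_eq]
    · rfl
  · intro i k hi hk
    simp only [sarr, if_pos (show i + 1 < n+1 by omega), Sr, if_neg (Nat.succ_ne_zero i), Nat.add_sub_cancel]
    rw [Ob_diff _ _ _ _ (by omega), Rr, Rr, ← map_add]
    congr 1
    rw [US_add, pow_succ]
    linear_combination US p * wS^k * evW_eq
  · intro i k hi hk
    simp only [sarr, if_neg (show ¬ (n + i + 1 < n+1) by omega), show n + i + 1 - (n+1) = i by omega]
    rw [Yy_diff _ _ _ (by omega)]
    congr 1
    rw [mul_left_comm, coeff_X_pow_mul']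
    by_cases h : 2*i+1 ≤ k+1
    · rw [if_pos h, if_pos (by omega)]
      rw [show 2*(n-1-i)+1 - (n+n-1-k) = k + 1 - (2*i+1) by omega]
      congr 3
      rw [show n+n-1-k = n+n-(1+k) by omega, Nat.cast_sub (by omega)]
      push_cast; ring
    · rw [if_neg h, if_neg (by omega)]

open Finset PowerSeries

abbrev EA (m : ℕ) := ExteriorAlgebra ℚ (Fin m → ℚ)
abbrev io {m : ℕ} (v : Fin m → ℚ) : EA m := ExteriorAlgebra.ι ℚ v

lemma io_sq {m : ℕ} (v : Fin m → ℚ) : io v * io v = 0 := ExteriorAlgebra.ι_sq_zero v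
lemma io_anti {m : ℕ} (v w : Fin m → ℚ) : io v * io w = - (io w * io v) :=
  eq_neg_of_add_eq_zero_left (ExteriorAlgebra.ι_add_mul_swap v w)

noncomputable def Tp (m : ℕ) : EA m →ₗ[ℚ] ℚ :=
  ExteriorAlgebra.liftAlternating (fun i => if h : i = m then by subst h; exact Matrix.detRowAlternating else 0)

noncomputable def pr {m : ℕ} (K : ℕ) (f : ℕ → Fin m → ℚ) : EA m := ExteriorAlgebra.ιMulti ℚ K (fun i : Fin K => f i)

lemma pr_zero {m : ℕ} (f : ℕ → Fin m → ℚ) : pr 0 f = 1 := by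
  simp [pr, ExteriorAlgebra.ιMulti_apply]

lemma pr_succ {m : ℕ} (K : ℕ) (f : ℕ → Fin m → ℚ) : pr (K+1) f = pr K f * io (f K) := by
  unfold pr
  rw [ExteriorAlgebra.ιMulti_apply, ExteriorAlgebra.ιMulti_apply, List.ofFn_succ', List.concat_eq_append, List.prod_append,
    List.prod_singleton]
  rfl

lemma pr_congr {m : ℕ} (K : ℕ) (f g : ℕ → Fin m → ℚ) (h : ∀ i < K, f i = g i) : pr K f = pr K g := by
  unfold pr; congr 1; funext i; exact h i i.2

lemma Tp_pr_ne {m K : ℕ} (h : K ≠ m) (f : ℕ → Fin m → ℚ) : Tp m (pr K f) = 0 := by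
  rw [Tp, pr, ExteriorAlgebra.liftAlternating_apply_ιMulti, dif_neg h]; simp

lemma Tp_pr {m : ℕ} (f : ℕ → Fin m → ℚ) : Tp m (pr m f) = (Matrix.of fun i j : Fin m => f i j).det := by
  rw [Tp, pr, ExteriorAlgebra.liftAlternating_apply_ιMulti, dif_pos rfl]; rfl

/-- product of K vectors satisfying a predicate -/
def IsPr {m : ℕ} (P : (Fin m → ℚ) → Prop) (K : ℕ) (x : EA m) : Prop :=
  ∃ f : ℕ → Fin m → ℚ, (∀ i < K, P (f i)) ∧ x = pr K f

lemma IsPr.one {m : ℕ} (P : (Fin m → ℚ) → Prop) : IsPr P 0 1 := ⟨0, by simp, (pr_zero _).symm⟩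

lemma IsPr.mul {m : ℕ} {P : (Fin m → ℚ) → Prop} {K : ℕ} {x : EA m} (h : IsPr P K x) {v : Fin m → ℚ} (hv : P v) :
    IsPr P (K+1) (x * io v) := by
  obtain ⟨f, hf, rfl⟩ := h
  refine ⟨fun i => if i < K then f i else v, ?_, ?_⟩
  · intro i _
    dsimp only
    split_ifs with h
    · exact hf i h
    · exact hv
  · rw [pr_succ, if_neg (lt_irrefl K), pr_congr K f (fun i => if i < K then f i else v)]
    intro i hi; simp [hi]

lemma IsPr.top_zero {m : ℕ} {P : (Fin m → ℚ) → Prop} {K : ℕ} {x : EA m} (h : IsPr P K x) (hK : K ≠ m) : Tp m x = 0 := by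
  obtain ⟨f, _, rfl⟩ := h
  exact Tp_pr_ne hK f

/-- too many vectors -/
lemma IsPr.zero_of_lt {m c K : ℕ} {x : EA m} (h : IsPr (fun v => ∀ a : Fin m, (a:ℕ) < c → v a = 0) K x) (hK : m < K + c) (hc : c ≤ m) :
    x = 0 := by
  obtain ⟨f, hf, rfl⟩ := h
  unfold pr
  apply AlternatingMap.map_linearDependent
  intro hli
  let π : (Fin m → ℚ) →ₗ[ℚ] (Fin (m - c) → ℚ) := LinearMap.funLeft ℚ ℚ (fun t : Fin (m-c) => (⟨c + t, by omega⟩ : Fin m))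
  have h2 : LinearIndependent ℚ (fun i : Fin K => π (f i)) := by
    rw [Fintype.linearIndependent_iff] at hli ⊢
    intro g hg
    apply hli g
    funext a
    by_cases ha : (a:ℕ) < c
    · simp only [Finset.sum_apply, Pi.smul_apply, Pi.zero_apply]
      apply Finset.sum_eq_zero
      intro i _
      rw [hf i i.2 a ha, smul_zero]
    · have := congrFun hg ⟨a - c, by omega⟩
      simp only [Finset.sum_apply, Pi.smul_apply, Pi.zero_apply, π, LinearMap.funLeft_apply] at this ⊢
      rw [← this]
      apply Finset.sum_congr rfl
      intro i _
      congr 2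
      apply Fin.ext; simp; omega
  have := h2.fintype_card_le_finrank
  simp at this
  omega

/-! ### the even commutative subalgebra -/
def evSet (m : ℕ) : Set (EA m) := {x | ∃ v w, x = io v * io w}

lemma ev_anti4 {m : ℕ} (a b c d : Fin m → ℚ) : (io a * io b) * (io c * io d) = (io c * io d) * (io a * io b) := by
  have h1 := io_anti b c
  have h2 := io_anti b d
  have h3 := io_anti a c
  have h4 := io_anti a d
  calc (io a * io b) * (io c * io d) = io a * (io b * io c) * io d := by noncomm_ring
    _ = - (io a * io c) * (io b * io d) := by rw [h1]; noncomm_ring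
    _ = - (io c * (io a * io d) * io b) := by rw [h2, h3]; noncomm_ring
    _ = (io c * io d) * (io a * io b) := by rw [h4]; noncomm_ring

lemma evSet_comm (m : ℕ) : ∀ a ∈ evSet m, ∀ b ∈ evSet m, a * b = b * a := by
  rintro _ ⟨a, b, rfl⟩ _ ⟨c, d, rfl⟩
  exact ev_anti4 a b c d

abbrev EC (m : ℕ) := Algebra.adjoin ℚ (evSet m)
noncomputable instance ecRing (m : ℕ) : CommRing (EC m) := Algebra.adjoinCommRingOfComm ℚ (evSet_comm m)

def gg {m : ℕ} (v w : Fin m → ℚ) : EC m := ⟨io v * io w, Algebra.subset_adjoin ⟨v, w, rfl⟩⟩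

lemma ec_comm_io {m : ℕ} (x : EC m) (v : Fin m → ℚ) : (x : EA m) * io v = io v * x := by
  obtain ⟨x, hx⟩ := x
  induction hx using Algebra.adjoin_induction with
  | mem x hx =>
    obtain ⟨a, b, rfl⟩ := hx
    have h1 := io_anti b v
    have h2 := io_anti a v
    calc io a * io b * io v = io a * (io b * io v) := by noncomm_ring
      _ = - (io a * io v) * io b := by rw [h1]; noncomm_ring
      _ = io v * (io a * io b) := by rw [h2]; noncomm_ring
  | algebraMap r => exact Algebra.commutes r _
  | add x y _ _ hx hy => 
    simp only at hx hy ⊢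
    rw [add_mul, mul_add, hx, hy]
  | mul x y _ _ hx hy =>
    simp only at hx hy ⊢
    rw [mul_assoc, hy, ← mul_assoc, hx, mul_assoc]

lemma ec_coe_mul {m : ℕ} (x y : EC m) : ((x * y : EC m) : EA m) = x * y := rfl
lemma ec_coe_add {m : ℕ} (x y : EC m) : ((x + y : EC m) : EA m) = x + y := rfl
lemma ec_coe_one {m : ℕ} : ((1 : EC m) : EA m) = 1 := rfl
lemma ec_coe_zero {m : ℕ} : ((0 : EC m) : EA m) = 0 := rfl
lemma gg_coe {m : ℕ} (v w : Fin m → ℚ) : ((gg v w : EC m) : EA m) = io v * io w := rfl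

lemma gg_left {m : ℕ} (v w w' : Fin m → ℚ) : gg v w * gg v w' = 0 := by
  apply Subtype.ext
  rw [ec_coe_mul, gg_coe, gg_coe]
  have h1 := io_anti w v
  calc io v * io w * (io v * io w') = io v * (io w * io v) * io w' := by noncomm_ring
    _ = - ((io v * io v) * io w * io w') := by rw [h1]; noncomm_ring
    _ = 0 := by rw [io_sq]; simp

lemma gg_right {m : ℕ} (v v' w : Fin m → ℚ) : gg v w * gg v' w = 0 := by
  apply Subtype.ext
  rw [ec_coe_mul, gg_coe, gg_coe]
  have h1 := io_anti w v'
  calc io v * io w * (io v' * io w) = io v * (io w * io v') * io w := by noncomm_ring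
    _ = - (io v * io v' * (io w * io w)) := by rw [h1]; noncomm_ring
    _ = 0 := by rw [io_sq]; simp

lemma gg_sum_right {m : ℕ} {ι : Type*} (s : Finset ι) (v : Fin m → ℚ) (w : ι → Fin m → ℚ) :
    1 + gg v (∑ b ∈ s, w b) = ∏ b ∈ s, (1 + gg v (w b)) := by
  classical
  induction s using Finset.induction_on with
  | empty =>
    rw [sum_empty, prod_empty]
    apply Subtype.ext
    rw [ec_coe_add, gg_coe]; simp [ec_coe_one]
  | insert a s ha ih =>
    rw [prod_insert ha, ← ih, sum_insert ha, mul_add, add_mul, add_mul, gg_left]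
    apply Subtype.ext
    simp only [ec_coe_add, gg_coe, ec_coe_mul, ec_coe_one, ec_coe_zero, io, map_add, mul_add, add_mul, add_assoc, mul_one, one_mul, add_zero]

lemma gg_sum_left {m : ℕ} {ι : Type*} (s : Finset ι) (v : ι → Fin m → ℚ) (w : Fin m → ℚ) :
    1 + gg (∑ b ∈ s, v b) w = ∏ b ∈ s, (1 + gg (v b) w) := by
  classical
  induction s using Finset.induction_on with
  | empty =>
    rw [sum_empty, prod_empty]
    apply Subtype.ext
    rw [ec_coe_add, gg_coe]; simp [ec_coe_one]
  | insert a s ha ih =>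
    rw [prod_insert ha, ← ih, sum_insert ha, mul_add, add_mul, add_mul, gg_right]
    apply Subtype.ext
    simp only [ec_coe_add, gg_coe, ec_coe_mul, ec_coe_one, ec_coe_zero, io, map_add, mul_add, add_mul, add_assoc, mul_one, one_mul, add_zero]

lemma gg_smul {m : ℕ} (c : ℚ) (v w : Fin m → ℚ) : gg v (c • w) = gg (c • v) w := by
  apply Subtype.ext
  simp [gg_coe, io]

/-- regrouping the exponential -/
lemma regroup {m : ℕ} (K n : ℕ) (th : ℕ → Fin m → ℚ) (c : ℕ → ℕ → ℚ) (y : ℕ → Fin m → ℚ) :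
    ∏ k ∈ range K, (1 + gg (th k) (∑ b ∈ range n, c k b • y b)) =
    ∏ b ∈ range n, (1 + gg (∑ k ∈ range K, c k b • th k) (y b)) := by
  simp only [gg_sum_right, gg_sum_left]
  rw [prod_comm]
  simp only [gg_smul]

open Finset PowerSeries
set_option linter.unusedSimpArgs false

noncomputable def QQ {m : ℕ} (L R : ℕ → Fin m → ℚ) : ℕ → EA m
  | 0 => 1
  | k+1 => (1 + io (L k)) * QQ L R k * (1 + io (R k))

lemma six_identity {A : Type*} [Ring A] (a b c : A) (ha : a * a = 0) (hb : b * b = 0) (hc : c * c = 0)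
    (hba : b * a = -(a * b)) (hca : c * a = -(a * c)) (hcb : c * b = -(b * c)) :
    (1 + (a - b)) * (1 + 2 * c) * (1 + (a + b)) = (1 + 2 * (c + a)) * (1 + (2 * a + 4 * c) * b) := by
  have ha' : ∀ z, a * (a * z) = 0 := fun z => by rw [← mul_assoc, ha, zero_mul]
  have hb' : ∀ z, b * (b * z) = 0 := fun z => by rw [← mul_assoc, hb, zero_mul]
  have hc' : ∀ z, c * (c * z) = 0 := fun z => by rw [← mul_assoc, hc, zero_mul]
  have hba' : ∀ z, b * (a * z) = -(a * (b * z)) := fun z => by rw [← mul_assoc, hba, neg_mul, mul_assoc]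
  have hca' : ∀ z, c * (a * z) = -(a * (c * z)) := fun z => by rw [← mul_assoc, hca, neg_mul, mul_assoc]
  have hcb' : ∀ z, c * (b * z) = -(b * (c * z)) := fun z => by rw [← mul_assoc, hcb, neg_mul, mul_assoc]
  have h2 : (2 : A) = 1 + 1 := by norm_num
  have h4 : (4 : A) = 1 + 1 + 1 + 1 := by norm_num
  simp only [h2, h4, add_mul, mul_add, sub_mul, mul_sub, one_mul, mul_one, mul_assoc, ha, hb, hc, hba, hca, hcb, ha', hb', hc', hba', hca', hcb',
    mul_neg, neg_mul, mul_zero, zero_mul, neg_zero]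
  abel

lemma QQ_closed {m : ℕ} (e o : ℕ → Fin m → ℚ) (K : ℕ) :
    QQ (fun k => e k - o k) (fun k => e k + o k) K =
      (1 + 2 * io (∑ k ∈ range K, e k)) *
        ((∏ k ∈ range K, (1 + gg ((2:ℚ) • e k + (4:ℚ) • ∑ k' ∈ range k, e k') (o k)) : EC m) : EA m) := by
  induction K with
  | zero => simp [QQ, ec_coe_one]
  | succ K ih =>
    rw [QQ, ih, prod_range_succ, sum_range_succ, ec_coe_mul]
    set x : EC m := ∏ k ∈ range K, (1 + gg ((2:ℚ) • e k + (4:ℚ) • ∑ k' ∈ range k, e k') (o k))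
    set c := ∑ k ∈ range K, e k
    have hx : (x : EA m) * (1 + io (e K + o K)) = (1 + io (e K + o K)) * x := by
      rw [mul_add, add_mul, ec_comm_io, one_mul, mul_one]
    have hxx : (x : EA m) * ((1 + gg ((2:ℚ) • e K + (4:ℚ) • c) (o K) : EC m) : EA m) = ((1 + gg ((2:ℚ) • e K + (4:ℚ) • c) (o K) : EC m) : EA m) * x := by
      rw [← ec_coe_mul, mul_comm, ec_coe_mul]
    rw [hxx, mul_assoc, mul_assoc, hx, ← mul_assoc, ← mul_assoc, ← mul_assoc]
    congr 1
    have := six_identity (io (e K)) (io (o K)) (io c) (io_sq _) (io_sq _) (io_sq _) (io_anti _ _) (io_anti _ _) (io_anti _ _)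
    rw [ec_coe_add, gg_coe, ec_coe_one]
    have s2 : ∀ z : EA m, (2:ℚ) • z = 2 * z := fun z => by rw [two_smul, two_mul]
    have s4 : ∀ z : EA m, (4:ℚ) • z = 4 * z := fun z => by
      rw [show (4:ℚ) = 2 + 2 by norm_num, show (4 : EA m) = 2 + 2 by norm_num, add_smul, s2, add_mul]
    simp only [io, map_add, map_sub, map_smul, s2, s4] at this ⊢
    exact this

lemma ec_prod_isPr {m K : ℕ} (η y : ℕ → Fin m → ℚ) (S : Finset ℕ) (z : EA m) (hz : IsPr (fun _ => True) K z) :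
    IsPr (fun _ => True) (K + 2 * S.card) (z * ((∏ b ∈ S, gg (η b) (y b) : EC m) : EA m)) := by
  induction S using Finset.induction_on with
  | empty => simpa [ec_coe_one] using hz
  | insert a s ha ih =>
    rw [prod_insert ha, card_insert_of_notMem ha, mul_comm (gg _ _), ec_coe_mul, gg_coe, ← mul_assoc, ← mul_assoc]
    exact (ih.mul trivial).mul trivial

lemma ec_prod_pr {m : ℕ} (r : ℕ → Fin m → ℚ) (K : ℕ) :
    ((∏ b ∈ range K, gg (r (2*b)) (r (2*b+1)) : EC m) : EA m) = pr (2*K) r := by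
  induction K with
  | zero => simp [pr_zero, ec_coe_one]
  | succ K ih => 
    rw [prod_range_succ, ec_coe_mul, ih, gg_coe, mul_add, mul_one, pr_succ, pr_succ, mul_assoc]

lemma Tp_coe_sum {m : ℕ} (z : EA m) (s : Finset (Finset ℕ)) (f : Finset ℕ → EC m) :
    Tp m (z * ((∑ t ∈ s, f t : EC m) : EA m)) = ∑ t ∈ s, Tp m (z * (f t : EA m)) := by
  induction s using Finset.induction_on with
  | empty => simp [ec_coe_zero]
  | insert a s ha ih => rw [sum_insert ha, sum_insert ha, ec_coe_add, mul_add, map_add, ih]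

/-- top coefficient of `(1+2E) ∏ (1 + η_b y_b)` -/
lemma Tp_expand (n : ℕ) (E : Fin (2*n+1) → ℚ) (η y : ℕ → Fin (2*n+1) → ℚ) (r : ℕ → Fin (2*n+1) → ℚ)
    (h0 : r (2*n) = E) (h1 : ∀ b < n, r (2*b) = η b) (h2 : ∀ b < n, r (2*b+1) = y b) :
    Tp (2*n+1) ((1 + 2 * io E) * ((∏ b ∈ range n, (1 + gg (η b) (y b)) : EC (2*n+1)) : EA (2*n+1))) =
      2 * (Matrix.of fun i j : Fin (2*n+1) => r i j).det := by
  have hE : IsPr (fun _ : Fin (2*n+1) → ℚ => True) 1 (io E) := by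
    have := (IsPr.one (fun _ : Fin (2*n+1) → ℚ => True)).mul (v := E) trivial
    simpa using this
  rw [Finset.prod_one_add]
  rw [add_mul, map_add, mul_assoc, Tp_coe_sum, two_mul (io E * _), map_add, Tp_coe_sum, ← two_mul (∑ t ∈ _, _)]
  have e1 : ∑ t ∈ (range n).powerset, Tp (2*n+1) (1 * ((∏ b ∈ t, gg (η b) (y b) : EC (2*n+1)) : EA (2*n+1))) = 0 := by
    apply sum_eq_zero
    intro t _
    apply (ec_prod_isPr η y t 1 (IsPr.one _)).top_zero
    omega
  rw [e1, zero_add]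
  congr 1
  rw [sum_eq_single (range n)]
  · rw [← ec_comm_io]
    rw [← Tp_pr, pr_succ, h0, ← ec_prod_pr]
    congr 3
    rw [prod_congr rfl]
    intro b hb
    rw [h1 b (mem_range.1 hb), h2 b (mem_range.1 hb)]
  · intro t ht hne
    apply (ec_prod_isPr η y t _ hE).top_zero
    have : t.card < (range n).card := card_lt_card (by
      rw [mem_powerset] at ht
      exact lt_of_le_of_ne ht hne)
    rw [card_range] at this
    omega
  · intro h; simp at h

noncomputable def Lv (m : ℕ) (p : ℚ) (k : ℕ) : Fin m → ℚ := fun a => (-1)^(a:ℕ) * Rr p k a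
noncomputable def Rv (m : ℕ) (p : ℚ) (k : ℕ) : Fin m → ℚ := fun a => Rr p k a
noncomputable def ev (m : ℕ) (p : ℚ) (k : ℕ) : Fin m → ℚ := fun a => if (a:ℕ) % 2 = 0 then Rr p k a else 0
noncomputable def ov (m : ℕ) (p : ℚ) (k : ℕ) : Fin m → ℚ := fun a => if (a:ℕ) % 2 = 0 then 0 else Rr p k a
def yv (m : ℕ) (b : ℕ) : Fin m → ℚ := fun a => if (a:ℕ) = 2*b+1 then 1 else 0

lemma Lv_eq (m : ℕ) (p : ℚ) : Lv m p = fun k => ev m p k - ov m p k := by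
  funext k a
  simp only [Lv, ev, ov, Pi.sub_apply]
  split_ifs with h
  · rw [Even.neg_one_pow (Nat.even_iff.2 h)]; ring
  · rw [Odd.neg_one_pow (Nat.odd_iff.2 (by omega))]; ring

lemma Rv_eq (m : ℕ) (p : ℚ) : Rv m p = fun k => ev m p k + ov m p k := by
  funext k a
  simp only [Rv, ev, ov, Pi.add_apply]
  split_ifs with h <;> ring

lemma ov_eq (n : ℕ) (p : ℚ) (k : ℕ) : ov (2*n+1) p k = ∑ b ∈ range n, Rr p k (2*b+1) • yv (2*n+1) b := by
  funext a
  simp only [ov, yv, Finset.sum_apply, Pi.smul_apply, smul_eq_mul, mul_ite, mul_one, mul_zero]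
  split_ifs with h
  · symm; apply sum_eq_zero; intro b _; rw [if_neg (by omega)]
  · rw [sum_eq_single ((a:ℕ)/2)]
    · rw [if_pos (by omega)]; congr 1; omega
    · intro b _ hb; rw [if_neg (by omega)]
    · intro hh; exfalso; apply hh; rw [mem_range]; omega

noncomputable def ηv (n : ℕ) (p : ℚ) (b : ℕ) : Fin (2*n+1) → ℚ :=
  ∑ k ∈ range (2*n+1), Rr p k (2*b+1) • ((2:ℚ) • ev (2*n+1) p k + (4:ℚ) • ∑ k' ∈ range k, ev (2*n+1) p k')

lemma ηv_even (n : ℕ) (p : ℚ) (b : ℕ) (j : Fin (n+1)) :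
    ηv n p b ⟨2*j, by omega⟩ = 2 * ∑ k ∈ range (2*n+1), Ob p (2*n+1) (2*b+1) k * Rr p k (2*j) := by
  unfold ηv
  have hev : ∀ k, ev (2*n+1) p k ⟨2*j, by omega⟩ = Rr p k (2*j) := by
    intro k; simp [ev]
  simp only [Finset.sum_apply, Pi.smul_apply, Pi.add_apply, hev, smul_eq_mul, Ob]
  have : ∑ k ∈ range (2*n+1), ∑ k' ∈ range k, Rr p k (2*b+1) * Rr p k' (2*j) =
      ∑ k' ∈ range (2*n+1), ∑ k ∈ Ioo k' (2*n+1), Rr p k (2*b+1) * Rr p k' (2*j) := by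
    apply Finset.sum_comm'
    intro x y; simp only [mem_range, mem_Ioo]; omega
  simp only [add_mul, mul_add, sum_add_distrib, mul_sum, sum_mul] at this ⊢
  congr 1
  · apply sum_congr rfl; intro k _; ring
  · have h2 := congrArg (fun x => 4 * x) this
    simp only [mul_sum] at h2
    convert h2 using 1
    · apply sum_congr rfl; intro k _; apply sum_congr rfl; intro k' _; ring
    · apply sum_congr rfl; intro k _; apply sum_congr rfl; intro k' _; ring

noncomputable def rowv (n : ℕ) (p : ℚ) (i : ℕ) : Fin (2*n+1) → ℚ :=
  if i = 2*n then ∑ k ∈ range (2*n+1), ev (2*n+1) p k else if i % 2 = 0 then ηv n p (i/2) else yv (2*n+1) (i/2)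

lemma abs_det_rowv (n : ℕ) (p : ℚ) : |(Matrix.of fun i j : Fin (2*n+1) => rowv n p i j).det| = 2^n * |(Bm n p).det| := by
  rw [← Matrix.abs_det_submatrix_equiv_equiv (evenOdd n) (evenOdd n)]
  let d : Fin (n+1) → ℚ := fun i => if (i:ℕ) = n then 1 else 2
  let B' : Matrix (Fin (n+1)) (Fin (n+1)) ℚ := Matrix.of fun i j => d i * (Bm n p).submatrix (finRotate (n+1)) (Equiv.refl _) i j
  have h1 : (Matrix.of fun i j : Fin (2*n+1) => rowv n p i j).submatrix (evenOdd n) (evenOdd n) =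
      Matrix.fromBlocks B' (Matrix.of fun (i : Fin (n+1)) (j : Fin n) => rowv n p (2*i) ⟨2*j+1, by omega⟩) 0 1 := by
    ext i j
    rcases i with i | i <;> rcases j with j | j
    · simp only [evenOdd, Matrix.submatrix_apply, Equiv.coe_fn_mk, Sum.elim_inl, Matrix.of_apply, Matrix.fromBlocks_apply₁₁, B', d, rowv]
      by_cases hi : (i:ℕ) = n
      · rw [if_pos (by omega), if_pos hi]
        have : i = Fin.last n := Fin.ext hi
        rw [this, finRotate_last]
        simp [Bm, Sr, ev]
      · rw [if_neg (by omega), if_neg hi, if_pos (by omega)]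
        have h3 : ((finRotate (n+1) i : Fin (n+1)) : ℕ) = i + 1 := coe_finRotate_of_ne_last (fun h => hi (by rw [h]; rfl))
        rw [ηv_even]
        simp only [Bm, Matrix.of_apply, h3, Sr, Equiv.refl_apply]
        simp
    · simp [evenOdd]
    · simp only [evenOdd, Matrix.submatrix_apply, Equiv.coe_fn_mk, Sum.elim_inl, Sum.elim_inr, Matrix.of_apply, Matrix.fromBlocks_apply₂₁, rowv]
      rw [if_neg (by omega), if_neg (by omega), yv, if_neg (by simp only; omega)]; rfl
    · simp only [evenOdd, Matrix.submatrix_apply, Equiv.coe_fn_mk, Sum.elim_inr, Matrix.of_apply, Matrix.fromBlocks_apply₂₂, rowv]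
      rw [if_neg (by omega), if_neg (by omega), yv, Matrix.one_apply]
      by_cases hij : i = j
      · rw [if_pos hij, if_pos (by rw [hij]; simp only; omega)]
      · rw [if_neg hij, if_neg]
        intro h; apply hij; apply Fin.ext; simp only at h; omega
  rw [h1, Matrix.det_fromBlocks_zero₂₁, Matrix.det_one, mul_one]
  have h2 := Matrix.det_mul_column d ((Bm n p).submatrix (finRotate (n+1)) (Equiv.refl _))
  rw [show B' = Matrix.of fun i j => d i * (Bm n p).submatrix (finRotate (n+1)) (Equiv.refl _) i j from rfl, h2, abs_mul,
    Matrix.abs_det_submatrix_equiv_equiv]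
  congr 1
  rw [Fin.prod_univ_castSucc]
  simp only [d, Fin.val_last, if_true, mul_one, Fin.val_castSucc]
  rw [prod_congr rfl (g := fun _ => (2:ℚ))]
  · simp
  · intro i _; rw [if_neg (by omega)]

theorem abs_Tp_QQ (n : ℕ) (p : ℚ) : |Tp (2*n+1) (QQ (Lv (2*n+1) p) (Rv (2*n+1) p) (2*n+1))| = 2^(n+1) * |(Bm n p).det| := by
  rw [Lv_eq, Rv_eq, QQ_closed]
  have h := regroup (m := 2*n+1) (2*n+1) n (fun k => (2:ℚ) • ev (2*n+1) p k + (4:ℚ) • ∑ k' ∈ range k, ev (2*n+1) p k') (fun k b => Rr p k (2*b+1)) (yv (2*n+1))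
  simp only [← ov_eq] at h
  have h' : ∏ k ∈ range (2*n+1), (1 + gg ((2:ℚ) • ev (2*n+1) p k + (4:ℚ) • ∑ k' ∈ range k, ev (2*n+1) p k') (ov (2*n+1) p k)) =
    ∏ b ∈ range n, (1 + gg (ηv n p b) (yv (2*n+1) b)) := h
  rw [h']
  rw [Tp_expand n _ (ηv n p) (yv (2*n+1)) (rowv n p)]
  · rw [abs_mul, abs_det_rowv, pow_succ]; norm_num; ring
  · simp [rowv]
  · intro b hb; rw [rowv, if_neg (by omega), if_pos (by omega)]; congr 1; omega
  · intro b hb; rw [rowv, if_neg (by omega), if_neg (by omega)]; congr 1; omega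

open Finset PowerSeries
set_option linter.unusedSimpArgs false

def WP {A : Type*} [Ring A] (v : ℕ → A) (X : Finset ℕ) : ℕ → A
  | 0 => 1
  | j+1 => WP v X j * (if j ∈ X then v j else 1)

def Zp {A : Type*} [Ring A] (lo hi : ℕ) (v : ℕ → A) (X : Finset ℕ) : ℕ → A × A
  | 0 => (1, 0)
  | j+1 =>
    let z := Zp lo hi v X j
    if lo ≤ j ∧ j < hi then (if j ∈ X then (z.1 * v j, z.2 * v j + z.1) else (z.1 + 2 * z.2 * v j, z.2))
    else (if j ∈ X then (z.1 * v j, z.2 * v j) else z)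

def tw (lo hi : ℕ) (X Y : Finset ℕ) : ℕ → ℚ × ℚ
  | 0 => (1, 0)
  | j+1 =>
    let z := tw lo hi X Y j
    if lo ≤ j ∧ j < hi then
      (if j ∈ X then (if j ∈ Y then z else (0, z.1)) else (if j ∈ Y then (2 * z.2, 0) else z))
    else (if (j ∈ X ↔ j ∈ Y) then z else (0, 0))

lemma WP_insert {A : Type*} [Ring A] (v : ℕ → A) (X : Finset ℕ) (J K : ℕ) (h : J ≤ K) : WP v (insert K X) J = WP v X J := by
  induction J with
  | zero => rfl
  | succ J ih =>
    rw [WP, WP, ih (by omega)]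
    have : J ∈ insert K X ↔ J ∈ X := by
      rw [mem_insert]; constructor
      · rintro (h | h)
        · omega
        · exact h
      · exact Or.inr
    simp only [this]

lemma tw_insert (lo hi : ℕ) (X Y : Finset ℕ) (J K : ℕ) (h : J ≤ K) : tw lo hi X (insert K Y) J = tw lo hi X Y J := by
  induction J with
  | zero => rfl
  | succ J ih =>
    rw [tw, tw, ih (by omega)]
    have : J ∈ insert K Y ↔ J ∈ Y := by
      rw [mem_insert]; constructor
      · rintro (h | h)
        · omega
        · exact h
      · exact Or.inr
    simp only [this]

lemma Z_sum {A : Type*} [Ring A] [Algebra ℚ A] (lo hi : ℕ) (v : ℕ → A) (X : Finset ℕ) (J : ℕ) :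
    (Zp lo hi v X J).1 = ∑ Y ∈ (range J).powerset, (tw lo hi X Y J).1 • WP v Y J ∧
    (Zp lo hi v X J).2 = ∑ Y ∈ (range J).powerset, (tw lo hi X Y J).2 • WP v Y J := by
  induction J with
  | zero => simp [Zp, tw, WP]
  | succ J ih =>
    obtain ⟨ih1, ih2⟩ := ih
    have hn : J ∉ range J := by simp
    have hY : ∀ Y ∈ (range J).powerset, J ∉ Y := fun Y hY h => by
      rw [mem_powerset] at hY; exact hn (hY h)
    rw [range_add_one, sum_powerset_insert hn, sum_powerset_insert hn]
    have e1 : ∀ Y ∈ (range J).powerset, WP v Y (J+1) = WP v Y J := fun Y h => by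
      rw [WP, if_neg (hY Y h), mul_one]
    have e2 : ∀ Y ∈ (range J).powerset, WP v (insert J Y) (J+1) = WP v Y J * v J := fun Y h => by
      rw [WP, if_pos (mem_insert_self _ _), WP_insert _ _ _ _ le_rfl]
    have t1 : ∀ Y ∈ (range J).powerset, tw lo hi X Y (J+1) = if lo ≤ J ∧ J < hi then 
       (if J ∈ X then (0, (tw lo hi X Y J).1) else tw lo hi X Y J) else (if J ∈ X then (0,0) else tw lo hi X Y J) := fun Y h => by
      rw [tw]; simp only [hY Y h, if_false, iff_false, ite_not]
    have t2 : ∀ Y ∈ (range J).powerset, tw lo hi X (insert J Y) (J+1) = if lo ≤ J ∧ J < hi then 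
       (if J ∈ X then tw lo hi X Y J else (2 * (tw lo hi X Y J).2, 0)) else (if J ∈ X then tw lo hi X Y J else (0,0)) := fun Y h => by
      rw [tw]; simp only [mem_insert_self, if_true, iff_true, tw_insert _ _ _ _ _ _ le_rfl]
    rw [← sum_add_distrib, ← sum_add_distrib]
    have c1 := sum_congr (rfl : (range J).powerset = _) (fun Y h => by rw [e1 Y h, t1 Y h, e2 Y h, t2 Y h] :
      ∀ Y ∈ (range J).powerset, (tw lo hi X Y (J+1)).1 • WP v Y (J+1) + (tw lo hi X (insert J Y) (J+1)).1 • WP v (insert J Y) (J+1) = _)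
    have c2 := sum_congr (rfl : (range J).powerset = _) (fun Y h => by rw [e1 Y h, t1 Y h, e2 Y h, t2 Y h] :
      ∀ Y ∈ (range J).powerset, (tw lo hi X Y (J+1)).2 • WP v Y (J+1) + (tw lo hi X (insert J Y) (J+1)).2 • WP v (insert J Y) (J+1) = _)
    rw [c1, c2, Zp]
    by_cases hw : lo ≤ J ∧ J < hi <;> by_cases hX : J ∈ X
    · simp only [if_pos hw, if_pos hX, ih1, ih2, zero_smul, zero_add, sum_mul, smul_mul_assoc, ← sum_add_distrib]
      refine ⟨trivial, sum_congr rfl fun Y _ => add_comm _ _⟩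
    · simp only [if_pos hw, if_neg hX, ih1, ih2, zero_smul, add_zero, sum_mul, smul_mul_assoc, sum_add_distrib, two_mul, add_mul, add_smul]
      trivial
    · simp only [if_neg hw, if_pos hX, ih1, ih2, zero_smul, zero_add, sum_mul, smul_mul_assoc]
      trivial
    · simp only [if_neg hw, if_neg hX, ih1, ih2, zero_smul, add_zero]
      trivial

lemma tw_card (lo hi : ℕ) (X Y : Finset ℕ) (J : ℕ) :
    ((tw lo hi X Y J).1 ≠ 0 → (X.filter (· < J)).card = (Y.filter (· < J)).card) ∧ 
    ((tw lo hi X Y J).2 ≠ 0 → (X.filter (· < J)).card = (Y.filter (· < J)).card + 1) := by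
  have key : ∀ (X : Finset ℕ) J, (X.filter (· < J+1)).card = (X.filter (· < J)).card + if J ∈ X then 1 else 0 := by
    intro X J
    split_ifs with h
    · rw [← card_insert_of_notMem (a := J) (by simp)]
      congr 1; ext x; simp only [mem_filter, mem_insert]
      constructor
      · rintro ⟨h1, h2⟩
        by_cases hx : x = J
        · exact Or.inl hx
        · exact Or.inr ⟨h1, by omega⟩
      · rintro (h1 | ⟨h1, h2⟩)
        · subst h1; exact ⟨h, by omega⟩
        · exact ⟨h1, by omega⟩
    · rw [add_zero]
      congr 1; ext x; simp only [mem_filter]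
      constructor
      · rintro ⟨h1, h2⟩
        refine ⟨h1, ?_⟩
        by_contra hx
        apply h; rwa [show J = x by omega]
      · rintro ⟨h1, h2⟩; exact ⟨h1, by omega⟩
  induction J with
  | zero => simp [tw]
  | succ J ih =>
    obtain ⟨ih1, ih2⟩ := ih
    rw [key, key, tw]
    by_cases hw : lo ≤ J ∧ J < hi <;> by_cases hX : J ∈ X <;> by_cases hY : J ∈ Y <;> simp only [hw, hX, hY, if_true, if_false, iff_true, iff_false, not_true, not_false_iff, ne_eq, mul_eq_zero, not_or, and_imp, add_zero, implies_true, and_self, true_and, and_true, IsEmpty.forall_iff, false_and, true_iff, false_iff, add_left_inj]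
    all_goals first
      | exact ⟨ih1, ih2⟩
      | (intro h; have := ih1 h; omega)
      | (intro _ h; have := ih2 h; omega)

section scan
variable {A : Type*} [Ring A]

lemma Zp_left (i hi : ℕ) (v V : ℕ → A) (X : Finset ℕ) (hL : ∀ j < i, V j = - v j) (u : A)
    (hanti : ∀ j, u * v j = - (v j * u)) (J : ℕ) (hJ : J ≤ i) :
    (Zp i hi v X J).2 = 0 ∧ WP V X J * u = u * (Zp i hi v X J).1 := by
  induction J with
  | zero => simp [Zp, WP]
  | succ J ih =>
    obtain ⟨ih1, ih2⟩ := ih (by omega)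
    rw [Zp, WP]
    simp only [if_neg (show ¬ (i ≤ J ∧ J < hi) by omega)]
    split_ifs with h
    · refine ⟨by simp [ih1], ?_⟩
      rw [hL J (by omega), mul_assoc, neg_mul, ← hanti, ← mul_assoc, ih2, mul_assoc]
    · refine ⟨ih1, ?_⟩
      rw [mul_one, ih2]

lemma Zp_pre (i hi : ℕ) (v V : ℕ → A) (X : Finset ℕ) (hL : ∀ j < i, V j = - v j) (u : A)
    (hanti : ∀ j, u * v j = - (v j * u)) (x : ℕ) (hx : x < hi) (hX : ∀ j, i ≤ j → j < x → j ∉ X)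
    (J : ℕ) (hJ : i ≤ J) (hJ2 : J ≤ x) :
    (Zp i hi v X J).2 = 0 ∧ WP V X J * u = u * (Zp i hi v X J).1 := by
  induction J, hJ using Nat.le_induction with
  | base => exact Zp_left i hi v V X hL u hanti i le_rfl
  | succ J hJ ih =>
    obtain ⟨ih1, ih2⟩ := ih (by omega)
    rw [Zp, WP]
    simp only [if_pos (show (i ≤ J ∧ J < hi) by omega), if_neg (hX J hJ (by omega))]
    simp [ih1, ih2]

lemma Zp_mid (i hi : ℕ) (v V : ℕ → A) (X : Finset ℕ) (hL : ∀ j < i, V j = - v j)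
    (hW : ∀ j, i ≤ j → j + 1 < hi → V (j+1) - V j = v j + v (j+1))
    (hsq : ∀ j, V j * V j = 0) (hsqv : ∀ j, v j * v j = 0)
    (x : ℕ) (hx0 : i ≤ x) (hx : x < hi) (hxX : x ∈ X) (hX : ∀ j, i ≤ j → j < x → j ∉ X)
    (hanti : ∀ j, V x * v j = - (v j * V x))
    (J : ℕ) (hJ : x ≤ J) (hJ2 : J < hi) :
    V x * (Zp i hi v X (J+1)).2 = WP V X (J+1) ∧ V x * (Zp i hi v X (J+1)).1 = WP V X (J+1) * (V J + v J) := by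
  induction J, hJ using Nat.le_induction with
  | base =>
    obtain ⟨h1, h2⟩ := Zp_pre i hi v V X hL (V x) hanti x hx hX x hx0 le_rfl
    rw [Zp, WP]
    simp only [if_pos (show (i ≤ x ∧ x < hi) from ⟨hx0, hx⟩), if_pos hxX]
    refine ⟨by rw [h1, zero_mul, zero_add, h2], ?_⟩
    rw [mul_add, mul_assoc, hsq, mul_zero, zero_add, h2, mul_assoc]
  | succ J hJ ih =>
    obtain ⟨ih1, ih2⟩ := ih (by omega)
    have hw := hW J (by omega) (by omega)
    have hw' : V J + v J = V (J+1) - v (J+1) := by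
      rw [eq_sub_iff_add_eq, add_assoc, ← hw]; abel
    rw [hw'] at ih2
    rw [Zp, WP]
    simp only [if_pos (show (i ≤ J+1 ∧ J+1 < hi) by omega)]
    split_ifs with h
    · constructor
      · rw [mul_add, ← mul_assoc, ih1, ih2]; noncomm_ring
      · dsimp only
        rw [← mul_assoc, ih2, mul_add, mul_assoc (WP V X (J+1)) (V (J+1)), hsq, mul_sub, sub_mul,
          mul_assoc (WP V X (J+1)) (v (J+1)), hsqv]
        simp
    · constructor
      · rw [ih1, mul_one]
      · rw [mul_add, ih2, mul_assoc 2, mul_one, mul_sub, mul_add]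
        rw [show V x * (2 * ((Zp i hi v X (J+1)).2 * v (J+1))) = 2 * ((V x * (Zp i hi v X (J+1)).2) * v (J+1)) by noncomm_ring, ih1]
        noncomm_ring

theorem scan_main (i hi N : ℕ) (v V : ℕ → A) (X : Finset ℕ) (hL : ∀ j < i, V j = - v j)
    (hR : ∀ j, hi ≤ j → j < N → V j = v j) 
    (hW : ∀ j, i ≤ j → j + 1 < hi → V (j+1) - V j = v j + v (j+1))
    (hsq : ∀ j, V j * V j = 0) (hsqv : ∀ j, v j * v j = 0)
    (x : ℕ) (hx0 : i ≤ x) (hx : x < hi) (hxX : x ∈ X) (hX : ∀ j, i ≤ j → j < x → j ∉ X)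
    (hanti : ∀ j, V x * v j = - (v j * V x)) (hN : hi ≤ N) :
    V x * (Zp i hi v X N).2 = WP V X N := by
  induction N, hN using Nat.le_induction with
  | base =>
    have := (Zp_mid i hi v V X hL hW hsq hsqv x hx0 hx hxX hX hanti (hi-1) (by omega) (by omega)).1
    rwa [show hi - 1 + 1 = hi by omega] at this
  | succ J hJ ih =>
    have ih := ih (fun j h1 h2 => hR j h1 (by omega))
    rw [Zp, WP]
    simp only [if_neg (show ¬ (i ≤ J ∧ J < hi) by omega)]
    split_ifs with h
    · rw [← mul_assoc, ih, hR J hJ (by omega)]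
    · rw [mul_one, ih]
end scan

open Finset PowerSeries
set_option linter.unusedSimpArgs false

noncomputable def cf (a k : ℕ) (y : ℚ) : ℚ := coeff a (X^k * US y)

lemma cf_lt (a k : ℕ) (y : ℚ) (h : a < k) : cf a k y = 0 := by
  rw [cf, coeff_X_pow_mul', if_neg (by omega)]

lemma cf_self (k : ℕ) (y : ℚ) : cf k k y = 1 := by
  rw [cf, coeff_X_pow_mul', if_pos le_rfl, Nat.sub_self, US_coeff_zero]

lemma cf_diff (a k : ℕ) (y : ℚ) : cf a k (y+1) - cf a k y = cf a (k+1) y + cf a (k+1) (y+1) := by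
  unfold cf
  rw [← map_sub, ← map_add]
  congr 1
  rw [US_add]
  linear_combination X^k * US y * US_one

noncomputable def yj (N j : ℕ) : ℚ := (j:ℚ) - ((N:ℚ)-1)/2

noncomputable def vv (m N i j : ℕ) : Fin m → ℚ := fun a =>
  if j + 1 < i then (-1)^(i-1-j) * cf a (m-1-j) (yj N j)
  else if N < j + i then cf a (m + j - N) (yj N j)
  else cf a (m - i) (yj N j)

def bs (m c : ℕ) : Fin m → ℚ := fun a => if (a:ℕ) = c then 1 else 0

noncomputable def Om (m : ℕ) : ℕ → EA m
  | 0 => 1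
  | i+1 => io (bs m (m-1-i)) * Om m i

lemma io_mul_pr {m : ℕ} (K : ℕ) (f : ℕ → Fin m → ℚ) (v : Fin m → ℚ) :
    io v * pr K f = pr (K+1) (fun t => if t = 0 then v else f (t-1)) := by
  induction K with
  | zero => rw [pr_succ, pr_zero, pr_zero]; simp
  | succ K ih => rw [pr_succ, pr_succ, ← mul_assoc, ih]; simp

lemma Om_pr (m i : ℕ) (hi : i ≤ m) : Om m i = pr i (fun t => bs m (m - i + t)) := by
  induction i with
  | zero => rw [Om, pr_zero]
  | succ i ih =>
    rw [Om, ih (by omega), io_mul_pr]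
    apply pr_congr
    intro t ht
    split_ifs with h
    · subst h; congr 1; omega
    · congr 1; omega

lemma Tp_Om (m : ℕ) : Tp m (Om m m) = 1 := by
  rw [Om_pr m m le_rfl, Tp_pr]
  have : (Matrix.of fun i j : Fin m => bs m (m - m + (i:ℕ)) j) = 1 := by
    ext i j
    simp only [Matrix.of_apply, bs, Matrix.one_apply, Nat.sub_self, zero_add]
    congr 1
    rw [Fin.ext_iff]; exact propext eq_comm
  rw [this, Matrix.det_one]

lemma io_Om (m i : ℕ) (hi : i ≤ m) (u : Fin m → ℚ) (hu : ∀ a : Fin m, (a:ℕ) < m - i → u a = 0) : io u * Om m i = 0 := by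
  induction i generalizing u with
  | zero =>
    have : u = 0 := by funext a; exact hu a (by omega)
    simp [this, io]
  | succ i ih =>
    let c : ℚ := u ⟨m-1-i, by omega⟩
    have hd : u = c • bs m (m-1-i) + (u - c • bs m (m-1-i)) := by abel
    have h0 := ih (by omega) (u - c • bs m (m-1-i)) (by
      intro a ha
      simp only [Pi.sub_apply, Pi.smul_apply, bs, smul_eq_mul]
      split_ifs with h
      · simp only [c]; rw [mul_one, sub_eq_zero]; congr 1; apply Fin.ext; exact h
      · rw [hu a (by omega)]; simp)
    rw [hd, io, map_add, map_smul, add_mul, Om, smul_mul_assoc, ← mul_assoc, ← mul_assoc]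
    have h1 := io_sq (bs m (m-1-i))
    have h2 := io_anti (u - c • bs m (m-1-i)) (bs m (m-1-i))
    simp only [io] at h1 h2 h0 ⊢
    rw [h1, h2, neg_mul, mul_assoc, h0]
    simp

lemma io_top (m i : ℕ) (hi : i + 1 ≤ m) (u : Fin m → ℚ) (hu : ∀ a : Fin m, (a:ℕ) < m - 1 - i → u a = 0)
    (h1 : u ⟨m-1-i, by omega⟩ = 1) : io u * Om m i = Om m (i+1) := by
  rw [Om, ← sub_eq_zero, ← sub_mul]
  have : io u - io (bs m (m-1-i)) = io (u - bs m (m-1-i)) := by simp [io]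
  rw [this]
  apply io_Om m i (by omega)
  intro a ha
  simp only [Pi.sub_apply, bs]
  split_ifs with h
  · rw [sub_eq_zero, ← h1]; congr 1; apply Fin.ext; exact h
  · rw [hu a (by omega)]; simp

noncomputable def fw (m N : ℕ) : ℕ → Finset ℕ → ℚ
  | 0 => fun S => if S = ∅ then 1 else 0
  | i+1 => fun X => ∑ Y ∈ (range N).powerset, fw m N i Y * (tw i (N-i) X Y N).2

lemma filt_eq (N : ℕ) (S : Finset ℕ) (hS : S ⊆ range N) : S.filter (· < N) = S := by
  rw [filter_true_of_mem]; intro x hx; exact mem_range.1 (hS hx)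

lemma fw_card (m N i : ℕ) (S : Finset ℕ) (hS : S ⊆ range N) (h : S.card ≠ i) : fw m N i S = 0 := by
  induction i generalizing S with
  | zero => simp only [fw]; rw [if_neg]; intro h2; rw [h2] at h; simp at h
  | succ i ih =>
    rw [fw]
    apply sum_eq_zero
    intro Y hY
    rw [mem_powerset] at hY
    by_cases hc : Y.card = i
    · have := (tw_card i (N-i) S Y N).2
      rw [filt_eq N S hS, filt_eq N Y hY] at this
      by_cases h0 : (tw i (N-i) S Y N).2 = 0
      · rw [h0, mul_zero]
      · exfalso; apply h; rw [this h0, hc]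
    · rw [ih Y hY hc, zero_mul]

lemma WP_isPr {m : ℕ} (P : (Fin m → ℚ) → Prop) (v : ℕ → Fin m → ℚ) (S : Finset ℕ) (J : ℕ)
    (h : ∀ j ∈ S, j < J → P (v j)) : IsPr P (S.filter (· < J)).card (WP (fun j => io (v j)) S J) := by
  induction J with
  | zero => simpa [WP] using IsPr.one P
  | succ J ih =>
    have ih := ih (fun j hj hJ => h j hj (by omega))
    rw [WP]
    by_cases hJ : J ∈ S
    · rw [if_pos hJ]
      have : S.filter (· < J+1) = insert J (S.filter (· < J)) := by
        ext x; simp only [mem_filter, mem_insert]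
        constructor
        · rintro ⟨h1, h2⟩
          by_cases hx : x = J
          · exact Or.inl hx
          · exact Or.inr ⟨h1, by omega⟩
        · rintro (h1 | ⟨h1, h2⟩)
          · subst h1; exact ⟨hJ, by omega⟩
          · exact ⟨h1, by omega⟩
      rw [this, card_insert_of_notMem (by simp)]
      exact ih.mul (h J hJ (by omega))
    · rw [if_neg hJ, mul_one]
      have : S.filter (· < J+1) = S.filter (· < J) := by
        ext x; simp only [mem_filter]
        constructor
        · rintro ⟨h1, h2⟩
          refine ⟨h1, ?_⟩
          by_contra hx
          apply hJ; rwa [show J = x by omega]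
        · rintro ⟨h1, h2⟩; exact ⟨h1, by omega⟩
      rw [this]; exact ih

lemma tw_nowin (lo hi : ℕ) (X Y : Finset ℕ) (h : ∀ j, lo ≤ j → j < hi → j ∉ X) (J : ℕ) : (tw lo hi X Y J).2 = 0 := by
  induction J with
  | zero => rfl
  | succ J ih =>
    rw [tw]
    by_cases hw : lo ≤ J ∧ J < hi
    · simp only [if_pos hw, if_neg (h J hw.1 hw.2)]
      split_ifs
      · rfl
      · exact ih
    · simp only [if_neg hw]
      split_ifs
      · exact ih
      · rfl

/-- the main identity -/
theorem WP_main (m N : ℕ) (hN : 2 * m ≤ N) (i : ℕ) (hi : i ≤ m) (S : Finset ℕ) (hS : S ⊆ range N) (hc : S.card = i) :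
    WP (fun j => io (vv m N i j)) S N = fw m N i S • Om m i := by
  induction i generalizing S with
  | zero =>
    rw [card_eq_zero] at hc
    subst hc
    have : ∀ J, WP (fun j => io (vv m N 0 j)) ∅ J = 1 := by
      intro J; induction J with
      | zero => rfl
      | succ J ih => rw [WP, ih]; simp
    rw [this]; simp [fw, Om]
  | succ i ih =>
    by_cases hx : ∃ x, i ≤ x ∧ x < N - i ∧ x ∈ S
    · let x := Nat.find hx
      obtain ⟨x0, x1, x2⟩ : i ≤ x ∧ x < N - i ∧ x ∈ S := Nat.find_spec hx
      have hmin : ∀ j, i ≤ j → j < x → j ∉ S := fun j h1 h2 h3 => Nat.find_min hx h2 ⟨h1, by omega, h3⟩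
      have hVw : ∀ j, i ≤ j → j < N - i → vv m N (i+1) j = fun a : Fin m => cf a (m - (i+1)) (yj N j) := by
        intro j h1 h2; funext a
        rw [vv, if_neg (by omega), if_neg (by omega)]
      have hvw : ∀ j, i ≤ j → j < N - i → vv m N i j = fun a : Fin m => cf a (m - i) (yj N j) := by
        intro j h1 h2; funext a
        rw [vv, if_neg (by omega), if_neg (by omega)]
      have key := scan_main i (N-i) N (fun j => io (vv m N i j)) (fun j => io (vv m N (i+1) j)) S
        (by
          intro j hj
          rw [← neg_eq_iff_eq_neg]
          have : -vv m N (i+1) j = vv m N i j := by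
            funext a
            rw [Pi.neg_apply, vv, vv, if_pos (by omega)]
            by_cases h : j + 1 < i
            · rw [if_pos h, show i + 1 - 1 - j = i - 1 - j + 1 by omega, pow_succ]; ring
            · rw [if_neg h, if_neg (by omega), show i + 1 - 1 - j = 1 by omega, show m - 1 - j = m - i by omega]; ring
          rw [← this]; simp [io])
        (by
          intro j h1 h2
          congr 1
          funext a
          rw [vv, vv, if_neg (by omega), if_pos (by omega), if_neg (by omega)]
          split_ifs with h
          · rfl
          · congr 1; omega)
        (by
          intro j h1 h2
          rw [hVw j h1 (by omega), hVw (j+1) (by omega) h2, hvw j h1 (by omega), hvw (j+1) (by omega) h2]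
          simp only [io, ← map_sub, ← map_add]
          congr 1
          funext a
          have := cf_diff a (m-(i+1)) (yj N j)
          rw [show yj N j + 1 = yj N (j+1) by unfold yj; push_cast; ring, show m - (i+1) + 1 = m - i by omega] at this
          exact this)
        (fun j => io_sq _) (fun j => io_sq _) x x0 x1 x2 hmin (fun j => io_anti _ _) (by omega)
      rw [← key, (Z_sum _ _ _ _ _).2]
      have e : ∑ Y ∈ (range N).powerset, (tw i (N-i) S Y N).2 • WP (fun j => io (vv m N i j)) Y N = fw m N (i+1) S • Om m i := by
        rw [fw, sum_smul]
        apply sum_congr rfl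
        intro Y hY
        rw [mem_powerset] at hY
        by_cases hYc : Y.card = i
        · rw [ih (by omega) Y hY hYc, smul_smul, mul_comm]
        · rw [fw_card m N i Y hY hYc]
          have := (tw_card i (N-i) S Y N).2
          rw [filt_eq N S hS, filt_eq N Y hY] at this
          by_cases h0 : (tw i (N-i) S Y N).2 = 0
          · simp [h0]
          · exfalso; have := this h0; omega
      rw [e, mul_smul_comm, io_top m i hi]
      · intro a ha
        rw [hVw x x0 x1]
        exact cf_lt _ _ _ (by omega)
      · rw [hVw x x0 x1]
        dsimp only
        rw [show m - (i+1) = m - 1 - i by omega, cf_self]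
    · push Not at hx
      have h0 : fw m N (i+1) S = 0 := by
        rw [fw]
        apply sum_eq_zero
        intro Y _
        rw [tw_nowin _ _ _ _ hx, mul_zero]
      rw [h0, zero_smul]
      have := WP_isPr (fun v : Fin m → ℚ => ∀ a : Fin m, (a:ℕ) < m - i → v a = 0) (vv m N (i+1)) S N (by
        intro j hj hjN a ha
        have hj2 : ¬ (i ≤ j ∧ j < N - i) := fun h => hx j h.1 h.2 hj
        rw [vv]
        split_ifs with h1 h2
        · rw [cf_lt _ _ _ (by omega), mul_zero]
        · rw [cf_lt _ _ _ (by omega)]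
        · omega)
      rw [filt_eq N S hS, hc] at this
      exact this.zero_of_lt (by omega) (by omega)

open Finset PowerSeries
set_option linter.unusedSimpArgs false

def PP {A : Type*} [Ring A] (m l : ℕ) (v : ℕ → A) : ℕ → A
  | 0 => 1
  | J+1 => PP m l v J * (if m ≤ J ∧ J + 2 < m + l then 1 else 1 + v J)

def ncen (m l J : ℕ) : Finset ℕ := (range J).filter (fun j => ¬ (m ≤ j ∧ j + 2 < m + l))

lemma sum_WP_PP {A : Type*} [Ring A] (m l : ℕ) (v : ℕ → A) (J : ℕ) :
    ∑ C ∈ (ncen m l J).powerset, WP v C J = PP m l v J := by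
  induction J with
  | zero => simp [ncen, WP, PP]
  | succ J ih =>
    have hn : J ∉ ncen m l J := by simp [ncen]
    have hY : ∀ Y ∈ (ncen m l J).powerset, J ∉ Y := fun Y hY h => by
      rw [mem_powerset] at hY; exact hn (hY h)
    have e1 : ∀ Y ∈ (ncen m l J).powerset, WP v Y (J+1) = WP v Y J := fun Y h => by
      rw [WP, if_neg (hY Y h), mul_one]
    have e2 : ∀ Y ∈ (ncen m l J).powerset, WP v (insert J Y) (J+1) = WP v Y J * v J := fun Y h => by
      rw [WP, if_pos (mem_insert_self _ _), WP_insert _ _ _ _ le_rfl]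
    by_cases h : m ≤ J ∧ J + 2 < m + l
    · have : ncen m l (J+1) = ncen m l J := by
        rw [ncen, range_add_one, filter_insert, if_neg (by simpa using h)]; rfl
      rw [this, PP, if_pos h, mul_one, ← ih, sum_congr rfl e1]
    · have : ncen m l (J+1) = insert J (ncen m l J) := by
        rw [ncen, range_add_one, filter_insert, if_pos h]; rfl
      rw [this, sum_powerset_insert hn, PP, if_neg h, sum_congr rfl e1, sum_congr rfl e2, ih, ← sum_mul, ih, mul_add, mul_one]

lemma Rr_cf (p : ℚ) (k a : ℕ) : Rr p k a = cf a k (p+k) := by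
  rw [Rr, wS_pow, cf]

lemma Lr_cf (p : ℚ) (k a : ℕ) : (-1)^a * Rr p k a = (-1)^k * cf a k (-(p+k)) := by
  rw [Rr_cf, cf, cf, coeff_X_pow_mul', coeff_X_pow_mul']
  split_ifs with h
  · rw [← US_rescale, coeff_rescale, ← mul_assoc, ← pow_add, Nat.add_sub_cancel' h]
  · simp

lemma PP_QQ (m l : ℕ) (hl : 2 ≤ l) (hm : 1 ≤ m) (K : ℕ) (hK : K ≤ m) :
    PP m l (fun j => io (vv m (2*m+l-2) m j)) (m + l - 2 + K) =
    PP m l (fun j => io (vv m (2*m+l-2) m j)) (m - K) * QQ (Lv m (((l:ℚ)-1)/2)) (Rv m (((l:ℚ)-1)/2)) K := by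
  induction K with
  | zero =>
    simp only [QQ, mul_one, Nat.sub_zero, add_zero]
    have : ∀ t, t ≤ l - 2 → PP m l (fun j => io (vv m (2*m+l-2) m j)) (m + t) = PP m l (fun j => io (vv m (2*m+l-2) m j)) m := by
      intro t
      induction t with
      | zero => simp
      | succ t ih =>
        intro ht
        rw [← add_assoc, PP, if_pos (by omega), mul_one, ih (by omega)]
    rw [show m + l - 2 = m + (l-2) by omega, this _ le_rfl]
  | succ K ih =>
    have hr : vv m (2*m+l-2) m (m+l-2+K) = Rv m (((l:ℚ)-1)/2) K := by
      funext a
      rw [vv, Rv, Rr_cf, if_neg (by omega)]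
      have hy : yj (2*m+l-2) (m+l-2+K) = ((l:ℚ)-1)/2 + K := by
        unfold yj
        rw [show m+l-2+K = m + (l-2) + K by omega, show 2*m+l-2 = 2*m+(l-2) by omega]
        push_cast [Nat.cast_sub hl]; ring
      rw [hy]
      split_ifs with h
      · congr 1; omega
      · congr 1; omega
    have hL : vv m (2*m+l-2) m (m-(K+1)) = Lv m (((l:ℚ)-1)/2) K := by
      funext a
      have hy : yj (2*m+l-2) (m-(K+1)) = -(((l:ℚ)-1)/2 + K) := by
        unfold yj
        rw [show 2*m+l-2 = 2*m+(l-2) by omega]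
        push_cast [Nat.cast_sub hl, Nat.cast_sub hK]; ring
      rw [vv, Lv, Lr_cf, hy]
      by_cases h : m - (K+1) + 1 < m
      · rw [if_pos h, show m - 1 - (m-(K+1)) = K by omega]
      · rw [if_neg h, if_neg (by omega), show K = 0 by omega]; simp
    rw [← add_assoc, PP, if_neg (by omega), ih (by omega), hr, QQ]
    conv_lhs => rw [show m - K = m - (K+1) + 1 by omega]
    rw [PP, if_neg (by omega), hL]
    simp only [mul_assoc]

theorem abs_sum_fw (n l : ℕ) (hl : 2 ≤ l) :
    |∑ C ∈ (ncen (2*n+1) l (2*(2*n+1)+l-2)).powerset, fw (2*n+1) (2*(2*n+1)+l-2) (2*n+1) C| = 2^(n+1) * (tau n l)^2 := by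
  have h1 := abs_Tp_QQ n (((l:ℚ)-1)/2)
  rw [abs_Bm_final, show ((l:ℚ)-1)/2 + 1/2 = l/2 by ring, show 1/2 - ((l:ℚ)-1)/2 - 2*n = 1 - 2*n - l/2 by ring,
    Mm_diag n l (by have : (2:ℚ) ≤ l := by exact_mod_cast hl
                    linarith)] at h1
  rw [← h1]
  have h2 := PP_QQ (2*n+1) l hl (by omega) (2*n+1) le_rfl
  rw [Nat.sub_self, PP, one_mul, show 2*n+1+l-2+(2*n+1) = 2*(2*n+1)+l-2 by omega] at h2
  rw [← h2, ← sum_WP_PP, map_sum]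
  congr 1
  apply sum_congr rfl
  intro C hC
  have hC' : C ⊆ range (2*(2*n+1)+l-2) := (mem_powerset.1 hC).trans (filter_subset _ _)
  by_cases hc : C.card = 2*n+1
  · rw [WP_main (2*n+1) _ (by omega) _ le_rfl C hC' hc, map_smul, Tp_Om]; simp
  · rw [fw_card _ _ _ _ hC' hc]
    have := WP_isPr (fun _ : Fin (2*n+1) → ℚ => True) (vv (2*n+1) (2*(2*n+1)+l-2) (2*n+1)) C (2*(2*n+1)+l-2) (fun _ _ _ => trivial)
    rw [filt_eq _ _ hC'] at this
    rw [this.top_zero hc]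

open Finset PowerSeries
set_option linter.unusedSimpArgs false

lemma psum_zero_between (b : ℕ → ℤ) (j1 k : ℕ) (h : ∀ j', j1 < j' → j' < j1 + 1 + k → b j' = 0) :
    ∑ j ∈ range (j1 + 1 + k), b j = ∑ j ∈ range (j1+1), b j := by
  induction k with
  | zero => rfl
  | succ k ih =>
    rw [← add_assoc, sum_range_succ, ih (fun j' h1 h2 => h j' h1 (by omega)), h _ (by omega) (by omega), add_zero]

lemma psum_alt (b : ℕ → ℤ) (hP : ∀ J, ∑ j ∈ range J, b j = 0 ∨ ∑ j ∈ range J, b j = 1) (j1 j2 : ℕ) (h12 : j1 < j2)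
    (h1 : b j1 ≠ 0) (h2 : b j2 ≠ 0) (h : ∀ j', j1 < j' → j' < j2 → b j' = 0) : b j2 = - b j1 := by
  obtain ⟨k, rfl⟩ : ∃ k, j2 = j1 + 1 + k := ⟨j2 - (j1+1), by omega⟩
  have e1 := psum_zero_between b j1 k h
  have e2 := sum_range_succ b j1
  have e3 := sum_range_succ b (j1+1+k)
  have a1 := hP j1
  have a2 := hP (j1+1)
  have a3 := hP (j1+1+k)
  have a4 := hP (j1+1+k+1)
  omega

lemma psum_entries (b : ℕ → ℤ) (hP : ∀ J, ∑ j ∈ range J, b j = 0 ∨ ∑ j ∈ range J, b j = 1) (j : ℕ) :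
    b j = -1 ∨ b j = 0 ∨ b j = 1 := by
  have e2 := sum_range_succ b j
  have a1 := hP j
  have a2 := hP (j+1)
  omega

lemma psum_top (b : ℕ → ℤ) (hP : ∀ J, ∑ j ∈ range J, b j = 0 ∨ ∑ j ∈ range J, b j = 1) (j : ℕ)
    (h1 : b j ≠ 0) (h : ∀ j', j' < j → b j' = 0) : b j = 1 := by
  have e2 := sum_range_succ b j
  have e1 : ∑ j ∈ range j, b j = 0 := sum_eq_zero (fun x hx => h x (mem_range.1 hx))
  have a2 := hP (j+1)
  omega

lemma psum_of_alt (b : ℕ → ℤ) (he : ∀ j, b j = -1 ∨ b j = 0 ∨ b j = 1)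
    (ha : ∀ j1 j2, j1 < j2 → b j1 ≠ 0 → b j2 ≠ 0 → (∀ j', j1 < j' → j' < j2 → b j' = 0) → b j2 = - b j1)
    (ht : ∀ j, b j ≠ 0 → (∀ j', j' < j → b j' = 0) → b j = 1) (J : ℕ) :
    ∑ j ∈ range J, b j = 0 ∨ ∑ j ∈ range J, b j = 1 := by
  suffices H : ((∑ j ∈ range J, b j = 0) ∧ ∀ j < J, b j = 0) ∨ ∃ j1 < J, b j1 ≠ 0 ∧ (∀ j', j1 < j' → j' < J → b j' = 0) ∧
      ((b j1 = 1 ∧ ∑ j ∈ range J, b j = 1) ∨ (b j1 = -1 ∧ ∑ j ∈ range J, b j = 0)) by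
    rcases H with h | ⟨_, _, _, _, h | h⟩
    · exact Or.inl h.1
    · exact Or.inr h.2
    · exact Or.inl h.2
  induction J with
  | zero => left; simp
  | succ J ih =>
    rw [sum_range_succ]
    by_cases hJ : b J = 0
    · rw [hJ, add_zero]
      rcases ih with ⟨h1, h2⟩ | ⟨j1, h1, h2, h3, h4⟩
      · refine Or.inl ⟨h1, fun j hj => ?_⟩
        rcases Nat.lt_succ_iff_lt_or_eq.1 hj with h | rfl
        · exact h2 j h
        · exact hJ
      · refine Or.inr ⟨j1, by omega, h2, fun j hj hj' => ?_, h4⟩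
        rcases Nat.lt_succ_iff_lt_or_eq.1 hj' with h | rfl
        · exact h3 j hj h
        · exact hJ
    · refine Or.inr ⟨J, by omega, hJ, fun j _ _ => by omega, ?_⟩
      rcases ih with ⟨h1, h2⟩ | ⟨j1, h1, h2, h3, h4⟩
      · left
        have := ht J hJ h2
        omega
      · have := ha j1 J h1 h2 hJ h3
        omega

lemma psum_of_alt_sum (b : ℕ → ℤ) (he : ∀ j, b j = -1 ∨ b j = 0 ∨ b j = 1)
    (ha : ∀ j1 j2, j1 < j2 → b j1 ≠ 0 → b j2 ≠ 0 → (∀ j', j1 < j' → j' < j2 → b j' = 0) → b j2 = - b j1)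
    (N : ℕ) (hN : ∑ j ∈ range N, b j = 1) (J : ℕ) :
    ∑ j ∈ range J, b j = 0 ∨ ∑ j ∈ range J, b j = 1 := by
  by_cases ht : ∀ j, b j ≠ 0 → (∀ j', j' < j → b j' = 0) → b j = 1
  · exact psum_of_alt b he ha ht J
  · exfalso
    push Not at ht
    obtain ⟨j, h1, h2, h3⟩ := ht
    have h4 : b j = -1 := by have := he j; omega
    have := psum_of_alt (fun j => - b j) (fun j => by have := he j; omega)
      (fun j1 j2 h h' h'' h3 => by
        have := ha j1 j2 h (by simpa using h') (by simpa using h'') (fun j' q q' => by simpa using h3 j' q q')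
        simp [this])
      (fun k hk hk' => by
        have hkj : k = j := by
          rcases lt_trichotomy k j with h | h | h
          · exact absurd (h2 k h) (by simpa using hk)
          · exact h
          · exact absurd (hk' j h) (by simpa using h1)
        rw [hkj, h4]; rfl) N
    rw [sum_neg_distrib, hN] at this
    omega

/-- The difference of indicator functions. -/
def dd (X Y : Finset ℕ) (j : ℕ) : ℤ := (if j ∈ X then 1 else 0) - (if j ∈ Y then 1 else 0)

lemma tw_ne (lo hi : ℕ) (X Y : Finset ℕ) (J : ℕ) (s : ℤ) (hs : (s = 0 ∧ (tw lo hi X Y J).1 ≠ 0) ∨ (s = 1 ∧ (tw lo hi X Y J).2 ≠ 0)) :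
    (∀ K ≤ J, ∑ j ∈ range K, dd X Y j = 0 ∨ ∑ j ∈ range K, dd X Y j = 1) ∧ (∑ j ∈ range J, dd X Y j = s) ∧
    (∀ j < J, ¬(lo ≤ j ∧ j < hi) → dd X Y j = 0) := by
  induction J generalizing s with
  | zero =>
    rcases hs with ⟨rfl, h⟩ | ⟨rfl, h⟩
    · simp
    · simp [tw] at h
  | succ J ih =>
    suffices H : ∃ s', ((s' = 0 ∧ (tw lo hi X Y J).1 ≠ 0) ∨ (s' = 1 ∧ (tw lo hi X Y J).2 ≠ 0)) ∧ s = s' + dd X Y J ∧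
        (¬(lo ≤ J ∧ J < hi) → dd X Y J = 0) by
      obtain ⟨s', h1, h2, h3⟩ := H
      obtain ⟨i1, i2, i3⟩ := ih s' h1
      have e : ∑ j ∈ range (J+1), dd X Y j = s := by rw [sum_range_succ, i2, h2]
      refine ⟨fun K hK => ?_, e, fun j hj => ?_⟩
      · rcases Nat.le_succ_iff.1 hK with h | rfl
        · exact i1 K h
        · rw [e]; omega
      · rcases Nat.lt_succ_iff_lt_or_eq.1 hj with h | rfl
        · exact i3 j h
        · exact h3
    rw [tw] at hs
    by_cases h0 : lo ≤ J ∧ J < hi <;> by_cases hX : J ∈ X <;> by_cases hY : J ∈ Y <;>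
      simp [h0, hX, hY] at hs <;> simp only [dd, hX, hY, if_true, if_false]
    · exact ⟨s, hs, by ring, by simp⟩
    · exact ⟨0, by simpa using hs.2, by rw [hs.1]; norm_num, fun h => absurd h0 h⟩
    · exact ⟨1, by simpa using hs.2, by rw [hs.1]; norm_num, fun h => absurd h0 h⟩
    · exact ⟨s, hs, by ring, by simp⟩
    · exact ⟨s, hs, by ring, by simp⟩
    · exact ⟨s, hs, by ring, by simp⟩

lemma tw_val (lo hi : ℕ) (X Y : Finset ℕ) (J : ℕ)
    (h1 : ∀ K ≤ J, ∑ j ∈ range K, dd X Y j = 0 ∨ ∑ j ∈ range K, dd X Y j = 1)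
    (h2 : ∀ j < J, ¬(lo ≤ j ∧ j < hi) → dd X Y j = 0) :
    tw lo hi X Y J = if ∑ j ∈ range J, dd X Y j = 0 then
      (2^(∑ j ∈ range J, if dd X Y j = -1 then 1 else 0), 0) else (0, 2^(∑ j ∈ range J, if dd X Y j = -1 then 1 else 0)) := by
  induction J with
  | zero => simp [tw]
  | succ J ih =>
    have ih' := ih (fun K hK => h1 K (by omega)) (fun j hj => h2 j (by omega))
    have a1 := h1 J (by omega)
    have a2 := h1 (J+1) (by omega)
    have a3 := h2 J (by omega)
    rw [sum_range_succ] at a2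
    rw [tw, ih', sum_range_succ, sum_range_succ]
    have hd : dd X Y J = (if J ∈ X then 1 else 0) - (if J ∈ Y then 1 else 0) := rfl
    by_cases h0 : lo ≤ J ∧ J < hi <;> by_cases hX : J ∈ X <;> by_cases hY : J ∈ Y <;>
      simp only [hX, hY, if_true, if_false] at hd <;> norm_num at hd <;>
      rcases a1 with a1 | a1 <;> rw [a1] at a2 <;> simp [hd, h0] at a2 a3 <;> simp [hd, hX, hY, h0, a1, pow_succ, mul_comm]

lemma chain_sum {σ : Type*} [Fintype σ] (u : σ → ℚ) (f : ℕ → σ → ℚ) (T : ℕ → σ → σ → ℚ)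
    (h0 : ∀ x, f 0 x = u x) (hs : ∀ i x, f (i+1) x = ∑ y, f i y * T i x y) (m : ℕ) (g : σ → ℚ) :
    ∑ x, f m x * g x = ∑ S : Fin (m+1) → σ, u (S 0) *
      (∏ i : Fin m, T i (S i.succ) (S i.castSucc)) * g (S (Fin.last m)) := by
  induction m generalizing g with
  | zero =>
    rw [← (Equiv.funUnique (Fin 1) σ).symm.sum_comp]
    apply sum_congr rfl
    intro x _
    simp [h0]
  | succ m ih =>
    have : ∑ x, f (m+1) x * g x = ∑ y, f m y * ∑ x, T m x y * g x := by
      simp only [hs, sum_mul, mul_sum]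
      rw [sum_comm]
      simp only [mul_assoc]
    rw [this, ih, ← (Fin.snocEquiv (fun _ : Fin (m+2) => σ)).sum_comp, Fintype.sum_prod_type, sum_comm]
    apply sum_congr rfl
    intro S _
    rw [mul_sum]
    apply sum_congr rfl
    intro x _
    have e0 : (Fin.snoc S x : Fin (m+2) → σ) 0 = S 0 := by
      have := Fin.snoc_castSucc (α := fun _ : Fin (m+2) => σ) x S 0
      exact this
    simp only [Fin.snocEquiv, Equiv.coe_fn_mk]
    rw [e0, Fin.prod_univ_castSucc]
    have e1 : ∀ i : Fin m, (Fin.snoc S x : Fin (m+2) → σ) i.castSucc.succ = S i.succ := fun i => by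
      rw [Fin.succ_castSucc]; exact Fin.snoc_castSucc (α := fun _ : Fin (m+2) => σ) x S _
    simp only [e1, Fin.snoc_castSucc, Fin.succ_last, Fin.snoc_last, Fin.val_castSucc, Fin.val_last]
    ring

open Finset PowerSeries
set_option linter.unusedSimpArgs false

section Bij
variable {m k : ℕ}

lemma ast_colP (A : AST m k) (I j : ℕ) : ∑ i ∈ range I, A.a i j = 0 ∨ ∑ i ∈ range I, A.a i j = 1 :=
  psum_of_alt (fun i => A.a i j) (fun i => A.entries i j) (A.col_alt j) (fun i => A.col_top i j) I

lemma ast_rowP (A : AST m k) (i : ℕ) (hi : i < m) (J : ℕ) : ∑ j ∈ range J, A.a i j = 0 ∨ ∑ j ∈ range J, A.a i j = 1 :=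
  psum_of_alt_sum (fun j => A.a i j) (A.entries i) (A.row_alt i) _ (A.row_sum i hi) J

def stt (A : AST m k) (i : ℕ) : Finset ℕ := (range (2*m+k-2)).filter (fun j => ∑ i' ∈ range i, A.a i' j = 1)

lemma stt_dd (A : AST m k) (hk : 2 ≤ k) (i : ℕ) (hi : i < m) (j : ℕ) : dd (stt A (i+1)) (stt A i) j = A.a i j := by
  have h1 := ast_colP A i j
  have h2 := ast_colP A (i+1) j
  have h3 := sum_range_succ (fun i => A.a i j) i
  simp only [dd, stt, mem_filter, mem_range]
  by_cases hj : j < 2*m+k-2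
  · simp only [hj, true_and]
    split_ifs <;> omega
  · have := A.outside i j (by omega)
    simp [hj, this]

abbrev Sg (N : ℕ) := ↥((range N).powerset)

def phi (A : AST m k) (i : Fin (m+1)) : Sg (2*m+k-2) := ⟨stt A i, mem_powerset.2 (filter_subset _ _)⟩

lemma phi_inj (hk : 2 ≤ k) : Function.Injective (phi : AST m k → _) := by
  intro A B h
  have hs : ∀ i ≤ m, stt A i = stt B i := fun i hi => congrArg Subtype.val (congrFun h ⟨i, by omega⟩)
  have : A.a = B.a := by
    funext i j
    by_cases hi : i < m
    · rw [← stt_dd A hk i hi, ← stt_dd B hk i hi, hs i (by omega), hs (i+1) (by omega)]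
    · rw [A.outside i j (by omega), B.outside i j (by omega)]
  cases A; cases B; cases this; rfl

noncomputable def Wt (m k : ℕ) (S : Fin (m+1) → Sg (2*m+k-2)) : ℚ :=
  (if (S 0).1 = ∅ then 1 else 0) *
    (∏ i : Fin m, (tw i (2*m+k-2-i) (S i.succ).1 (S i.castSucc).1 (2*m+k-2)).2) *
    (if (S (Fin.last m)).1 ⊆ ncen m k (2*m+k-2) then 1 else 0)

lemma Wt_phi (A : AST m k) (hk : 2 ≤ k) : Wt m k (phi A) = 2 ^ qStat A := by
  rw [Wt, if_pos, if_pos, one_mul, mul_one]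
  · have : ∀ i : Fin m, (tw i (2*m+k-2-i) (phi A i.succ).1 (phi A i.castSucc).1 (2*m+k-2)).2 =
        2 ^ (∑ j ∈ range (2*m+k-2), if A.a i j = -1 then 1 else 0) := by
      intro i
      have hi := i.2
      change (tw i (2*m+k-2-i) (stt A (i+1)) (stt A i) (2*m+k-2)).2 = _
      rw [tw_val]
      · simp only [stt_dd A hk i hi, A.row_sum i hi]; simp
      · intro K _
        simp only [stt_dd A hk i hi]; exact ast_rowP A i hi K
      · intro j hj h
        rw [stt_dd A hk i hi]; exact A.outside i j (by omega)
    simp only [this]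
    rw [prod_pow_eq_pow_sum, qStat]
    congr 1
    exact Fin.sum_univ_eq_sum_range (fun i => ∑ j ∈ range (2*m+k-2), if A.a i j = -1 then 1 else 0) m
  · intro j hj
    simp only [phi, stt, mem_filter, Fin.val_last] at hj
    rw [ncen, mem_filter]
    refine ⟨hj.1, fun h => ?_⟩
    have := A.central_sum j h.1 (by omega)
    omega
  · simp [phi, stt]

lemma Wt_surj (hk : 2 ≤ k) (S : Fin (m+1) → Sg (2*m+k-2)) (hS : Wt m k S ≠ 0) : ∃ A : AST m k, phi A = S := by
  rw [Wt] at hS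
  have hl := right_ne_zero_of_mul hS
  have hp := right_ne_zero_of_mul (left_ne_zero_of_mul hS)
  have h0 := left_ne_zero_of_mul (left_ne_zero_of_mul hS)
  replace h0 : (S 0).1 = ∅ := by by_contra h; simp [h] at h0
  replace hl : (S (Fin.last m)).1 ⊆ ncen m k (2*m+k-2) := by by_contra h; simp [h] at hl
  rw [prod_ne_zero_iff] at hp
  set x : ℕ → Finset ℕ := fun i => (S ⟨min i m, by omega⟩).1 with hx
  have x0 : x 0 = ∅ := by rw [← h0]; simp [hx]
  have xm : x m ⊆ ncen m k (2*m+k-2) := by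
    have : x m = (S (Fin.last m)).1 := by simp [hx, Fin.last]
    rwa [this]
  have xN : ∀ i, x i ⊆ range (2*m+k-2) := fun i => mem_powerset.1 (S _).2
  have xt : ∀ i < m, (tw i (2*m+k-2-i) (x (i+1)) (x i) (2*m+k-2)).2 ≠ 0 := by
    intro i hi
    have := hp ⟨i, hi⟩ (mem_univ _)
    have e1 : x (i+1) = (S (Fin.succ ⟨i, hi⟩)).1 := by
      simp only [hx]; congr 2; ext; simp; omega
    have e2 : x i = (S (Fin.castSucc ⟨i, hi⟩)).1 := by
      simp only [hx]; congr 2; ext; simp; omega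
    rw [e1, e2]; exact this
  have xc : ∀ i, m ≤ i → x (i+1) = x i := by
    intro i hi
    simp only [hx]; congr 2; ext; simp; omega
  set a : ℕ → ℕ → ℤ := fun i j => dd (x (i+1)) (x i) j with ha
  have acol : ∀ I j, ∑ i ∈ range I, a i j = if j ∈ x I then 1 else 0 := by
    intro I j
    induction I with
    | zero => simp [x0]
    | succ I ih => rw [sum_range_succ, ih, ha]; simp only [dd]; ring
  have acolP : ∀ j I, ∑ i ∈ range I, a i j = 0 ∨ ∑ i ∈ range I, a i j = 1 := by
    intro j I; rw [acol]; split_ifs <;> simp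
  have aN : ∀ i j, 2*m+k-2 ≤ j → a i j = 0 := by
    intro i j hj
    have h1 : j ∉ x i := fun h => by have := mem_range.1 (xN i h); omega
    have h2 : j ∉ x (i+1) := fun h => by have := mem_range.1 (xN (i+1) h); omega
    simp [ha, dd, h1, h2]
  have am : ∀ i j, m ≤ i → a i j = 0 := by
    intro i j hi
    simp [ha, dd, xc i hi]
  have T := fun i (hi : i < m) => tw_ne i (2*m+k-2-i) (x (i+1)) (x i) (2*m+k-2) 1 (Or.inr ⟨rfl, xt i hi⟩)
  have arowP : ∀ i J, ∑ j ∈ range J, a i j = 0 ∨ ∑ j ∈ range J, a i j = 1 := by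
    intro i J
    by_cases hi : i < m
    · by_cases hJ : J ≤ 2*m+k-2
      · exact (T i hi).1 J hJ
      · right
        rw [← (T i hi).2.1]
        symm
        apply sum_subset (range_subset_range.2 (by omega))
        intro j _ hj
        exact aN i j (by simpa using hj)
    · left; exact sum_eq_zero (fun j _ => am i j (by omega))
  refine ⟨⟨a, fun i => psum_entries _ (arowP i), ?_, fun i hi => (T i hi).2.1, fun i => psum_alt _ (arowP i),
    fun j => psum_alt (fun i => a i j) (acolP j), fun i j => psum_top (fun i => a i j) (acolP j) i, ?_⟩, ?_⟩
  · intro i j h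
    by_cases hi : i < m
    · by_cases hj : j < 2*m+k-2
      · exact (T i hi).2.2 j hj (by omega)
      · exact aN i j (by omega)
    · exact am i j (by omega)
  · intro j h1 h2
    rw [acol, if_neg]
    intro h
    have := (mem_filter.1 (xm h)).2
    omega
  · funext i
    apply Subtype.ext
    have hi := i.2
    have e : x i = (S i).1 := by
      simp only [hx]; congr 2; ext; simp; omega
    rw [← e]
    ext j
    simp only [phi, stt, mem_filter, acol]
    constructor
    · rintro ⟨_, h⟩
      by_contra h'
      simp [h'] at h
    · intro h
      exact ⟨xN _ h, by simp [h]⟩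

theorem ast_sum (hk : 2 ≤ k) : ∑ᶠ A : AST m k, (2:ℚ) ^ qStat A =
    ∑ C ∈ (ncen m k (2*m+k-2)).powerset, fw m (2*m+k-2) m C := by
  have h1 : ∑ᶠ A : AST m k, (2:ℚ) ^ qStat A = ∑ S, Wt m k S := by
    simp only [← Wt_phi _ hk]
    rw [← finsum_mem_range (phi_inj hk), ← finsum_eq_sum_of_fintype, finsum_mem_def]
    congr 1
    funext S
    by_cases h : S ∈ Set.range (phi : AST m k → _)
    · simp [h]
    · simp only [Set.indicator_of_notMem h]
      by_contra h'
      exact h (Wt_surj hk S (Ne.symm h'))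
  have h2 := chain_sum (σ := Sg (2*m+k-2)) (fun x => if x.1 = ∅ then 1 else 0) (fun i x => fw m (2*m+k-2) i x.1)
    (fun i x y => (tw i (2*m+k-2-i) x.1 y.1 (2*m+k-2)).2) (fun x => by simp [fw])
    (fun i x => by
      rw [fw]
      exact (sum_coe_sort _ (fun Y => fw m (2*m+k-2) i Y * (tw i (2*m+k-2-i) x.1 Y (2*m+k-2)).2)).symm) m
    (fun x => if x.1 ⊆ ncen m k (2*m+k-2) then 1 else 0)
  rw [h1]
  simp only [Wt]
  rw [← h2, sum_coe_sort _ (fun Y => fw m (2*m+k-2) m Y * (if Y ⊆ ncen m k (2*m+k-2) then 1 else 0))]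
  simp only [mul_ite, mul_one, mul_zero]
  rw [← sum_filter]
  apply sum_congr _ (fun _ _ => rfl)
  ext C
  simp only [mem_filter, mem_powerset]
  exact ⟨fun h => h.2, fun h => ⟨h.trans (filter_subset _ _), h⟩⟩

end Bij

/-- for `l ≥ 2` and `n ≥ 0`, the 2-enumeration of `(2n+1,l)`-alternating sign
trapezoids equals `2^{n+1} (∏_{1≤i≤j≤n} (2(i+j)+l-3)/(2i-1))²`. -/
theorem ast_two_enumeration_odd (n l : ℕ) (hl : 2 ≤ l) :
    ∑ᶠ A : AST (2 * n + 1) l, (2 : ℚ) ^ qStat A =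
      2 ^ (n + 1) *
        (∏ j ∈ Finset.range n, ∏ i ∈ Finset.range (j + 1),
          (2 * (((i : ℚ) + 1) + ((j : ℚ) + 1)) + (l : ℚ) - 3) / (2 * ((i : ℚ) + 1) - 1)) ^ 2 := by
  have h := abs_sum_fw n l hl
  rw [← ast_sum hl, abs_of_nonneg (finsum_nonneg (fun A => by positivity))] at h
  rw [h, tau]
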